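/- arXiv:2307.10670 — 14 statements merged into one kernel-verified Lean document; each statement's English description precedes it below -/
import Mathlib

section
/- Let m, n be coprime integers and suppose L : ℝ⁴ → ℂ² is an ℝ-linear isomorphism such that ω_ℂ(Lu, Lv) = ω_ℝ(u, v) for all u, v ∈ ℝ⁴ and q_{m,n}(L(x₁,x₂,ξ₁,ξ₂)) = q₁(x₁,x₂,ξ₁,ξ₂) for all (x₁,x₂,ξ₁,ξ₂) ∈ ℝ⁴. Then {m, n} = {−1, 1}, and there exist ρ > 0, θ, ν ∈ ℝ and α ∈ (0, π) such that: if (m,n) = (1,−1), then L(x₁,x₂,ξ₁,ξ₂) = (ρe^{iθ}(x₁ + i x₂) + (e^{i(θ−α)}/(2ρ sin α))(ξ₁ + i ξ₂), ρe^{iν}(x₁ − i x₂) + (e^{i(ν−α)}/(2ρ sin α))(ξ₁ − i ξ₂)); and if (m,n) = (−1,1), then L(x₁,x₂,ξ₁,ξ₂) = (ρe^{iθ}(x₁ − i x₂) + (e^{i(θ−α)}/(2ρ sin α))(ξ₁ − i ξ₂), ρe^{iν}(x₁ + i x₂) + (e^{i(ν−α)}/(2ρ sin α))(ξ₁ + i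 ξ₂)). Conversely, every map of either displayed form (with ρ > 0, θ, ν ∈ ℝ, α ∈ (0,π)) is an ℝ-linear isomorphism satisfying both conditions for the corresponding (m,n) ∈ {(1,−1), (−1,1)}. -/
noncomputable section

/-- The standard symplectic form `ω_ℝ = dξ₁∧dx₁ + dξ₂∧dx₂` on ℝ⁴ with coordinates
`(x₁, x₂, ξ₁, ξ₂)`. -/
def omegaR (u v : ℝ × ℝ × ℝ × ℝ) : ℝ :=
  u.2.2.1 * v.1 - u.1 * v.2.2.1 + u.2.2.2 * v.2.1 - u.2.1 * v.2.2.2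

/-- The standard symplectic form `ω_ℂ = (i/2)(dz₁∧dz̄₁ + dz₂∧dz̄₂)` on ℂ². -/
def omegaC (u v : ℂ × ℂ) : ℝ :=
  ((starRingEnd ℂ u.1) * v.1).im + ((starRingEnd ℂ u.2) * v.2).im

/-- `q₁(x₁, x₂, ξ₁, ξ₂) = x₁ξ₂ − x₂ξ₁`. -/
def q1R (p : ℝ × ℝ × ℝ × ℝ) : ℝ := p.1 * p.2.2.2 - p.2.1 * p.2.2.1

/-- `q_{m,n}(z₁, z₂) = (m/2)|z₁|² + (n/2)|z₂|²`. -/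
def qmn (m n : ℤ) (z : ℂ × ℂ) : ℝ :=
  (m : ℝ)/2 * Complex.normSq z.1 + (n : ℝ)/2 * Complex.normSq z.2

/-- The normal form of the linear map for `(m, n) = (1, −1)`. -/
def formA (ρ θ ν α : ℝ) (p : ℝ × ℝ × ℝ × ℝ) : ℂ × ℂ :=
  ((ρ : ℂ) * Complex.exp ((θ : ℂ) * Complex.I) * ((p.1 : ℂ) + (p.2.1 : ℂ) * Complex.I)
      + Complex.exp (((θ - α : ℝ) : ℂ) * Complex.I) / ((2 * ρ * Real.sin α : ℝ) : ℂ)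
        * ((p.2.2.1 : ℂ) + (p.2.2.2 : ℂ) * Complex.I),
   (ρ : ℂ) * Complex.exp ((ν : ℂ) * Complex.I) * ((p.1 : ℂ) - (p.2.1 : ℂ) * Complex.I)
      + Complex.exp (((ν - α : ℝ) : ℂ) * Complex.I) / ((2 * ρ * Real.sin α : ℝ) : ℂ)
        * ((p.2.2.1 : ℂ) - (p.2.2.2 : ℂ) * Complex.I))

/-- The normal form of the linear map for `(m, n) = (−1, 1)`. -/
def formB (ρ θ ν α : ℝ) (p : ℝ × ℝ × ℝ × ℝ) : ℂ × ℂ :=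
  ((ρ : ℂ) * Complex.exp ((θ : ℂ) * Complex.I) * ((p.1 : ℂ) - (p.2.1 : ℂ) * Complex.I)
      + Complex.exp (((θ - α : ℝ) : ℂ) * Complex.I) / ((2 * ρ * Real.sin α : ℝ) : ℂ)
        * ((p.2.2.1 : ℂ) - (p.2.2.2 : ℂ) * Complex.I),
   (ρ : ℂ) * Complex.exp ((ν : ℂ) * Complex.I) * ((p.1 : ℂ) + (p.2.1 : ℂ) * Complex.I)
      + Complex.exp (((ν - α : ℝ) : ℂ) * Complex.I) / ((2 * ρ * Real.sin α : ℝ) : ℂ)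
        * ((p.2.2.1 : ℂ) + (p.2.2.2 : ℂ) * Complex.I))

/-- The general map with complex coefficients. -/
def genA (a b c d : ℂ) : (ℝ × ℝ × ℝ × ℝ) →ₗ[ℝ] (ℂ × ℂ) where
  toFun p := (a * ((p.1 : ℂ) + (p.2.1 : ℂ) * Complex.I)
      + b * ((p.2.2.1 : ℂ) + (p.2.2.2 : ℂ) * Complex.I),
    c * ((p.1 : ℂ) - (p.2.1 : ℂ) * Complex.I)
      + d * ((p.2.2.1 : ℂ) - (p.2.2.2 : ℂ) * Complex.I))
  map_add' p q := by
    ext1 <;> simp <;> ring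
  map_smul' r p := by
    ext1 <;> simp <;> ring

theorem genA_omega (a b c d : ℂ) (h1 : Complex.normSq a = Complex.normSq c)
    (h2 : Complex.normSq b = Complex.normSq d)
    (h3 : starRingEnd ℂ a * b - c * starRingEnd ℂ d = -Complex.I) (u v : ℝ × ℝ × ℝ × ℝ) :
    omegaC (genA a b c d u) (genA a b c d v) = omegaR u v := by
  obtain ⟨u1, u2, u3, u4⟩ := u
  obtain ⟨v1, v2, v3, v4⟩ := v
  have h4 := congrArg Complex.re h3
  have h5 := congrArg Complex.im h3
  simp [Complex.normSq_apply, omegaC, omegaR, genA] at *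
  linear_combination (u1 * v2 - u2 * v1) * h1 + (u3 * v4 - u4 * v3) * h2
    + (u1 * v4 - u2 * v3 + u3 * v2 - u4 * v1) * h4 + (u1 * v3 + u2 * v4 - u3 * v1 - u4 * v2) * h5

theorem genA_q (a b c d : ℂ) (h1 : Complex.normSq a = Complex.normSq c)
    (h2 : Complex.normSq b = Complex.normSq d)
    (h3 : starRingEnd ℂ a * b - c * starRingEnd ℂ d = -Complex.I) (u : ℝ × ℝ × ℝ × ℝ) :
    qmn 1 (-1) (genA a b c d u) = q1R u := by
  obtain ⟨u1, u2, u3, u4⟩ := u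
  have h4 := congrArg Complex.re h3
  have h5 := congrArg Complex.im h3
  simp [Complex.normSq_apply, qmn, q1R, genA] at *
  linear_combination (u1 ^ 2 + u2 ^ 2) / 2 * h1 + (u3 ^ 2 + u4 ^ 2) / 2 * h2
    + (u1 * u3 + u2 * u4) * h4 - (u1 * u4 - u2 * u3) * h5

theorem formA_eq (ρ θ ν α : ℝ) (p : ℝ × ℝ × ℝ × ℝ) :
    formA ρ θ ν α p = genA ((ρ : ℂ) * Complex.exp ((θ : ℂ) * Complex.I))
      (Complex.exp (((θ - α : ℝ) : ℂ) * Complex.I) / ((2 * ρ * Real.sin α : ℝ) : ℂ))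
      ((ρ : ℂ) * Complex.exp ((ν : ℂ) * Complex.I))
      (Complex.exp (((ν - α : ℝ) : ℂ) * Complex.I) / ((2 * ρ * Real.sin α : ℝ) : ℂ)) p := rfl

theorem formB_eq (ρ θ ν α : ℝ) (p : ℝ × ℝ × ℝ × ℝ) :
    formB ρ θ ν α p = (formA ρ ν θ α p).swap := rfl

theorem omegaC_swap (z w : ℂ × ℂ) : omegaC z.swap w.swap = omegaC z w := by
  simp only [omegaC, Prod.fst_swap, Prod.snd_swap]; ring

theorem qmn_swap (m n : ℤ) (z : ℂ × ℂ) : qmn m n z.swap = qmn n m z := by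
  simp only [qmn, Prod.fst_swap, Prod.snd_swap]; ring

theorem convA (ρ θ ν α : ℝ) (hρ : 0 < ρ) (h0 : 0 < α) (hpi : α < Real.pi) :
    ∃ L : (ℝ × ℝ × ℝ × ℝ) ≃ₗ[ℝ] (ℂ × ℂ),
        (∀ p, L p = formA ρ θ ν α p) ∧
        (∀ u v, omegaC (L u) (L v) = omegaR u v) ∧
        (∀ p, qmn 1 (-1) (L p) = q1R p) := by
  have hs : 0 < Real.sin α := Real.sin_pos_of_pos_of_lt_pi h0 hpi
  have hconj : ∀ t : ℝ, starRingEnd ℂ (Complex.exp ((t : ℂ) * Complex.I))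
      = Complex.exp (((-t : ℝ) : ℂ) * Complex.I) := by
    intro t
    rw [← Complex.exp_conj]; simp
  have hn : ∀ t : ℝ, Complex.normSq (Complex.exp ((t : ℂ) * Complex.I)) = 1 := by
    intro t
    rw [Complex.normSq_eq_norm_sq, Complex.norm_exp_ofReal_mul_I]; norm_num
  have h1 : Complex.normSq ((ρ : ℂ) * Complex.exp ((θ : ℂ) * Complex.I))
      = Complex.normSq ((ρ : ℂ) * Complex.exp ((ν : ℂ) * Complex.I)) := by
    simp only [Complex.normSq_mul, hn]
  have h2 : Complex.normSq (Complex.exp (((θ - α : ℝ) : ℂ) * Complex.I) / ((2 * ρ * Real.sin α : ℝ) : ℂ))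
      = Complex.normSq (Complex.exp (((ν - α : ℝ) : ℂ) * Complex.I) / ((2 * ρ * Real.sin α : ℝ) : ℂ)) := by
    simp only [Complex.normSq_div, hn]
  have h3 : starRingEnd ℂ ((ρ : ℂ) * Complex.exp ((θ : ℂ) * Complex.I))
      * (Complex.exp (((θ - α : ℝ) : ℂ) * Complex.I) / ((2 * ρ * Real.sin α : ℝ) : ℂ))
      - ((ρ : ℂ) * Complex.exp ((ν : ℂ) * Complex.I)) *
      starRingEnd ℂ (Complex.exp (((ν - α : ℝ) : ℂ) * Complex.I) / ((2 * ρ * Real.sin α : ℝ) : ℂ))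
      = -Complex.I := by
    have hρ' : (ρ : ℂ) ≠ 0 := by exact_mod_cast hρ.ne'
    have hs' : ((Real.sin α : ℝ) : ℂ) ≠ 0 := by exact_mod_cast hs.ne'
    have e1 : Complex.exp (((-θ : ℝ) : ℂ) * Complex.I) * Complex.exp (((θ - α : ℝ) : ℂ) * Complex.I)
        = Real.cos α - Real.sin α * Complex.I := by
      rw [← Complex.exp_add, ← add_mul, ← Complex.ofReal_add, Complex.exp_ofReal_mul_I,
        show -θ + (θ - α) = -α by ring, Real.cos_neg, Real.sin_neg]
      push_cast; ring
    have e2 : Complex.exp ((ν : ℂ) * Complex.I) * Complex.exp (((-(ν - α) : ℝ) : ℂ) * Complex.I)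
        = Real.cos α + Real.sin α * Complex.I := by
      rw [← Complex.exp_add, ← add_mul, ← Complex.ofReal_add, Complex.exp_ofReal_mul_I,
        show ν + -(ν - α) = α by ring]
    rw [map_mul, map_div₀, hconj, hconj, Complex.conj_ofReal, Complex.conj_ofReal]
    rw [show ((2 * ρ * Real.sin α : ℝ) : ℂ) = 2 * (ρ : ℂ) * ((Real.sin α : ℝ) : ℂ) by push_cast; ring]
    generalize ((Real.sin α : ℝ) : ℂ) = s at *
    generalize Complex.exp (((-θ : ℝ) : ℂ) * Complex.I) = E1 at *
    generalize Complex.exp (((θ - α : ℝ) : ℂ) * Complex.I) = E2 at *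
    generalize Complex.exp ((ν : ℂ) * Complex.I) = E3 at *
    generalize Complex.exp (((-(ν - α) : ℝ) : ℂ) * Complex.I) = E4 at *
    field_simp
    linear_combination e1 - e2
  have ho := genA_omega _ _ _ _ h1 h2 h3
  have hq := genA_q _ _ _ _ h1 h2 h3
  set G := genA ((ρ : ℂ) * Complex.exp ((θ : ℂ) * Complex.I))
      (Complex.exp (((θ - α : ℝ) : ℂ) * Complex.I) / ((2 * ρ * Real.sin α : ℝ) : ℂ))
      ((ρ : ℂ) * Complex.exp ((ν : ℂ) * Complex.I))
      (Complex.exp (((ν - α : ℝ) : ℂ) * Complex.I) / ((2 * ρ * Real.sin α : ℝ) : ℂ)) with hG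
  have hinj : Function.Injective G := by
    rw [← LinearMap.ker_eq_bot, LinearMap.ker_eq_bot']
    intro u hu
    have hz : ∀ v, omegaR u v = 0 := by
      intro v
      rw [← ho u v, hu]; simp [omegaC]
    obtain ⟨u1, u2, u3, u4⟩ := u
    have a1 := hz (1, 0, 0, 0)
    have a2 := hz (0, 1, 0, 0)
    have a3 := hz (0, 0, 1, 0)
    have a4 := hz (0, 0, 0, 1)
    simp [omegaR] at a1 a2 a3 a4
    simp [a1, a2, a3, a4]
  refine ⟨LinearMap.linearEquivOfInjective G hinj (by simp), ?_, ?_, ?_⟩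
  · intro p; rw [LinearMap.linearEquivOfInjective_apply, formA_eq]
  · intro u v; simp only [LinearMap.linearEquivOfInjective_apply]; exact ho u v
  · intro u; simp only [LinearMap.linearEquivOfInjective_apply]; exact hq u

/-- The map intertwines the Hamiltonian vector fields. -/
theorem intertwine (m n : ℤ) (L : (ℝ × ℝ × ℝ × ℝ) ≃ₗ[ℝ] (ℂ × ℂ))
    (ho : ∀ u v, omegaC (L u) (L v) = omegaR u v)
    (hq : ∀ p, qmn m n (L p) = q1R p) (u : ℝ × ℝ × ℝ × ℝ) :
    L (u.2.1, -u.1, u.2.2.2, -u.2.2.1)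
      = (-((m : ℝ) : ℂ) * Complex.I * (L u).1, -((n : ℝ) : ℂ) * Complex.I * (L u).2) := by
  have key : ∀ w, omegaC (L (u.2.1, -u.1, u.2.2.2, -u.2.2.1)) w =
      omegaC (-((m : ℝ) : ℂ) * Complex.I * (L u).1, -((n : ℝ) : ℂ) * Complex.I * (L u).2) w := by
    intro w
    obtain ⟨v, rfl⟩ := L.surjective w
    rw [ho]
    have h1 := hq (u + v)
    have h2 := hq u
    have h3 := hq v
    rw [map_add] at h1
    generalize L u = z at *
    generalize L v = w at *
    simp [qmn, q1R, omegaC, omegaR, Complex.normSq_apply] at *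
    linear_combination -h1 + h2 + h3
  generalize L (u.2.1, -u.1, u.2.2.2, -u.2.2.1) = z at *
  generalize (-((m : ℝ) : ℂ) * Complex.I * (L u).1, -((n : ℝ) : ℂ) * Complex.I * (L u).2) = y at *
  have k1 := key (1, 0)
  have k2 := key (Complex.I, 0)
  have k3 := key (0, 1)
  have k4 := key (0, Complex.I)
  simp [omegaC] at k1 k2 k3 k4
  ext1 <;> apply Complex.ext <;> assumption

theorem sq_eq_one_iff_eq (m : ℤ) (h : m ^ 2 = 1) : m = 1 ∨ m = -1 := by
  have : (m - 1) * (m + 1) = 0 := by linear_combination h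
  rcases mul_eq_zero.mp this with h | h
  · left; linarith
  · right; linarith

theorem signs (m n : ℤ) (L : (ℝ × ℝ × ℝ × ℝ) ≃ₗ[ℝ] (ℂ × ℂ))
    (ho : ∀ u v, omegaC (L u) (L v) = omegaR u v)
    (hq : ∀ p, qmn m n (L p) = q1R p) : (m = 1 ∧ n = -1) ∨ (m = -1 ∧ n = 1) := by
  have hsq : ∀ z : ℂ × ℂ, -z = (-((m : ℝ) : ℂ) ^ 2 * z.1, -((n : ℝ) : ℂ) ^ 2 * z.2) := by
    intro z
    obtain ⟨u, rfl⟩ := L.surjective z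
    have h1 := intertwine m n L ho hq u
    have h2 := intertwine m n L ho hq (u.2.1, -u.1, u.2.2.2, -u.2.2.1)
    rw [h1] at h2
    have h3 : ((-u.1, -u.2.1, -u.2.2.1, -u.2.2.2) : ℝ × ℝ × ℝ × ℝ) = -u := rfl
    simp only [h3, map_neg] at h2
    rw [h2]
    ext1
    · simp only; linear_combination ((m : ℝ) : ℂ) ^ 2 * (L u).1 * Complex.I_sq
    · simp only; linear_combination ((n : ℝ) : ℂ) ^ 2 * (L u).2 * Complex.I_sq
  have hm := congrArg (fun z => z.1) (hsq (1, 1))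
  have hn := congrArg (fun z => z.2) (hsq (1, 1))
  simp only [Prod.fst_neg, Prod.snd_neg, mul_one, neg_inj] at hm hn
  have hm' : m ^ 2 = 1 := by exact_mod_cast hm.symm
  have hn' : n ^ 2 = 1 := by exact_mod_cast hn.symm
  have p1 := hq (1, 0, 0, 1)
  have p2 := hq (1, 0, 0, -1)
  have c1 := Complex.normSq_nonneg (L (1, 0, 0, 1)).1
  have c2 := Complex.normSq_nonneg (L (1, 0, 0, 1)).2
  have c3 := Complex.normSq_nonneg (L (1, 0, 0, -1)).1
  have c4 := Complex.normSq_nonneg (L (1, 0, 0, -1)).2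
  rcases (sq_eq_one_iff_eq m hm') with rfl | rfl <;>
  rcases (sq_eq_one_iff_eq n hn') with rfl | rfl
  · simp [qmn, q1R] at p1 p2; linarith
  · simp
  · simp
  · simp [qmn, q1R] at p1 p2; linarith

theorem fwdA (L : (ℝ × ℝ × ℝ × ℝ) ≃ₗ[ℝ] (ℂ × ℂ))
    (ho : ∀ u v, omegaC (L u) (L v) = omegaR u v)
    (hq : ∀ p, qmn 1 (-1) (L p) = q1R p) :
    ∃ ρ θ ν α : ℝ, 0 < ρ ∧ 0 < α ∧ α < Real.pi ∧ ∀ p, L p = formA ρ θ ν α p := by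
  obtain ⟨a, c, hac⟩ : ∃ a c, L (1, 0, 0, 0) = (a, c) := ⟨_, _, rfl⟩
  obtain ⟨b, d, hbd⟩ : ∃ b d, L (0, 0, 1, 0) = (b, d) := ⟨_, _, rfl⟩
  have i1 := intertwine 1 (-1) L ho hq (1, 0, 0, 0)
  have i2 := intertwine 1 (-1) L ho hq (0, 0, 1, 0)
  have hL : ∀ p, L p = genA a b c d p := by
    intro p
    obtain ⟨p1, p2, p3, p4⟩ := p
    have hp : ((p1, p2, p3, p4) : ℝ × ℝ × ℝ × ℝ) = p1 • (1, 0, 0, 0) + (-p2) • (0, -1, 0, 0)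
      + p3 • (0, 0, 1, 0) + (-p4) • (0, 0, 0, -1) := by simp
    simp only [neg_zero] at i1 i2
    rw [hp, map_add, map_add, map_add, map_smul, map_smul, map_smul, map_smul, i1, i2, hac, hbd]
    ext1 <;> simp [genA] <;> ring
  have q1 := hq (1, 0, 0, 0)
  have q2 := hq (0, 0, 1, 0)
  have q3 := hq (1, 0, 1, 0)
  have q4 := hq (1, 0, 0, 1)
  rw [hL] at q1 q2 q3 q4
  have hab1 : Complex.normSq a = Complex.normSq c := by
    simp [genA, qmn, q1R] at q1; linarith
  have hbd1 : Complex.normSq b = Complex.normSq d := by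
    simp [genA, qmn, q1R] at q2; linarith
  -- w = conj a * b
  have hre : (starRingEnd ℂ a * b).re = (starRingEnd ℂ c * d).re := by
    simp [genA, qmn, q1R, Complex.normSq_apply] at *; linarith
  have him : (starRingEnd ℂ a * b).im + (starRingEnd ℂ c * d).im = -1 := by
    simp [genA, qmn, q1R, Complex.normSq_apply] at *; linarith
  have hnw : Complex.normSq (starRingEnd ℂ a * b) = Complex.normSq (starRingEnd ℂ c * d) := by
    simp only [Complex.normSq_mul, Complex.normSq_conj, hab1, hbd1]
  have him2 : (starRingEnd ℂ a * b).im = (starRingEnd ℂ c * d).im := by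
    rw [Complex.normSq_apply, Complex.normSq_apply, hre] at hnw
    linear_combination -hnw - ((starRingEnd ℂ a * b).im - (starRingEnd ℂ c * d).im) * (-him)
  have hww : starRingEnd ℂ a * b = starRingEnd ℂ c * d := Complex.ext hre him2
  have himw : (starRingEnd ℂ a * b).im = -(1 / 2) := by linarith
  have ha : a ≠ 0 := by
    rintro rfl; simp at himw
  have hc : c ≠ 0 := by
    rintro rfl; rw [hww] at himw; simp at himw
  have hρ : 0 < ‖a‖ := norm_pos_iff.mpr ha
  have hnac : ‖a‖ = ‖c‖ := by
    rw [Complex.normSq_eq_norm_sq, Complex.normSq_eq_norm_sq] at hab1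
    exact (sq_eq_sq₀ (norm_nonneg _) (norm_nonneg _)).mp hab1
  obtain ⟨w, hw⟩ : ∃ w, w = starRingEnd ℂ a * b := ⟨_, rfl⟩
  rw [← hw] at hww himw
  have harg : w.arg < 0 := Complex.arg_neg_iff.mpr (by rw [himw]; norm_num)
  have harg2 := Complex.neg_pi_lt_arg w
  have hsin : Real.sin (-w.arg) * ‖w‖ = 1 / 2 := by
    have := Complex.norm_mul_sin_arg w
    rw [Real.sin_neg]; linarith
  have hspos : 0 < Real.sin (-w.arg) := Real.sin_pos_of_pos_of_lt_pi (by linarith) (by linarith)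
  have gen : ∀ a b : ℂ, a ≠ 0 → w = starRingEnd ℂ a * b →
      Complex.exp (((a.arg - -w.arg : ℝ) : ℂ) * Complex.I) /
        ((2 * ‖a‖ * Real.sin (-w.arg) : ℝ) : ℂ) = b := by
    intro a b ha hw
    have hρ : 0 < ‖a‖ := norm_pos_iff.mpr ha
    have e1 := Complex.norm_mul_exp_arg_mul_I a
    have e2 := Complex.norm_mul_exp_arg_mul_I w
    have e3 : Complex.exp (((a.arg - -w.arg : ℝ) : ℂ) * Complex.I)
      = Complex.exp (a.arg * Complex.I) * Complex.exp (w.arg * Complex.I) := by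
      rw [← Complex.exp_add]; congr 1; push_cast; ring
    have e4 : a * starRingEnd ℂ a = (‖a‖ : ℂ) ^ 2 := by
      rw [Complex.mul_conj, Complex.normSq_eq_norm_sq]; push_cast; rfl
    have hsin' : ((Real.sin (-w.arg) : ℝ) : ℂ) * (‖w‖ : ℂ) = 1 / 2 := by
      rw [← Complex.ofReal_mul, hsin]; norm_num
    have hρ' : (‖a‖ : ℂ) ≠ 0 := by exact_mod_cast hρ.ne'
    have hs' : ((Real.sin (-w.arg) : ℝ) : ℂ) ≠ 0 := by exact_mod_cast hspos.ne'
    have hwn : (‖w‖ : ℂ) ≠ 0 := by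
      intro h; rw [h] at hsin'; norm_num at hsin'
    rw [e3, show ((2 * ‖a‖ * Real.sin (-w.arg) : ℝ) : ℂ)
      = 2 * (‖a‖ : ℂ) * ((Real.sin (-w.arg) : ℝ) : ℂ) by push_cast; ring]
    rw [div_eq_iff (by simp only [ne_eq, mul_eq_zero, hρ', hs', or_false]; norm_num)]
    apply mul_left_cancel₀ (mul_ne_zero hρ' hwn)
    generalize ((Real.sin (-w.arg) : ℝ) : ℂ) = s at *
    generalize Complex.exp (a.arg * Complex.I) = E at *
    generalize Complex.exp (w.arg * Complex.I) = F at *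
    have : (‖a‖ : ℂ) * ‖w‖ * (E * F) = (‖a‖ : ℂ) ^ 2 * b := by
      rw [← e4]
      calc (‖a‖ : ℂ) * ‖w‖ * (E * F) = (‖a‖ * E) * (‖w‖ * F) := by ring
        _ = a * w := by rw [e1, e2]
        _ = a * (starRingEnd ℂ a * b) := by rw [← hw]
        _ = _ := by ring
    rw [this]
    linear_combination -2 * (‖a‖ : ℂ) ^ 2 * b * hsin'
  refine ⟨‖a‖, a.arg, c.arg, -w.arg, hρ, by linarith, by linarith, ?_⟩
  intro p
  rw [formA_eq, gen a b ha hw, Complex.norm_mul_exp_arg_mul_I, hnac, gen c d hc hww,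
    Complex.norm_mul_exp_arg_mul_I, hL]

/-- Classification of the ℝ-linear isomorphisms `L : ℝ⁴ → ℂ²` intertwining the standard
symplectic forms and carrying `q_{m,n}` to the focus-focus component `q₁`: necessarily
`{m, n} = {−1, 1}` and `L` has one of the two displayed normal forms; conversely every
map of either displayed form is such an isomorphism. -/
theorem stmt0 :
    (∀ m n : ℤ, IsCoprime m n →
      ∀ L : (ℝ × ℝ × ℝ × ℝ) ≃ₗ[ℝ] (ℂ × ℂ),
        (∀ u v, omegaC (L u) (L v) = omegaR u v) →
        (∀ p, qmn m n (L p) = q1R p) →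
        ((m = 1 ∧ n = -1) ∨ (m = -1 ∧ n = 1)) ∧
        ∃ ρ θ ν α : ℝ, 0 < ρ ∧ 0 < α ∧ α < Real.pi ∧
          ((m = 1 ∧ n = -1) → ∀ p, L p = formA ρ θ ν α p) ∧
          ((m = -1 ∧ n = 1) → ∀ p, L p = formB ρ θ ν α p)) ∧
    (∀ ρ θ ν α : ℝ, 0 < ρ → 0 < α → α < Real.pi →
      (∃ L : (ℝ × ℝ × ℝ × ℝ) ≃ₗ[ℝ] (ℂ × ℂ),
        (∀ p, L p = formA ρ θ ν α p) ∧
        (∀ u v, omegaC (L u) (L v) = omegaR u v) ∧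
        (∀ p, qmn 1 (-1) (L p) = q1R p)) ∧
      (∃ L : (ℝ × ℝ × ℝ × ℝ) ≃ₗ[ℝ] (ℂ × ℂ),
        (∀ p, L p = formB ρ θ ν α p) ∧
        (∀ u v, omegaC (L u) (L v) = omegaR u v) ∧
        (∀ p, qmn (-1) 1 (L p) = q1R p))) := by
  refine ⟨?_, ?_⟩
  · intro m n _ L ho hq
    have hs := signs m n L ho hq
    refine ⟨hs, ?_⟩
    rcases hs with ⟨rfl, rfl⟩ | ⟨rfl, rfl⟩
    · obtain ⟨ρ, θ, ν, α, h1, h2, h3, h4⟩ := fwdA L ho hq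
      exact ⟨ρ, θ, ν, α, h1, h2, h3, fun _ => h4, fun h => absurd h.1 (by norm_num)⟩
    · obtain ⟨ρ, θ, ν, α, h1, h2, h3, h4⟩ := fwdA (L.trans (LinearEquiv.prodComm ℝ ℂ ℂ))
        (fun u v => (omegaC_swap (L u) (L v)).trans (ho u v))
        (fun p => (qmn_swap 1 (-1) (L p)).trans (hq p))
      refine ⟨ρ, ν, θ, α, h1, h2, h3, fun h => absurd h.1 (by norm_num), fun _ p => ?_⟩
      rw [formB_eq, ← h4 p]
      rfl
  · intro ρ θ ν α hρ h0 hpi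
    refine ⟨convA ρ θ ν α hρ h0 hpi, ?_⟩
    obtain ⟨L, h1, h2, h3⟩ := convA ρ ν θ α hρ h0 hpi
    refine ⟨L.trans (LinearEquiv.prodComm ℝ ℂ ℂ), fun p => ?_,
      fun u v => (omegaC_swap (L u) (L v)).trans (h2 u v),
      fun p => (qmn_swap (-1) 1 (L p)).trans (h3 p)⟩
    rw [formB_eq, ← h1 p]
    rfl

end
end

section
/- Let m, n be coprime integers and let L : ℝ⁴ → ℂ² be an ℝ-linear isomorphism with ω_ℂ(Lu, Lv) = ω_ℝ(u, v) for all u, v ∈ ℝ⁴ and q_{m,n} ∘ L = q₁ (so by the companion lemma {m,n} = {−1,1}). Then there exist λ ≥ 1, φ ∈ ℝ and η ∈ {−1, 1} such that for all (z₁, z₂) ∈ ℂ², q₂(L⁻¹(z₁,z₂)) = λ·Re(e^{iφ} z₁ z₂) + η·(√(λ² − 1)/2)·(|z₁|² + |z₂|²). Conversely, for every λ ≥ 1, φ ∈ ℝ and η ∈ {−1,1} there exists such an L for which q₂ ∘ L⁻¹ is the displayed quadratic form. -/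
noncomputable section

/-- `q₂(x₁, x₂, ξ₁, ξ₂) = x₁ξ₁ + x₂ξ₂`. -/
def q2R (p : ℝ × ℝ × ℝ × ℝ) : ℝ := p.1 * p.2.2.1 + p.2.1 * p.2.2.2

lemma conv_aux (b1 b2 t : ℝ) (hb : b1^2 + b2^2 = 1) :
    ∃ L : (ℝ × ℝ × ℝ × ℝ) ≃ₗ[ℝ] (ℂ × ℂ),
      (∀ u v, omegaC (L u) (L v) = omegaR u v) ∧
      (∀ p, qmn 1 (-1) (L p) = q1R p) ∧
      ∀ z : ℂ × ℂ, q2R (L.symm z) =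
        ((⟨b1, -b2⟩ : ℂ) * ⟨t, 1⟩ * z.1 * z.2).re
          + t / 2 * (Complex.normSq z.1 + Complex.normSq z.2) := by
  have hb' : b1^2 = 1 - b2^2 := by linarith
  refine ⟨
    { toFun := fun p => (⟨p.1/2 - t*p.2.1/2 + p.2.2.2, p.2.1/2 + t*p.1/2 - p.2.2.1⟩,
        ⟨-b2*((t*p.1-p.2.1)/2 - p.2.2.1) + b1*((t*p.2.1+p.1)/2 - p.2.2.2),
          b2*((t*p.2.1+p.1)/2 - p.2.2.2) + b1*((t*p.1-p.2.1)/2 - p.2.2.1)⟩)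
      invFun := fun z => (z.1.re + (b1*z.2.re + b2*z.2.im),
        z.1.im + (b2*z.2.re - b1*z.2.im),
        (t*z.1.re - z.1.im)/2 + (t*(b1*z.2.re + b2*z.2.im) + (b2*z.2.re - b1*z.2.im))/2,
        (t*z.1.im + z.1.re)/2 + (t*(b2*z.2.re - b1*z.2.im) - (b1*z.2.re + b2*z.2.im))/2)
      map_add' := ?_
      map_smul' := ?_
      left_inv := ?_
      right_inv := ?_ }, ?_, ?_, ?_⟩
  · intro x y
    refine Prod.ext (Complex.ext ?_ ?_) (Complex.ext ?_ ?_) <;> simp <;> ring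
  · intro r y
    refine Prod.ext (Complex.ext ?_ ?_) (Complex.ext ?_ ?_) <;> simp <;> ring
  · rintro ⟨x1, x2, y1, y2⟩
    ext <;> simp <;> ring_nf <;> (try simp only [hb']) <;> ring
  · rintro ⟨⟨a1, a2⟩, ⟨c1, c2⟩⟩
    refine Prod.ext (Complex.ext ?_ ?_) (Complex.ext ?_ ?_) <;> simp <;> ring_nf <;> (try simp only [hb']) <;> ring
  · rintro ⟨x1, x2, y1, y2⟩ ⟨u1, u2, v1, v2⟩
    simp [omegaC, omegaR]
    ring_nf
    simp only [hb']
    ring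
  · rintro ⟨x1, x2, y1, y2⟩
    simp [qmn, q1R, Complex.normSq_apply]
    ring_nf
    simp only [hb']
    ring
  · rintro ⟨⟨a1, a2⟩, ⟨c1, c2⟩⟩
    simp [q2R, Complex.normSq_apply]
    ring_nf
    simp only [hb']
    ring

lemma conv_main (lam φ η : ℝ) (hl : 1 ≤ lam) (hη : η = 1 ∨ η = -1) :
    ∃ m n : ℤ, IsCoprime m n ∧
        ∃ L : (ℝ × ℝ × ℝ × ℝ) ≃ₗ[ℝ] (ℂ × ℂ),
          (∀ u v, omegaC (L u) (L v) = omegaR u v) ∧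
          (∀ p, qmn m n (L p) = q1R p) ∧
          ∀ z : ℂ × ℂ,
            q2R (L.symm z) =
              lam * (Complex.exp ((φ : ℂ) * Complex.I) * z.1 * z.2).re
                + η * (Real.sqrt (lam^2 - 1) / 2)
                  * (Complex.normSq z.1 + Complex.normSq z.2) := by
  obtain ⟨t, ht⟩ : ∃ t, t = η * Real.sqrt (lam^2 - 1) := ⟨_, rfl⟩
  have ht2 : t^2 = lam^2 - 1 := by
    have h1 : η^2 = 1 := by rcases hη with h | h <;> rw [h] <;> norm_num
    rw [ht, mul_pow, h1, Real.sq_sqrt (by nlinarith)]; ring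
  have hl0 : lam ≠ 0 := by linarith
  have hcs := Real.sin_sq_add_cos_sq φ
  obtain ⟨L, h1, h2, h3⟩ := conv_aux ((Real.cos φ * t + Real.sin φ) / lam)
    ((Real.cos φ - Real.sin φ * t) / lam) t (by
      field_simp
      linear_combination (t^2+1) * hcs + ht2)
  refine ⟨1, -1, by exact isCoprime_one_left, L, h1, h2, fun z => ?_⟩
  have key : ((⟨(Real.cos φ * t + Real.sin φ) / lam, -((Real.cos φ - Real.sin φ * t) / lam)⟩ : ℂ)
      * ⟨t, 1⟩) = (lam : ℂ) * Complex.exp ((φ : ℂ) * Complex.I) := by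
    apply Complex.ext
    · simp only [Complex.mul_re, Complex.ofReal_re, Complex.ofReal_im,
        Complex.exp_ofReal_mul_I_re, Complex.exp_ofReal_mul_I_im]
      field_simp
      linear_combination Real.cos φ * ht2
    · simp only [Complex.mul_im, Complex.ofReal_re, Complex.ofReal_im,
        Complex.exp_ofReal_mul_I_re, Complex.exp_ofReal_mul_I_im]
      field_simp
      linear_combination Real.sin φ * ht2
  rw [h3, key, mul_assoc, mul_assoc, Complex.re_ofReal_mul, ← mul_assoc, ht]
  ring

lemma omegaC_nondeg (a b : ℂ × ℂ) (h : ∀ w, omegaC a w = omegaC b w) : a = b := by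
  have h1 := h (1, 0)
  have h2 := h (Complex.I, 0)
  have h3 := h (0, 1)
  have h4 := h (0, Complex.I)
  simp [omegaC] at h1 h2 h3 h4
  exact Prod.ext (Complex.ext h2 h1) (Complex.ext h4 h3)

/-- Hamiltonian map of `q₁`. -/
def A1 (u : ℝ × ℝ × ℝ × ℝ) : ℝ × ℝ × ℝ × ℝ := (u.2.1, -u.1, u.2.2.2, -u.2.2.1)

/-- Hamiltonian map of `q₂`. -/
def A2 : (ℝ × ℝ × ℝ × ℝ) →ₗ[ℝ] ℝ × ℝ × ℝ × ℝ where
  toFun u := (-u.1, -u.2.1, u.2.2.1, u.2.2.2)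
  map_add' x y := by ext <;> simp <;> ring
  map_smul' r x := by ext <;> simp

/-- Hamiltonian map of `q_{m,n}`. -/
def DD (m n : ℤ) (z : ℂ × ℂ) : ℂ × ℂ := (-(Complex.I * m * z.1), -(Complex.I * n * z.2))

lemma fwd_D (m n : ℤ) (L : (ℝ × ℝ × ℝ × ℝ) ≃ₗ[ℝ] (ℂ × ℂ))
    (h1 : ∀ u v, omegaC (L u) (L v) = omegaR u v)
    (h2 : ∀ p, qmn m n (L p) = q1R p) (u) : L (A1 u) = DD m n (L u) := by
  apply omegaC_nondeg
  intro w
  obtain ⟨v, rfl⟩ := L.surjective w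
  rw [h1]
  have e1 : omegaR (A1 u) v = q1R (u + v) - q1R u - q1R v := by
    simp [omegaR, A1, q1R]; ring
  rw [e1, ← h2, ← h2, ← h2, map_add]
  simp [omegaC, DD, qmn, Complex.normSq_apply]
  ring

lemma fwd_mn (m n : ℤ) (L : (ℝ × ℝ × ℝ × ℝ) ≃ₗ[ℝ] (ℂ × ℂ))
    (h1 : ∀ u v, omegaC (L u) (L v) = omegaR u v)
    (h2 : ∀ p, qmn m n (L p) = q1R p) : (m = 1 ∧ n = -1) ∨ (m = -1 ∧ n = 1) := by
  have hD := fwd_D m n L h1 h2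
  have hDD : ∀ z, DD m n (DD m n z) = -z := by
    intro z
    obtain ⟨u, rfl⟩ := L.surjective z
    rw [← hD, ← hD, ← map_neg]
    congr 1
  have hm : m = 1 ∨ m = -1 := by
    have h := congrArg (fun z => z.1.re) (hDD (1, 0))
    simp [DD] at h
    have h' : m * m = 1 := by exact_mod_cast h
    exact mul_self_eq_one_iff.mp h'
  have hn : n = 1 ∨ n = -1 := by
    have h := congrArg (fun z => z.2.re) (hDD (0, 1))
    simp [DD] at h
    have h' : n * n = 1 := by exact_mod_cast h
    exact mul_self_eq_one_iff.mp h'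
  have p1 := h2 (1, 0, 0, 1)
  have p2 := h2 (1, 0, 0, -1)
  simp only [qmn, q1R] at p1 p2
  have a1 := Complex.normSq_nonneg (L (1, 0, 0, 1)).1
  have a2 := Complex.normSq_nonneg (L (1, 0, 0, 1)).2
  have a3 := Complex.normSq_nonneg (L (1, 0, 0, -1)).1
  have a4 := Complex.normSq_nonneg (L (1, 0, 0, -1)).2
  rcases hm with rfl | rfl <;> rcases hn with rfl | rfl
  · push_cast at p1 p2; linarith
  · simp
  · simp
  · push_cast at p1 p2; linarith

lemma fwd_main (m n : ℤ) (L : (ℝ × ℝ × ℝ × ℝ) ≃ₗ[ℝ] (ℂ × ℂ))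
    (h1 : ∀ u v, omegaC (L u) (L v) = omegaR u v)
    (h2 : ∀ p, qmn m n (L p) = q1R p) :
        ∃ lam φ η : ℝ, 1 ≤ lam ∧ (η = 1 ∨ η = -1) ∧
          ∀ z : ℂ × ℂ,
            q2R (L.symm z) =
              lam * (Complex.exp ((φ : ℂ) * Complex.I) * z.1 * z.2).re
                + η * (Real.sqrt (lam^2 - 1) / 2)
                  * (Complex.normSq z.1 + Complex.normSq z.2) := by
  have hD := fwd_D m n L h1 h2
  have hmn := fwd_mn m n L h1 h2
  obtain ⟨N, hN⟩ : ∃ N : (ℂ × ℂ) →ₗ[ℝ] (ℂ × ℂ), ∀ u, N (L u) = L (A2 u) :=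
    ⟨L.toLinearMap ∘ₗ A2 ∘ₗ L.symm.toLinearMap, fun u => by simp⟩
  have hNN : ∀ z, N (N z) = z := by
    intro z
    obtain ⟨u, rfl⟩ := L.surjective z
    rw [hN, hN]
    congr 1
    ext <;> simp [A2]
  have hND : ∀ z, N (DD m n z) = DD m n (N z) := by
    intro z
    obtain ⟨u, rfl⟩ := L.surjective z
    rw [← hD, hN, hN, ← hD]
    congr 1
  have hNs : ∀ z w, omegaC (N z) w = omegaC (N w) z := by
    intro z w
    obtain ⟨u, rfl⟩ := L.surjective z
    obtain ⟨v, rfl⟩ := L.surjective w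
    rw [hN, hN, h1, h1]
    simp [omegaR, A2]; ring
  have hq : ∀ z, q2R (L.symm z) = omegaC (N z) z / 2 := by
    intro z
    obtain ⟨u, rfl⟩ := L.surjective z
    rw [hN, h1]
    simp [omegaR, A2, q2R]; ring
  clear hD h1 h2 hN
  obtain ⟨a, b, hab⟩ : ∃ a b, N (1, 0) = (a, b) := ⟨_, _, rfl⟩
  obtain ⟨c, d, hcd⟩ : ∃ c d, N (0, 1) = (c, d) := ⟨_, _, rfl⟩
  have hI1 : N (Complex.I, 0) = (Complex.I * a, -(Complex.I * b)) := by
    have h := hND (1, 0)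
    rw [hab] at h
    rcases hmn with ⟨rfl, rfl⟩ | ⟨rfl, rfl⟩
    · have e : DD 1 (-1) (1, 0) = -(Complex.I, 0) := by simp [DD]
      rw [e, map_neg] at h
      rw [← neg_neg (N _), h]; simp [DD]
    · have e : DD (-1) 1 (1, 0) = (Complex.I, 0) := by simp [DD]
      rw [e] at h
      rw [h]; simp [DD]
  have hI2 : N (0, Complex.I) = (-(Complex.I * c), Complex.I * d) := by
    have h := hND (0, 1)
    rw [hcd] at h
    rcases hmn with ⟨rfl, rfl⟩ | ⟨rfl, rfl⟩
    · have e : DD 1 (-1) (0, 1) = (0, Complex.I) := by simp [DD]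
      rw [e] at h
      rw [h]; simp [DD]
    · have e : DD (-1) 1 (0, 1) = -(0, Complex.I) := by simp [DD]
      rw [e, map_neg] at h
      rw [← neg_neg (N _), h]; simp [DD]
  have hform : ∀ z : ℂ × ℂ, N z = (a * z.1 + c * starRingEnd ℂ z.2,
      b * starRingEnd ℂ z.1 + d * z.2) := by
    rintro ⟨⟨x, y⟩, ⟨u, v⟩⟩
    have e : (((⟨x, y⟩ : ℂ), (⟨u, v⟩ : ℂ)) : ℂ × ℂ) = x • ((1, 0) : ℂ × ℂ)
        + y • ((Complex.I, 0) : ℂ × ℂ) + u • ((0, 1) : ℂ × ℂ)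
        + v • ((0, Complex.I) : ℂ × ℂ) := by
      refine Prod.ext (Complex.ext ?_ ?_) (Complex.ext ?_ ?_) <;> simp
    conv_lhs => rw [e]
    simp only [map_add, map_smul, hab, hcd, hI1, hI2]
    refine Prod.ext (Complex.ext ?_ ?_) (Complex.ext ?_ ?_) <;> simp <;> ring
  have s1 := hNs (1, 0) (Complex.I, 0)
  have s2 := hNs (0, 1) (0, Complex.I)
  have s3 := hNs (1, 0) (0, 1)
  have s4 := hNs (1, 0) (0, Complex.I)
  simp [hform, omegaC] at s1 s2 s3 s4
  have ha : a.re = 0 := by linarith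
  have hd : d.re = 0 := by linarith
  have hbc : b = c := by apply Complex.ext <;> linarith
  subst hbc
  have n1 := hNN (1, 0)
  rw [hform, hform] at n1
  simp [Complex.ext_iff, ha, hd] at n1
  obtain ⟨⟨n1, n2⟩, n3, n4⟩ := n1
  have hlam : ‖b‖^2 = 1 + a.im^2 := by
    rw [Complex.sq_norm, Complex.normSq_apply]; linarith
  have had : d.im = a.im := by
    have e : (d.im - a.im)^2 * (1 + a.im^2) = 0 := by
      rw [← hlam, Complex.sq_norm, Complex.normSq_apply]
      linear_combination (d.im - a.im) * b.re * n4 - (d.im - a.im) * b.im * n3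
    have : (d.im - a.im)^2 = 0 := by
      rcases mul_eq_zero.mp e with h | h
      · exact h
      · nlinarith [sq_nonneg a.im]
    have := pow_eq_zero_iff (two_ne_zero) |>.mp this
    linarith
  have hpolar : (‖b‖ : ℂ) * Complex.exp ((Complex.arg (-Complex.I * starRingEnd ℂ b) : ℂ) * Complex.I)
      = -Complex.I * starRingEnd ℂ b := by
    have h := Complex.norm_mul_exp_arg_mul_I (-Complex.I * starRingEnd ℂ b)
    simpa using h
  obtain ⟨η, hη, hηa⟩ : ∃ η : ℝ, (η = 1 ∨ η = -1) ∧ η * Real.sqrt (‖b‖^2 - 1) = -a.im := by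
    have e : ‖b‖^2 - 1 = a.im^2 := by linarith
    rw [e, Real.sqrt_sq_eq_abs]
    rcases abs_choice a.im with h | h <;> rw [h]
    · exact ⟨-1, by simp, by ring⟩
    · exact ⟨1, by simp, by ring⟩
  refine ⟨‖b‖, Complex.arg (-Complex.I * starRingEnd ℂ b), η, ?_, hη, ?_⟩
  · nlinarith [norm_nonneg b, sq_nonneg a.im]
  · intro z
    rw [← Complex.re_ofReal_mul, ← mul_assoc, ← mul_assoc, hpolar, ← mul_div_assoc, hηa, hq, hform]
    simp [omegaC, Complex.normSq_apply, ha, hd, had]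
    ring

/-- If `L : ℝ⁴ → ℂ²` is an ℝ-linear isomorphism intertwining the symplectic forms and
carrying `q_{m,n}` (with `m, n` coprime) to `q₁`, then `q₂ ∘ L⁻¹` has the normal form
`λ·Re(e^{iφ}z₁z₂) + η(√(λ² − 1)/2)(|z₁|² + |z₂|²)` for some `λ ≥ 1`, `φ ∈ ℝ`,
`η ∈ {−1, 1}`; conversely every such normal form arises this way. -/
theorem stmt1 :
    (∀ m n : ℤ, IsCoprime m n →
      ∀ L : (ℝ × ℝ × ℝ × ℝ) ≃ₗ[ℝ] (ℂ × ℂ),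
        (∀ u v, omegaC (L u) (L v) = omegaR u v) →
        (∀ p, qmn m n (L p) = q1R p) →
        ∃ lam φ η : ℝ, 1 ≤ lam ∧ (η = 1 ∨ η = -1) ∧
          ∀ z : ℂ × ℂ,
            q2R (L.symm z) =
              lam * (Complex.exp ((φ : ℂ) * Complex.I) * z.1 * z.2).re
                + η * (Real.sqrt (lam^2 - 1) / 2)
                  * (Complex.normSq z.1 + Complex.normSq z.2)) ∧
    (∀ lam φ η : ℝ, 1 ≤ lam → (η = 1 ∨ η = -1) →
      ∃ m n : ℤ, IsCoprime m n ∧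
        ∃ L : (ℝ × ℝ × ℝ × ℝ) ≃ₗ[ℝ] (ℂ × ℂ),
          (∀ u v, omegaC (L u) (L v) = omegaR u v) ∧
          (∀ p, qmn m n (L p) = q1R p) ∧
          ∀ z : ℂ × ℂ,
            q2R (L.symm z) =
              lam * (Complex.exp ((φ : ℂ) * Complex.I) * z.1 * z.2).re
                + η * (Real.sqrt (lam^2 - 1) / 2)
                  * (Complex.normSq z.1 + Complex.normSq z.2)) := by
  exact ⟨fun m n _ L h1 h2 => fwd_main m n L h1 h2,
    fun lam φ η hl hη => conv_main lam φ η hl hη⟩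

end
end

section
/- A smooth function H : ℂ² → ℝ satisfies {q₁, H} = 0 identically, H(0) = 0 and dH(0) = 0 if and only if there exist μ₁, μ₂, μ₃, ψ ∈ ℝ and a smooth function R₃ : ℂ² → ℝ with {q₁, R₃} = 0 identically and R₃(z) = O(‖z‖³) as z → 0, such that H(z₁, z₂) = μ₁·Re(e^{iψ} z₁ z₂) + μ₂|z₁|² + μ₃|z₂|² + R₃(z₁, z₂) for all (z₁, z₂) ∈ ℂ². -/
open Topology Asymptotics

/-- The Poisson bracket on ℂ² ≅ ℝ⁴ for the symplectic form
`ω_ℂ = dx₁∧dy₁ + dx₂∧dy₂`: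
`{F, G} = Σ_k (∂F/∂x_k · ∂G/∂y_k − ∂F/∂y_k · ∂G/∂x_k)`. -/
noncomputable def poisson (F G : ℂ × ℂ → ℝ) (z : ℂ × ℂ) : ℝ :=
  fderiv ℝ F z (1, 0) * fderiv ℝ G z (Complex.I, 0)
    - fderiv ℝ F z (Complex.I, 0) * fderiv ℝ G z (1, 0)
    + fderiv ℝ F z (0, 1) * fderiv ℝ G z (0, Complex.I)
    - fderiv ℝ F z (0, Complex.I) * fderiv ℝ G z (0, 1)

/-- `q₁(z₁, z₂) = ε(|z₁|² − |z₂|²)/2`. -/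
noncomputable def q1C (ε : ℝ) (z : ℂ × ℂ) : ℝ :=
  ε * (Complex.normSq z.1 - Complex.normSq z.2) / 2

/-- The generator of the circle action. -/
noncomputable def rotGen (z : ℂ × ℂ) : ℂ × ℂ := (Complex.I * z.1, -(Complex.I * z.2))

lemma rotGen_eq (z : ℂ × ℂ) : rotGen z =
    z.1.re • ((Complex.I, 0) : ℂ × ℂ) - z.1.im • ((1, 0) : ℂ × ℂ)
    - z.2.re • ((0, Complex.I) : ℂ × ℂ) + z.2.im • ((0, 1) : ℂ × ℂ) := by
  apply Prod.ext <;> apply Complex.ext <;> simp [rotGen]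

lemma vec_eq (z : ℂ × ℂ) : z =
    z.1.re • ((1, 0) : ℂ × ℂ) + z.1.im • ((Complex.I, 0) : ℂ × ℂ)
    + z.2.re • ((0, 1) : ℂ × ℂ) + z.2.im • ((0, Complex.I) : ℂ × ℂ) := by
  apply Prod.ext <;> apply Complex.ext <;> simp

/-- `Re z₁`, etc. as continuous linear maps. -/
noncomputable def X1 : ℂ × ℂ →L[ℝ] ℝ := Complex.reCLM ∘L ContinuousLinearMap.fst ℝ ℂ ℂ
noncomputable def Y1 : ℂ × ℂ →L[ℝ] ℝ := Complex.imCLM ∘L ContinuousLinearMap.fst ℝ ℂ ℂ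
noncomputable def X2 : ℂ × ℂ →L[ℝ] ℝ := Complex.reCLM ∘L ContinuousLinearMap.snd ℝ ℂ ℂ
noncomputable def Y2 : ℂ × ℂ →L[ℝ] ℝ := Complex.imCLM ∘L ContinuousLinearMap.snd ℝ ℂ ℂ

lemma X1_apply (z : ℂ × ℂ) : X1 z = z.1.re := rfl
lemma Y1_apply (z : ℂ × ℂ) : Y1 z = z.1.im := rfl
lemma X2_apply (z : ℂ × ℂ) : X2 z = z.2.re := rfl
lemma Y2_apply (z : ℂ × ℂ) : Y2 z = z.2.im := rfl

lemma poisson_eq (ε : ℝ) (G : ℂ × ℂ → ℝ) (z : ℂ × ℂ) :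
    poisson (q1C ε) G z = ε * fderiv ℝ G z (rotGen z) := by
  have hq : q1C ε = fun z => (ε / 2) * (X1 z * X1 z + Y1 z * Y1 z - (X2 z * X2 z + Y2 z * Y2 z)) := by
    funext w
    simp only [q1C, Complex.normSq_apply, X1_apply, Y1_apply, X2_apply, Y2_apply]
    ring
  have h := ((((X1.hasFDerivAt (x := z)).mul X1.hasFDerivAt).add
    (Y1.hasFDerivAt.mul Y1.hasFDerivAt)).sub
    ((X2.hasFDerivAt.mul X2.hasFDerivAt).add (Y2.hasFDerivAt.mul Y2.hasFDerivAt))).const_mul (ε / 2)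
  have h1 : HasFDerivAt (q1C ε) _ z := hq ▸ h
  have h' := h1.fderiv
  rw [rotGen_eq]
  simp only [poisson, h', map_add, map_sub, map_smul]
  simp [X1_apply, Y1_apply, X2_apply, Y2_apply]
  ring

/-- The quadratic invariant part. -/
noncomputable def quad (p q a b : ℝ) (z : ℂ × ℂ) : ℝ :=
  p * (X1 z * X2 z - Y1 z * Y2 z) - q * (X1 z * Y2 z + Y1 z * X2 z)
    + a * (X1 z * X1 z + Y1 z * Y1 z) + b * (X2 z * X2 z + Y2 z * Y2 z)

lemma quad_deriv (p q a b : ℝ) (z : ℂ × ℂ) :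
    ∃ D : ℂ × ℂ →L[ℝ] ℝ, HasFDerivAt (quad p q a b) D z ∧ D (rotGen z) = 0 ∧ (z = 0 → D = 0) := by
  have h := ((((((X1.hasFDerivAt (x := z)).mul X2.hasFDerivAt).sub
    (Y1.hasFDerivAt.mul Y2.hasFDerivAt)).const_mul p).sub
    (((X1.hasFDerivAt.mul Y2.hasFDerivAt).add
    (Y1.hasFDerivAt.mul X2.hasFDerivAt)).const_mul q)).add
    (((X1.hasFDerivAt.mul X1.hasFDerivAt).add
    (Y1.hasFDerivAt.mul Y1.hasFDerivAt)).const_mul a)).add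
    (((X2.hasFDerivAt.mul X2.hasFDerivAt).add
    (Y2.hasFDerivAt.mul Y2.hasFDerivAt)).const_mul b)
  refine ⟨_, h, ?_, ?_⟩
  · simp [X1_apply, Y1_apply, X2_apply, Y2_apply, rotGen]
    ring
  · rintro rfl
    simp

lemma explicit_eq (μ₁ μ₂ μ₃ : ℝ) (c : ℂ) (z : ℂ × ℂ) :
    μ₁ * (c * z.1 * z.2).re + μ₂ * Complex.normSq z.1 + μ₃ * Complex.normSq z.2
      = quad (μ₁ * c.re) (μ₁ * c.im) μ₂ μ₃ z := by
  simp [quad, X1_apply, Y1_apply, X2_apply, Y2_apply, Complex.normSq_apply]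
  ring

lemma bigO_of_fderiv {E F : Type*} [NormedAddCommGroup E] [NormedSpace ℝ E]
    [NormedAddCommGroup F] [NormedSpace ℝ F] (f : E → F) (hf : Differentiable ℝ f)
    (h0 : f 0 = 0) (n : ℕ) (h : fderiv ℝ f =O[𝓝 0] fun z => ‖z‖ ^ n) :
    f =O[𝓝 0] fun z => ‖z‖ ^ (n + 1) := by
  obtain ⟨C, hC⟩ := h.bound
  obtain ⟨r, hr, hb⟩ := Metric.eventually_nhds_iff.1 hC
  refine IsBigO.of_bound C ?_
  filter_upwards [Metric.ball_mem_nhds (0 : E) hr] with z hz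
  rw [mem_ball_zero_iff] at hz
  have hC0 : 0 ≤ C ∨ z = 0 := by
    by_cases hz0 : z = 0
    · exact Or.inr hz0
    · left
      have := hb (y := z) (by simpa using hz)
      rw [norm_pow, norm_norm] at this
      have hp : 0 < ‖z‖ ^ n := pow_pos (norm_pos_iff.2 hz0) n
      by_contra hneg
      push Not at hneg
      have := mul_neg_of_neg_of_pos hneg hp
      linarith [norm_nonneg (fderiv ℝ f z)]
  rcases hC0 with hC0 | rfl
  · have key := (convex_closedBall (0 : E) ‖z‖).norm_image_sub_le_of_norm_fderiv_le (𝕜 := ℝ)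
      (f := f) (C := C * ‖z‖ ^ n) (x := 0) (y := z) (fun x _ => hf x) (fun x hx => by
        rw [mem_closedBall_zero_iff] at hx
        have := hb (y := x) (by simpa using lt_of_le_of_lt hx hz)
        rw [norm_pow, norm_norm] at this
        exact this.trans (by gcongr)) (by simp) (by simp)
    rw [h0, sub_zero, sub_zero] at key
    rw [norm_pow, norm_norm, pow_succ]
    linarith
  · simp [h0]

/-- A smooth `H : ℂ² → ℝ` satisfies `{q₁, H} = 0`, `H(0) = 0`, `dH(0) = 0` iff
`H(z₁, z₂) = μ₁Re(e^{iψ}z₁z₂) + μ₂|z₁|² + μ₃|z₂|² + R₃(z₁, z₂)` with `R₃` smooth,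
Poisson-commuting with `q₁`, and `R₃(z) = O(‖z‖³)` at the origin. -/
theorem stmt2 (ε : ℝ) (hε : ε = 1 ∨ ε = -1)
    (H : ℂ × ℂ → ℝ) (hH : ContDiff ℝ (⊤ : ℕ∞) H) :
    ((∀ z, poisson (q1C ε) H z = 0) ∧ H 0 = 0 ∧ fderiv ℝ H 0 = 0) ↔
    ∃ (μ₁ μ₂ μ₃ ψ : ℝ) (R₃ : ℂ × ℂ → ℝ),
      ContDiff ℝ (⊤ : ℕ∞) R₃ ∧
      (∀ z, poisson (q1C ε) R₃ z = 0) ∧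
      R₃ =O[𝓝 (0 : ℂ × ℂ)] (fun z => ‖z‖ ^ 3) ∧
      ∀ z : ℂ × ℂ,
        H z = μ₁ * (Complex.exp ((ψ : ℂ) * Complex.I) * z.1 * z.2).re
            + μ₂ * Complex.normSq z.1 + μ₃ * Complex.normSq z.2 + R₃ z := by
  have hε0 : ε ≠ 0 := by rcases hε with rfl | rfl <;> norm_num
  simp only [poisson_eq, mul_eq_zero, hε0, false_or]
  constructor
  · rintro ⟨hP, h0, hd0⟩
    have hHd : Differentiable ℝ H := hH.differentiable (by simp)
    have hH1 : ContDiff ℝ (⊤ : ℕ∞) (fderiv ℝ H) := hH.fderiv_right (by simp)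
    have hH1d : Differentiable ℝ (fderiv ℝ H) := hH1.differentiable (by simp)
    have hH2 : ContDiff ℝ (⊤ : ℕ∞) (fderiv ℝ (fderiv ℝ H)) := hH1.fderiv_right (by simp)
    have hH2d : Differentiable ℝ (fderiv ℝ (fderiv ℝ H)) := hH2.differentiable (by simp)
    obtain ⟨B, hB⟩ : ∃ B, B = fderiv ℝ (fderiv ℝ H) 0 := ⟨_, rfl⟩
    have hsym : ∀ v w, B v w = B w v := by
      intro v w
      have := (hH.contDiffAt (x := 0)).isSymmSndFDerivAt (by
        simp only [minSmoothness_of_isRCLikeNormedField]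
        exact WithTop.coe_le_coe.2 (le_top : (2 : ℕ∞) ≤ ⊤))
      rw [hB]; exact this v w
    have hBL : ∀ v, B v (rotGen v) = 0 := by
      intro v
      have hline : HasDerivAt (fun t : ℝ => t • v) v 0 := by
        simpa using (hasDerivAt_id (0 : ℝ)).smul_const v
      have h1 : HasFDerivAt (fderiv ℝ H) B ((0 : ℝ) • v) := by
        rw [zero_smul, hB]; exact (hH1d 0).hasFDerivAt
      have h2 : HasDerivAt (fun t : ℝ => fderiv ℝ H (t • v)) (B v) 0 :=
        h1.comp_hasDerivAt (0 : ℝ) hline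
      have h3 : HasDerivAt (fun t : ℝ => fderiv ℝ H (t • v) (rotGen v)) (B v (rotGen v)) 0 := by
        simpa using h2.clm_apply (hasDerivAt_const (0 : ℝ) (rotGen v))
      have h4 : (fun t : ℝ => fderiv ℝ H (t • v) (rotGen v)) = fun _ => 0 := by
        funext t
        by_cases ht : t = 0
        · simp [ht, hd0]
        · have := hP (t • v)
          have hr : rotGen (t • v) = t • rotGen v := by
            apply Prod.ext <;> simp [rotGen] <;> ring
          rw [hr, map_smul, smul_eq_mul] at this
          exact (mul_eq_zero.1 this).resolve_left ht
      rw [h4] at h3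
      exact h3.unique (hasDerivAt_const _ _)
    have hquad : ∀ z, (1 / 2) * B z z = quad (B (1, 0) (0, 1)) (-(B (1, 0) (0, Complex.I)))
        (B (1, 0) (1, 0) / 2) (B (0, 1) (0, 1) / 2) z := by
      intro z
      have expand : ∀ a b c d : ℝ, 
          B (a • (1, 0) + b • (Complex.I, 0) + c • (0, 1) + d • (0, Complex.I))
            (a • (Complex.I, 0) - b • (1, 0) - c • (0, Complex.I) + d • (0, 1)) = 0 := by
        intro a b c d
        have h := hBL (⟨a, b⟩, ⟨c, d⟩)
        rw [rotGen_eq] at h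
        rw [vec_eq (⟨a, b⟩, ⟨c, d⟩)] at h
        simpa using h
      have s1 := hsym (Complex.I, 0) (1, 0)
      have s2 := hsym (0, 1) (1, 0)
      have s3 := hsym (0, Complex.I) (1, 0)
      have s4 := hsym (0, 1) (Complex.I, 0)
      have s5 := hsym (0, Complex.I) (Complex.I, 0)
      have s6 := hsym (0, Complex.I) (0, 1)
      simp only [map_add, map_sub, map_smul, add_apply,
        smul_apply, smul_eq_mul, s1, s2, s3, s4, s5, s6] at expand
      have e1 := expand 1 0 0 0
      have e2 := expand 1 1 0 0
      have e2' := expand 0 1 0 0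
      have e3 := expand 0 0 1 0
      have e4 := expand 0 0 1 1
      have e5 := expand 1 0 1 0
      have e6 := expand 1 0 0 1
      have e7 := expand 0 0 0 1
      ring_nf at e1 e2 e2' e3 e4 e5 e6 e7
      have k1 : B (1, 0) (Complex.I, 0) = 0 := by linarith
      have k2 : B (Complex.I, 0) (Complex.I, 0) = B (1, 0) (1, 0) := by linarith
      have k3 : B (0, 1) (0, Complex.I) = 0 := by linarith
      have k4 : B (0, Complex.I) (0, Complex.I) = B (0, 1) (0, 1) := by linarith
      have k5 : B (Complex.I, 0) (0, 1) = B (1, 0) (0, Complex.I) := by linarith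
      have k6 : B (Complex.I, 0) (0, Complex.I) = - B (1, 0) (0, 1) := by linarith
      conv_lhs => rw [vec_eq z]
      simp only [map_add, map_smul, add_apply,
        smul_apply, smul_eq_mul, s1, s2, s3, s4, s5, s6, k1, k2, k3, k4, k5, k6,
        quad, X1_apply, X2_apply, Y1_apply, Y2_apply]
      ring
    have hR : ∀ z, HasFDerivAt (fun z => H z - (1 / 2) * B z z) (fderiv ℝ H z - B z) z := by
      intro z
      have h1 := (hHd z).hasFDerivAt.sub
        (((B.hasFDerivAt (x := z)).clm_apply (hasFDerivAt_id z)).const_mul (1 / 2))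
      have h2 : fderiv ℝ H z - B z = fderiv ℝ H z -
          (1 / 2 : ℝ) • (B z ∘SL ContinuousLinearMap.id ℝ (ℂ × ℂ) + B.flip (id z)) := by
        refine ContinuousLinearMap.ext fun v => ?_
        simp only [sub_apply, smul_apply, add_apply, ContinuousLinearMap.comp_apply,
          ContinuousLinearMap.flip_apply, id, ContinuousLinearMap.id_apply, hsym v z, smul_eq_mul]
        ring
      rw [h2]
      exact h1
    have hRd : fderiv ℝ (fun z => H z - (1 / 2) * B z z) = fun z => fderiv ℝ H z - B z :=
      funext fun z => (hR z).fderiv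
    have hR2 : fderiv ℝ (fun z => fderiv ℝ H z - B z) = fun z => fderiv ℝ (fderiv ℝ H) z - B :=
      funext fun z => ((hH1d z).hasFDerivAt.sub B.hasFDerivAt).fderiv
    let c : ℂ := ⟨B (1, 0) (0, 1), -(B (1, 0) (0, Complex.I))⟩
    have hc : (‖c‖ : ℂ) * Complex.exp ((Complex.arg c : ℂ) * Complex.I) = c :=
      Complex.norm_mul_exp_arg_mul_I c
    refine ⟨‖c‖, B (1, 0) (1, 0) / 2, B (0, 1) (0, 1) / 2, Complex.arg c,
      fun z => H z - (1 / 2) * B z z, ?_, ?_, ?_, ?_⟩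
    · exact hH.sub (contDiff_const.mul (B.contDiff.clm_apply contDiff_id))
    · intro z
      rw [(hR z).fderiv]
      simp [hP z, hBL z]
    · refine bigO_of_fderiv _ (fun z => (hR z).differentiableAt) (by simp [h0]) 2 ?_
      rw [hRd]
      refine bigO_of_fderiv (fun z => fderiv ℝ H z - B z) (hH1d.sub B.differentiable) (by simp [hd0]) 1 ?_
      rw [hR2]
      have := DifferentiableAt.isBigO_sub (𝕜 := ℝ) (E := ℂ × ℂ)
        (F := ℂ × ℂ →L[ℝ] ℂ × ℂ →L[ℝ] ℝ) (hH2d 0)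
      rw [← hB] at this
      simpa using this.norm_right
    · intro z
      rw [explicit_eq]
      beta_reduce
      rw [hquad]
      have r1 := congrArg Complex.re hc
      have r2 := congrArg Complex.im hc
      rw [Complex.re_ofReal_mul] at r1
      rw [Complex.im_ofReal_mul] at r2
      rw [r1, r2]
      simp [c]
  · rintro ⟨μ₁, μ₂, μ₃, ψ, R, hRs, hRP, hRO, hHeq⟩
    have hHf : H = quad (μ₁ * (Complex.exp ((ψ : ℂ) * Complex.I)).re)
        (μ₁ * (Complex.exp ((ψ : ℂ) * Complex.I)).im) μ₂ μ₃ + R := by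
      funext z; rw [hHeq, explicit_eq]; rfl
    have hRd : Differentiable ℝ R := hRs.differentiable (by simp)
    have hR0 : R 0 = 0 := by
      simpa using hRO.eq_zero_imp.self_of_nhds (by simp)
    have hRd0 : HasFDerivAt R (0 : ℂ × ℂ →L[ℝ] ℝ) 0 :=
      IsBigO.hasFDerivAt (n := 3) (by simpa using hRO) (by norm_num)
    refine ⟨fun z => ?_, ?_, ?_⟩
    · obtain ⟨D, hD, hDL, -⟩ := quad_deriv (μ₁ * (Complex.exp ((ψ : ℂ) * Complex.I)).re)
        (μ₁ * (Complex.exp ((ψ : ℂ) * Complex.I)).im) μ₂ μ₃ z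
      rw [hHf, (hD.add (hRd z).hasFDerivAt).fderiv]
      simp [hDL, hRP z]
    · rw [hHeq]; simp [hR0]
    · obtain ⟨D, hD, -, hD0⟩ := quad_deriv (μ₁ * (Complex.exp ((ψ : ℂ) * Complex.I)).re)
        (μ₁ * (Complex.exp ((ψ : ℂ) * Complex.I)).im) μ₂ μ₃ 0
      rw [hHf, (hD.add hRd0).fderiv, hD0 rfl, zero_add]
end

section
/- The characteristic polynomial of C_λ is X ↦ P_λ(X²), where P_λ(Y) = Y² + 2((λ + ε(μ₂−μ₃))² + (μ₂+μ₃)² − μ₁²)·Y + ((λ + ε(μ₂−μ₃))² + μ₁² − (μ₂+μ₃)²)², and the discriminant of P_λ equals 16(λ + ε(μ₂−μ₃))²·((μ₂+μ₃)² − μ₁²). Moreover, for any λ ∈ ℝ with λ ≠ ε(μ₃−μ₂) and (λ + ε(μ₂−μ₃))² + μ₁² − (μ₂+μ₃)² ≠ 0: (a) if |μ₂+μ₃| < |μ₁|, then there exist nonzero real numbers a, b such that the eigenvalues of C_λ are a+ib, a−ib, −a+ib, −a−ib (focus-focus case); (b) if |μ₂+μ₃| > |μ₁|, then there exist real numbers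 β₁ > β₂ > 0 such that the eigenvalues of C_λ are iβ₁, −iβ₁, iβ₂, −iβ₂ (elliptic-elliptic case); (c) if |μ₂+μ₃| = |μ₁|, then the discriminant of P_λ is zero (degenerate case). -/
open Polynomial

/-- The matrix `C_λ = Ω⁻¹(λ·d²q₁(0) + d²H₂(0))` in the basis
`(∂_{z₁}, ∂_{z̄₁}, ∂_{z₂}, ∂_{z̄₂})`. -/
noncomputable def CMat (ε μ₁ μ₂ μ₃ ψ lam : ℝ) : Matrix (Fin 4) (Fin 4) ℂ :=
  !![Complex.I * ((ε*lam + 2*μ₂ : ℝ) : ℂ), 0, 0,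
        Complex.I * (μ₁ : ℂ) * Complex.exp (-(ψ : ℂ) * Complex.I);
     0, -Complex.I * ((ε*lam + 2*μ₂ : ℝ) : ℂ),
        -Complex.I * (μ₁ : ℂ) * Complex.exp ((ψ : ℂ) * Complex.I), 0;
     0, Complex.I * (μ₁ : ℂ) * Complex.exp (-(ψ : ℂ) * Complex.I),
        -Complex.I * ((ε*lam - 2*μ₃ : ℝ) : ℂ), 0;
     -Complex.I * (μ₁ : ℂ) * Complex.exp ((ψ : ℂ) * Complex.I), 0, 0,
        Complex.I * ((ε*lam - 2*μ₃ : ℝ) : ℂ)]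

theorem roots_aux (A B r1 r2 r3 r4 u v : ℂ) (h1 : r1 = u) (h2 : r2 = v) (h3 : r3 = -v)
    (h4 : r4 = -u) (hA : A = -(u ^ 2 + v ^ 2)) (hB : B = u ^ 2 * v ^ 2) :
    ((X ^ 2 + C A * X + C B : ℂ[X]).comp (X ^ 2)).roots = {r1, r2, r3, r4} := by
  have : (X ^ 2 + C A * X + C B : ℂ[X]).comp (X ^ 2)
      = (Multiset.map (fun a => X - C a) ({r1, r2, r3, r4} : Multiset ℂ)).prod := by
    subst h1 h2 h3 h4 hA hB
    simp
    ring
  rw [this, roots_multiset_prod_X_sub_C]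

theorem charpoly_aux (ε μ₁ μ₂ μ₃ ψ lam : ℝ) (hε : ε = 1 ∨ ε = -1) :
    (CMat ε μ₁ μ₂ μ₃ ψ lam).charpoly =
      (X ^ 2
        + C (((2 * ((lam + ε*(μ₂ - μ₃))^2 + (μ₂ + μ₃)^2 - μ₁^2) : ℝ) : ℂ)) * X
        + C (((((lam + ε*(μ₂ - μ₃))^2 + μ₁^2 - (μ₂ + μ₃)^2)^2 : ℝ) : ℂ))).comp
        (X ^ 2) := by
  have hE : Complex.exp ((ψ : ℂ) * Complex.I) * Complex.exp (-(ψ : ℂ) * Complex.I) = 1 := by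
    rw [← Complex.exp_add]; simp
  have he : (ε : ℂ) ^ 2 = 1 := by rcases hε with h | h <;> simp [h]
  have hI : Complex.I ^ 2 = -1 := Complex.I_sq
  unfold CMat
  generalize Complex.exp ((ψ : ℂ) * Complex.I) = e at *
  generalize Complex.exp (-(ψ : ℂ) * Complex.I) = f at *
  apply Polynomial.funext
  intro x
  rw [Matrix.eval_charpoly]
  simp [Matrix.det_succ_row_zero, Fin.sum_univ_succ, Fin.succAbove, Matrix.scalar_apply]
  generalize Complex.I = I at *
  generalize (ε : ℂ) = ε at *
  generalize (μ₁ : ℂ) = m at *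
  generalize (μ₂ : ℂ) = n at *
  generalize (μ₃ : ℂ) = k at *
  generalize (lam : ℂ) = l at *
  have key : ∀ p r : ℂ, p = ε*l+2*n → r = ε*l-2*k →
     ((x - I*p)*(x-I*r) + I^2*m^2*(e*f)) * ((x + I*p)*(x+I*r) + I^2*m^2*(e*f)) =
      (x^2)^2 + 2*((l+ε*(n-k))^2+(n+k)^2-m^2)*x^2 + ((l+ε*(n-k))^2+m^2-(n+k)^2)^2 := by
    intro p r hp hr
    have h1 : p = ε * (l+ε*(n-k)) + (n+k) := by rw [hp]; linear_combination (-(n-k)) * he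
    have h2 : r = ε * (l+ε*(n-k)) - (n+k) := by rw [hr]; linear_combination (-(n-k)) * he
    generalize l+ε*(n-k) = s at *
    generalize n+k = t at *
    have h3 : p * r = s^2 - t^2 := by rw [h1, h2]; linear_combination s^2 * he
    have h4 : (p+r)^2 = 4*s^2 := by rw [h1, h2]; linear_combination 4*s^2 * he
    have e1 : ((x - I*p)*(x-I*r) + I^2*m^2*(e*f)) = x^2 - I*(p+r)*x - (s^2-t^2+m^2) := by
      rw [hE, hI, ← h3]; linear_combination p*r*hI
    have e2 : ((x + I*p)*(x+I*r) + I^2*m^2*(e*f)) = x^2 + I*(p+r)*x - (s^2-t^2+m^2) := by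
      rw [hE, hI, ← h3]; linear_combination p*r*hI
    rw [e1, e2]
    linear_combination x^2*h4 - (p+r)^2*x^2*hI
  rw [← key _ _ rfl rfl]
  ring

/-- The characteristic polynomial of `C_λ` is `X ↦ P_λ(X²)` with
`P_λ(Y) = Y² + 2((λ + ε(μ₂−μ₃))² + (μ₂+μ₃)² − μ₁²)Y + ((λ + ε(μ₂−μ₃))² + μ₁² − (μ₂+μ₃)²)²`,
whose discriminant is `16(λ + ε(μ₂−μ₃))²((μ₂+μ₃)² − μ₁²)`; and for
`λ ≠ ε(μ₃−μ₂)` with `(λ + ε(μ₂−μ₃))² + μ₁² − (μ₂+μ₃)² ≠ 0` the eigenvalue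
configuration of `C_λ` is focus-focus, elliptic-elliptic, or degenerate according to
the sign of `|μ₂+μ₃| − |μ₁|`. -/
theorem stmt3 (ε μ₁ μ₂ μ₃ ψ lam : ℝ) (hε : ε = 1 ∨ ε = -1) :
    (CMat ε μ₁ μ₂ μ₃ ψ lam).charpoly =
      (X ^ 2
        + C (((2 * ((lam + ε*(μ₂ - μ₃))^2 + (μ₂ + μ₃)^2 - μ₁^2) : ℝ) : ℂ)) * X
        + C (((((lam + ε*(μ₂ - μ₃))^2 + μ₁^2 - (μ₂ + μ₃)^2)^2 : ℝ) : ℂ))).comp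
        (X ^ 2) ∧
    (2 * ((lam + ε*(μ₂ - μ₃))^2 + (μ₂ + μ₃)^2 - μ₁^2))^2
        - 4 * ((lam + ε*(μ₂ - μ₃))^2 + μ₁^2 - (μ₂ + μ₃)^2)^2
      = 16 * (lam + ε*(μ₂ - μ₃))^2 * ((μ₂ + μ₃)^2 - μ₁^2) ∧
    (lam ≠ ε * (μ₃ - μ₂) →
      (lam + ε*(μ₂ - μ₃))^2 + μ₁^2 - (μ₂ + μ₃)^2 ≠ 0 →
      ((|μ₂ + μ₃| < |μ₁| →
          ∃ a b : ℝ, a ≠ 0 ∧ b ≠ 0 ∧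
            (CMat ε μ₁ μ₂ μ₃ ψ lam).charpoly.roots =
              {(a : ℂ) + (b : ℂ) * Complex.I, (a : ℂ) - (b : ℂ) * Complex.I,
               -(a : ℂ) + (b : ℂ) * Complex.I, -(a : ℂ) - (b : ℂ) * Complex.I}) ∧
        (|μ₁| < |μ₂ + μ₃| →
          ∃ β₁ β₂ : ℝ, 0 < β₂ ∧ β₂ < β₁ ∧
            (CMat ε μ₁ μ₂ μ₃ ψ lam).charpoly.roots =
              {(β₁ : ℂ) * Complex.I, -((β₁ : ℂ) * Complex.I),
               (β₂ : ℂ) * Complex.I, -((β₂ : ℂ) * Complex.I)}) ∧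
        (|μ₂ + μ₃| = |μ₁| →
          (2 * ((lam + ε*(μ₂ - μ₃))^2 + (μ₂ + μ₃)^2 - μ₁^2))^2
              - 4 * ((lam + ε*(μ₂ - μ₃))^2 + μ₁^2 - (μ₂ + μ₃)^2)^2 = 0))) := by
  have hc := charpoly_aux ε μ₁ μ₂ μ₃ ψ lam hε
  refine ⟨hc, by ring, ?_⟩
  intro h1 h2
  have hs : lam + ε*(μ₂ - μ₃) ≠ 0 := fun h => h1 (by linarith)
  rw [hc]
  clear hc
  generalize lam + ε*(μ₂ - μ₃) = s at *
  generalize μ₂ + μ₃ = t at *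
  refine ⟨fun h => ?_, fun h => ?_, fun h => ?_⟩
  · have h' : 0 < μ₁^2 - t^2 := sub_pos.2 (sq_lt_sq.2 h)
    have hd := Real.sq_sqrt h'.le
    have hd0 := Real.sqrt_pos.2 h'
    generalize √(μ₁^2 - t^2) = d at *
    have hdc : (d:ℂ)^2 = μ₁^2 - t^2 := by exact_mod_cast hd
    refine ⟨d, s, hd0.ne', hs, roots_aux _ _ _ _ _ _ (d + s * Complex.I) (d - s * Complex.I)
      rfl rfl (by ring) (by ring) ?_ ?_⟩
    · push_cast
      linear_combination 2 * hdc + 2 * s^2 * Complex.I_sq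
    · have : ((d:ℂ) + s * Complex.I)^2 * (d - s * Complex.I)^2 = (d^2 + s^2)^2 := by
        rw [← mul_pow]; congr 1; linear_combination - s^2 * Complex.I_sq
      rw [this, hdc]; push_cast; ring
  · have h' : 0 < t^2 - μ₁^2 := sub_pos.2 (sq_lt_sq.2 h)
    have hd := Real.sq_sqrt h'.le
    have hd0 := Real.sqrt_pos.2 h'
    generalize √(t^2 - μ₁^2) = d at *
    have hdc : (d:ℂ)^2 = t^2 - μ₁^2 := by exact_mod_cast hd
    have hq := sq_abs s
    have hs0 := abs_pos.2 hs
    generalize |s| = q at *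
    have hqc : (q:ℂ)^2 = s^2 := by exact_mod_cast hq
    have hqd : q - d ≠ 0 := fun h => h2 (by
      have : q = d := by linarith
      rw [this] at hq; linarith)
    have hb : |q - d| < q + d := abs_lt.2 ⟨by linarith, by linarith⟩
    have hbq := sq_abs (q - d)
    have hbp := abs_pos.2 hqd
    generalize |q - d| = b at *
    have hbc : (b:ℂ)^2 = (q - d)^2 := by exact_mod_cast hbq
    refine ⟨q + d, b, hbp, hb, ?_⟩
    have := roots_aux (((2 * (s^2 + t^2 - μ₁^2) : ℝ) : ℂ)) ((((s^2 + μ₁^2 - t^2)^2 : ℝ) : ℂ))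
      _ _ _ _ (((q + d : ℝ) : ℂ) * Complex.I) ((b : ℂ) * Complex.I) rfl rfl rfl rfl ?_ ?_
    · rw [this]
      simp only [Multiset.insert_eq_cons]
      congr 1
      rw [← Multiset.coe_singleton, ← Multiset.coe_singleton]
      simp only [Multiset.cons_coe, Multiset.coe_eq_coe]
      exact (List.perm_append_comm (l₁ := [_, _]) (l₂ := [_]))
    · push_cast
      simp only [mul_pow, Complex.I_sq, hbc]
      linear_combination -2 * hdc - 2 * hqc
    · have : (((q + d : ℝ) : ℂ) * Complex.I)^2 * ((b : ℂ) * Complex.I)^2 = (q^2 - d^2)^2 := by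
        simp only [mul_pow, Complex.I_sq, hbc]
        push_cast; ring
      rw [this, hdc, hqc]; push_cast; ring
  · have := (sq_eq_sq_iff_abs_eq_abs _ _).2 h
    rw [this]; ring
end

section
/- A point (ρ₀, θ₀) ∈ I × ℝ is a critical point of H if and only if sin θ₀ = 0 and f(ρ₀²) = cos θ₀ · g(ρ₀²); equivalently, the critical points of H, with θ taken modulo 2π, are exactly the pairs (ρ_ε, arccos ε) with ε ∈ {−1, 1} and ρ_ε ∈ I satisfying f(ρ_ε²) = ε·g(ρ_ε²). -/
/-- `H(ρ, θ) = a(ρ²) − b(ρ²)·cos θ·√(c(ρ²))`. -/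
noncomputable def Hred (a b c : ℝ → ℝ) (p : ℝ × ℝ) : ℝ :=
  a (p.1^2) - b (p.1^2) * Real.cos p.2 * Real.sqrt (c (p.1^2))

/-- `f = 2a′√c`. -/
noncomputable def fred (a c : ℝ → ℝ) (X : ℝ) : ℝ := 2 * deriv a X * Real.sqrt (c X)

/-- `g = 2b′c + bc′`. -/
noncomputable def gred (b c : ℝ → ℝ) (X : ℝ) : ℝ :=
  2 * deriv b X * c X + b X * deriv c X

/-- A point `(ρ₀, θ₀) ∈ I × ℝ` is a critical point of `H` iff `sin θ₀ = 0` and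
`f(ρ₀²) = cos θ₀ · g(ρ₀²)`; equivalently, the critical points, with `θ` taken modulo
`2π`, are exactly the `(ρ_ε, arccos ε)` with `ε ∈ {−1, 1}` and `f(ρ_ε²) = ε·g(ρ_ε²)`. -/
theorem stmt4 (ρm ρp : ℝ) (hρm : 0 ≤ ρm) (hρ : ρm < ρp)
    (a b c : ℝ → ℝ) (u₁ u₂ : ℝ)
    (hKU : closure (Set.Ioo (ρm^2) (ρp^2)) ⊆ Set.Ioo u₁ u₂)
    (ha : ContDiffOn ℝ (⊤ : ℕ∞) a (Set.Ioo u₁ u₂))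
    (hb : ContDiffOn ℝ (⊤ : ℕ∞) b (Set.Ioo u₁ u₂))
    (hc : ContDiffOn ℝ (⊤ : ℕ∞) c (Set.Ioo u₁ u₂))
    (ha' : ∀ X ∈ Set.Ioo (ρm^2) (ρp^2), deriv a X ≠ 0)
    (hb0 : ∀ X ∈ Set.Ioo (ρm^2) (ρp^2), b X ≠ 0)
    (hc0 : ∀ X ∈ Set.Ioo (ρm^2) (ρp^2), 0 < c X)
    (ρ₀ θ₀ : ℝ) (hρ₀ : ρ₀ ∈ Set.Ioo ρm ρp) :
    (fderiv ℝ (Hred a b c) (ρ₀, θ₀) = 0 ↔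
      Real.sin θ₀ = 0 ∧ fred a c (ρ₀^2) = Real.cos θ₀ * gred b c (ρ₀^2)) ∧
    (fderiv ℝ (Hred a b c) (ρ₀, θ₀) = 0 ↔
      ∃ ε : ℝ, (ε = 1 ∨ ε = -1) ∧ fred a c (ρ₀^2) = ε * gred b c (ρ₀^2) ∧
        ∃ k : ℤ, θ₀ = Real.arccos ε + 2 * Real.pi * k) := by
  have hpos : 0 < ρ₀ := lt_of_le_of_lt hρm hρ₀.1
  have hX : ρ₀^2 ∈ Set.Ioo (ρm^2) (ρp^2) :=
    ⟨pow_lt_pow_left₀ hρ₀.1 hρm two_ne_zero, pow_lt_pow_left₀ hρ₀.2 hpos.le two_ne_zero⟩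
  have hU : Set.Ioo u₁ u₂ ∈ nhds (ρ₀^2) := isOpen_Ioo.mem_nhds (hKU (subset_closure hX))
  have dA : HasDerivAt a (deriv a (ρ₀^2)) (ρ₀^2) :=
    ((ha.contDiffAt hU).differentiableAt (by simp)).hasDerivAt
  have dB : HasDerivAt b (deriv b (ρ₀^2)) (ρ₀^2) :=
    ((hb.contDiffAt hU).differentiableAt (by simp)).hasDerivAt
  have dC : HasDerivAt c (deriv c (ρ₀^2)) (ρ₀^2) :=
    ((hc.contDiffAt hU).differentiableAt (by simp)).hasDerivAt
  have hcp := hc0 _ hX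
  have hbn := hb0 _ hX
  have dS := dC.sqrt hcp.ne'
  have dq : HasFDerivAt (fun p : ℝ × ℝ => p.1^2)
      ((2 * ρ₀) • ContinuousLinearMap.fst ℝ ℝ ℝ) (ρ₀, θ₀) := by
    have h := (hasDerivAt_pow 2 ρ₀).comp_hasFDerivAt (f := fun p : ℝ × ℝ => p.1) (ρ₀, θ₀)
      (hasFDerivAt_fst (𝕜 := ℝ) (E := ℝ) (F := ℝ))
    simpa [Function.comp_def] using h
  have dcos : HasFDerivAt (fun p : ℝ × ℝ => Real.cos p.2)
      ((-Real.sin θ₀) • ContinuousLinearMap.snd ℝ ℝ ℝ) (ρ₀, θ₀) :=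
    (Real.hasDerivAt_cos θ₀).comp_hasFDerivAt (f := fun p : ℝ × ℝ => p.2) (ρ₀, θ₀)
      (hasFDerivAt_snd (𝕜 := ℝ) (E := ℝ) (F := ℝ))
  have dA2 := dA.comp_hasFDerivAt (f := fun p : ℝ × ℝ => p.1^2) (ρ₀, θ₀) dq
  have dB2 := dB.comp_hasFDerivAt (f := fun p : ℝ × ℝ => p.1^2) (ρ₀, θ₀) dq
  have dS2 := dS.comp_hasFDerivAt (f := fun p : ℝ × ℝ => p.1^2) (ρ₀, θ₀) dq
  have dH := (dA2.sub ((dB2.mul dcos).mul dS2)).fderiv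
  have hs : 0 < √(c (ρ₀^2)) := Real.sqrt_pos.mpr hcp
  have hss : √(c (ρ₀^2)) * √(c (ρ₀^2)) = c (ρ₀^2) := Real.mul_self_sqrt hcp.le
  have e1 : fderiv ℝ (Hred a b c) (ρ₀, θ₀) (1, 0) * √(c (ρ₀^2)) =
      ρ₀ * (fred a c (ρ₀^2) - Real.cos θ₀ * gred b c (ρ₀^2)) := by
    refine (congrArg (fun L : ℝ × ℝ →L[ℝ] ℝ => L (1, 0) * √(c (ρ₀^2))) dH).trans ?_
    simp [fred, gred]
    field_simp
    rw [Real.sq_sqrt hcp.le]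
    ring
  have e2 : fderiv ℝ (Hred a b c) (ρ₀, θ₀) (0, 1) =
      b (ρ₀^2) * √(c (ρ₀^2)) * Real.sin θ₀ := by
    refine (congrArg (fun L : ℝ × ℝ →L[ℝ] ℝ => L (0, 1)) dH).trans ?_
    simp
    ring
  have main : fderiv ℝ (Hred a b c) (ρ₀, θ₀) = 0 ↔
      Real.sin θ₀ = 0 ∧ fred a c (ρ₀^2) = Real.cos θ₀ * gred b c (ρ₀^2) := by
    constructor
    · intro h
      rw [h] at e1 e2
      constructor
      · simpa [hbn, hs.ne'] using e2.symm
      · have := e1.symm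
        simp only [ContinuousLinearMap.zero_apply, zero_mul, mul_eq_zero, hpos.ne',
          false_or] at this
        linarith
    · rintro ⟨h1, h2⟩
      rw [h1, mul_zero] at e2
      rw [h2, sub_self, mul_zero] at e1
      have e1' := (mul_eq_zero.mp e1).resolve_right hs.ne'
      ext
      · simpa using e1'
      · simpa using e2
  refine ⟨main, main.trans ?_⟩
  constructor
  · rintro ⟨h1, h2⟩
    rcases Real.sin_eq_zero_iff_cos_eq.mp h1 with h | h
    · refine ⟨1, Or.inl rfl, by rw [h2, h], ?_⟩
      obtain ⟨k, hk⟩ := (Real.cos_eq_one_iff θ₀).mp h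
      exact ⟨k, by rw [Real.arccos_one, ← hk]; ring⟩
    · refine ⟨-1, Or.inr rfl, by rw [h2, h], ?_⟩
      obtain ⟨k, hk⟩ := Real.cos_eq_neg_one_iff.mp h
      exact ⟨k, by rw [Real.arccos_neg_one, ← hk]; ring⟩
  · rintro ⟨ε, hε, h2, k, hk⟩
    have hcos : Real.cos θ₀ = ε := by
      rw [hk, mul_comm (2 * Real.pi), Real.cos_add_int_mul_two_pi]
      rcases hε with rfl | rfl <;> simp
    exact ⟨Real.sin_eq_zero_iff_cos_eq.mpr (by rw [hcos]; exact hε), by rw [hcos]; exact h2⟩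
end

section
/- Let (ρ₀, θ₀) ∈ I × ℝ be a critical point of H, with ε := cos θ₀ ∈ {−1, 1} and f(ρ₀²) = ε·g(ρ₀²). Then the Hessian of H at (ρ₀, θ₀) in the coordinates (ρ, θ) is the diagonal matrix diag( 2ρ₀²·(f′(ρ₀²) − ε g′(ρ₀²))/√(c(ρ₀²)), ε·b(ρ₀²)·√(c(ρ₀²)) ). Consequently: (ρ₀, θ₀) is a nondegenerate critical point if and only if f′(ρ₀²) ≠ ε g′(ρ₀²); if it is nondegenerate, then the Hessian is definite if and only if ε·b(ρ₀²)·(f′(ρ₀²) − ε g′(ρ₀²)) > 0 and indefinite (a saddle) if and only if this quantity is negative; and in the definite case, (ρ₀, θ₀) is a local minimum of H if and only if ε·b(ρ₀²) > 0 and a local maximum if and only if ε·b(ρ₀²) < 0. -/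
/-- The Hessian bilinear form of `F : ℝ² → ℝ` at `p`, evaluated on vectors `u, v`. -/
noncomputable def hessBil (F : ℝ × ℝ → ℝ) (p u v : ℝ × ℝ) : ℝ :=
  fderiv ℝ (fderiv ℝ F) p u v

open Filter Topology in
theorem hess_gen (A B A1 B1 : ℝ → ℝ) (A2 B2 x t : ℝ)
    (hA : ∀ᶠ y in 𝓝 x, HasDerivAt A (A1 y) y) (hB : ∀ᶠ y in 𝓝 x, HasDerivAt B (B1 y) y)
    (hA1 : HasDerivAt A1 A2 x) (hB1 : HasDerivAt B1 B2 x) (u v : ℝ × ℝ) :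
    fderiv ℝ (fderiv ℝ (fun p : ℝ × ℝ => A p.1 - B p.1 * Real.cos p.2)) (x, t) u v =
      (A2 - B2 * Real.cos t) * u.1 * v.1 + B1 x * Real.sin t * (u.1 * v.2 + u.2 * v.1)
        + B x * Real.cos t * u.2 * v.2 := by
  have hfst : ∀ p : ℝ × ℝ, HasFDerivAt (fun p : ℝ × ℝ => p.1) (ContinuousLinearMap.fst ℝ ℝ ℝ) p :=
    fun p => hasFDerivAt_fst
  have hsnd : ∀ p : ℝ × ℝ, HasFDerivAt (fun p : ℝ × ℝ => p.2) (ContinuousLinearMap.snd ℝ ℝ ℝ) p :=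
    fun p => hasFDerivAt_snd
  have key : fderiv ℝ (fun p : ℝ × ℝ => A p.1 - B p.1 * Real.cos p.2) =ᶠ[𝓝 (x, t)]
      fun p => (A1 p.1 - B1 p.1 * Real.cos p.2) • ContinuousLinearMap.fst ℝ ℝ ℝ
        + (B p.1 * Real.sin p.2) • ContinuousLinearMap.snd ℝ ℝ ℝ := by
    have ht : Tendsto (fun p : ℝ × ℝ => p.1) (𝓝 (x, t)) (𝓝 x) := continuous_fst.tendsto (x, t)
    filter_upwards [ht.eventually hA, ht.eventually hB] with p h1 h2
    have e1 := h1.comp_hasFDerivAt p (hfst p)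
    have e2 := h2.comp_hasFDerivAt p (hfst p)
    have e3 := (Real.hasDerivAt_cos p.2).comp_hasFDerivAt p (hsnd p)
    have := (e1.sub (e2.mul e3)).fderiv
    refine Eq.trans this ?_
    ext <;> simp <;> ring
  rw [key.fderiv_eq]
  have e1 := hA1.comp_hasFDerivAt (x, t) (hfst (x, t))
  have e2 := hB1.comp_hasFDerivAt (x, t) (hfst (x, t))
  have e4 := hB.self_of_nhds.comp_hasFDerivAt (x, t) (hfst (x, t))
  have e3 := (Real.hasDerivAt_cos t).comp_hasFDerivAt (x, t) (hsnd (x, t))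
  have e5 := (Real.hasDerivAt_sin t).comp_hasFDerivAt (x, t) (hsnd (x, t))
  have := (((e1.sub (e2.mul e3)).smul_const (ContinuousLinearMap.fst ℝ ℝ ℝ)).add
    ((e4.mul e5).smul_const (ContinuousLinearMap.snd ℝ ℝ ℝ))).fderiv
  refine (congrArg (fun L => L u v) this).trans ?_
  simp
  ring

open Filter Topology in
theorem locmin_gen (A B A1 B1 : ℝ → ℝ) (A2 B2 x t e : ℝ)
    (hA : ∀ᶠ y in 𝓝 x, HasDerivAt A (A1 y) y) (hB : ∀ᶠ y in 𝓝 x, HasDerivAt B (B1 y) y)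
    (hA1 : HasDerivAt A1 A2 x) (hB1 : HasDerivAt B1 B2 x)
    (ht : Real.cos t = e) (he : e = 1 ∨ e = -1) (h0 : A1 x - e * B1 x = 0)
    (h2 : 0 < A2 - e * B2) (hpos : 0 < e * B x) :
    IsLocalMin (fun p : ℝ × ℝ => A p.1 - B p.1 * Real.cos p.2) (x, t) ∧
    ¬ IsLocalMax (fun p : ℝ × ℝ => A p.1 - B p.1 * Real.cos p.2) (x, t) := by
  have hbd : ∀ s : ℝ, 0 ≤ 1 - e * Real.cos s := by
    intro s
    rcases he with h | h <;> rw [h] <;> linarith [Real.neg_one_le_cos s, Real.cos_le_one s]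
  have hee : e * e = 1 := by rcases he with h | h <;> rw [h] <;> norm_num
  constructor
  · have hd : ∀ᶠ y in 𝓝 x, HasDerivAt (fun y => A y - e * B y) (A1 y - e * B1 y) y := by
      filter_upwards [hA, hB] with y h1 h2 using h1.sub (h2.const_mul e)
    have hde : deriv (fun y => A y - e * B y) =ᶠ[𝓝 x] fun y => A1 y - e * B1 y := by
      filter_upwards [hd] with y h using h.deriv
    have hmin : IsLocalMin (fun y => A y - e * B y) x := by
      apply isLocalMin_of_deriv_deriv_pos
      · rw [hde.deriv_eq]; exact h2.trans_eq (hA1.sub (hB1.const_mul e)).deriv.symm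
      · rw [hde.self_of_nhds]; exact h0
      · exact hd.self_of_nhds.continuousAt
    have hBp : ∀ᶠ y in 𝓝 x, 0 < e * B y :=
      (continuousAt_const.mul hB.self_of_nhds.continuousAt).eventually (lt_mem_nhds hpos)
    have hf : Tendsto (fun p : ℝ × ℝ => p.1) (𝓝 (x, t)) (𝓝 x) := continuous_fst.tendsto (x, t)
    filter_upwards [hf.eventually hmin, hf.eventually hBp] with p h1 h3
    have := mul_nonneg h3.le (hbd p.2)
    have h4 : e * B p.1 * (1 - e * Real.cos p.2) = e * B p.1 - (e * e) * B p.1 * Real.cos p.2 := by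
      ring
    rw [h4, hee] at this
    simp only [ht]
    linarith
  · intro hmax
    have hf : Tendsto (fun s : ℝ => (x, s)) (𝓝 t) (𝓝 (x, t)) :=
      (Continuous.prodMk_right x).tendsto t
    have hc : Real.cos =ᶠ[𝓝 t] fun _ => e := by
      filter_upwards [hf.eventually hmax] with s hs
      simp only [ht] at hs
      have h1 : e * B x * (1 - e * Real.cos s) ≤ 0 := by
        have : e * B x * (1 - e * Real.cos s) = e * B x - (e * e) * B x * Real.cos s := by ring
        rw [this, hee]; linarith
      have h3 : 1 - e * Real.cos s = 0 := by
        refine le_antisymm ?_ (hbd s)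
        by_contra h
        push Not at h
        linarith [mul_pos hpos h]
      linear_combination (-e) * h3 - Real.cos s * hee
    have h5 := hc.deriv.deriv_eq
    simp at h5
    rw [← ht, h5] at hee
    simp at hee

open Filter Topology in
theorem locmax_gen (A B A1 B1 : ℝ → ℝ) (A2 B2 x t e : ℝ)
    (hA : ∀ᶠ y in 𝓝 x, HasDerivAt A (A1 y) y) (hB : ∀ᶠ y in 𝓝 x, HasDerivAt B (B1 y) y)
    (hA1 : HasDerivAt A1 A2 x) (hB1 : HasDerivAt B1 B2 x)
    (ht : Real.cos t = e) (he : e = 1 ∨ e = -1) (h0 : A1 x - e * B1 x = 0)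
    (h2 : A2 - e * B2 < 0) (hneg : e * B x < 0) :
    IsLocalMax (fun p : ℝ × ℝ => A p.1 - B p.1 * Real.cos p.2) (x, t) ∧
    ¬ IsLocalMin (fun p : ℝ × ℝ => A p.1 - B p.1 * Real.cos p.2) (x, t) := by
  have h := locmin_gen (fun y => - A y) (fun y => - B y) (fun y => - A1 y) (fun y => - B1 y)
    (-A2) (-B2) x t e (hA.mono fun y h => h.neg) (hB.mono fun y h => h.neg) hA1.neg hB1.neg ht he
    (by linarith) (by linarith) (by linarith)
  have hfun : (fun p : ℝ × ℝ => -A p.1 - -B p.1 * Real.cos p.2) =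
      fun p => -(A p.1 - B p.1 * Real.cos p.2) := by funext p; ring
  rw [hfun] at h
  refine ⟨by simpa using h.1.neg, fun h' => h.2 h'.neg⟩

/-- At a critical point `(ρ₀, θ₀)` with `ε = cos θ₀ ∈ {−1, 1}` and `f(ρ₀²) = εg(ρ₀²)`,
the Hessian of `H` in the coordinates `(ρ, θ)` is
`diag(2ρ₀²(f′(ρ₀²) − εg′(ρ₀²))/√(c(ρ₀²)), εb(ρ₀²)√(c(ρ₀²)))`; it is nondegenerate iff
`f′(ρ₀²) ≠ εg′(ρ₀²)`, definite iff `εb(ρ₀²)(f′(ρ₀²) − εg′(ρ₀²)) > 0` and indefinite iff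
that quantity is negative; and in the definite case `(ρ₀, θ₀)` is a local minimum iff
`εb(ρ₀²) > 0` and a local maximum iff `εb(ρ₀²) < 0`. -/
theorem stmt5 (ρm ρp : ℝ) (hρm : 0 ≤ ρm) (hρ : ρm < ρp)
    (a b c : ℝ → ℝ) (u₁ u₂ : ℝ)
    (hKU : closure (Set.Ioo (ρm^2) (ρp^2)) ⊆ Set.Ioo u₁ u₂)
    (ha : ContDiffOn ℝ (⊤ : ℕ∞) a (Set.Ioo u₁ u₂))
    (hb : ContDiffOn ℝ (⊤ : ℕ∞) b (Set.Ioo u₁ u₂))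
    (hc : ContDiffOn ℝ (⊤ : ℕ∞) c (Set.Ioo u₁ u₂))
    (ha' : ∀ X ∈ Set.Ioo (ρm^2) (ρp^2), deriv a X ≠ 0)
    (hb0 : ∀ X ∈ Set.Ioo (ρm^2) (ρp^2), b X ≠ 0)
    (hc0 : ∀ X ∈ Set.Ioo (ρm^2) (ρp^2), 0 < c X)
    (ρ₀ θ₀ ε : ℝ) (hρ₀ : ρ₀ ∈ Set.Ioo ρm ρp)
    (hcrit : fderiv ℝ (Hred a b c) (ρ₀, θ₀) = 0)
    (hεcos : Real.cos θ₀ = ε) (hεpm : ε = 1 ∨ ε = -1)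
    (hfg : fred a c (ρ₀^2) = ε * gred b c (ρ₀^2)) :
    (hessBil (Hred a b c) (ρ₀, θ₀) (1, 0) (1, 0)
        = 2 * ρ₀^2 * (deriv (fred a c) (ρ₀^2) - ε * deriv (gred b c) (ρ₀^2))
            / Real.sqrt (c (ρ₀^2)) ∧
      hessBil (Hred a b c) (ρ₀, θ₀) (1, 0) (0, 1) = 0 ∧
      hessBil (Hred a b c) (ρ₀, θ₀) (0, 1) (1, 0) = 0 ∧
      hessBil (Hred a b c) (ρ₀, θ₀) (0, 1) (0, 1)
        = ε * b (ρ₀^2) * Real.sqrt (c (ρ₀^2))) ∧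
    (hessBil (Hred a b c) (ρ₀, θ₀) (1, 0) (1, 0)
          * hessBil (Hred a b c) (ρ₀, θ₀) (0, 1) (0, 1)
        - hessBil (Hred a b c) (ρ₀, θ₀) (1, 0) (0, 1)
          * hessBil (Hred a b c) (ρ₀, θ₀) (0, 1) (1, 0) ≠ 0 ↔
      deriv (fred a c) (ρ₀^2) ≠ ε * deriv (gred b c) (ρ₀^2)) ∧
    (0 < hessBil (Hred a b c) (ρ₀, θ₀) (1, 0) (1, 0)
          * hessBil (Hred a b c) (ρ₀, θ₀) (0, 1) (0, 1)
        - hessBil (Hred a b c) (ρ₀, θ₀) (1, 0) (0, 1)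
          * hessBil (Hred a b c) (ρ₀, θ₀) (0, 1) (1, 0) ↔
      0 < ε * b (ρ₀^2)
          * (deriv (fred a c) (ρ₀^2) - ε * deriv (gred b c) (ρ₀^2))) ∧
    (hessBil (Hred a b c) (ρ₀, θ₀) (1, 0) (1, 0)
          * hessBil (Hred a b c) (ρ₀, θ₀) (0, 1) (0, 1)
        - hessBil (Hred a b c) (ρ₀, θ₀) (1, 0) (0, 1)
          * hessBil (Hred a b c) (ρ₀, θ₀) (0, 1) (1, 0) < 0 ↔
      ε * b (ρ₀^2)
          * (deriv (fred a c) (ρ₀^2) - ε * deriv (gred b c) (ρ₀^2)) < 0) ∧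
    (0 < ε * b (ρ₀^2)
          * (deriv (fred a c) (ρ₀^2) - ε * deriv (gred b c) (ρ₀^2)) →
      (IsLocalMin (Hred a b c) (ρ₀, θ₀) ↔ 0 < ε * b (ρ₀^2)) ∧
      (IsLocalMax (Hred a b c) (ρ₀, θ₀) ↔ ε * b (ρ₀^2) < 0)) := by
  have hρ0 : 0 < ρ₀ := lt_of_le_of_lt hρm hρ₀.1
  have hKsub : Set.Ioo (ρm^2) (ρp^2) ⊆ Set.Ioo u₁ u₂ := subset_closure.trans hKU
  have hX0 : ρ₀^2 ∈ Set.Ioo (ρm^2) (ρp^2) :=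
    ⟨by nlinarith [hρ₀.1], by nlinarith [hρ₀.2]⟩
  have hcd : ∀ F : ℝ → ℝ, ContDiffOn ℝ (⊤ : ℕ∞) F (Set.Ioo u₁ u₂) →
      ∀ X ∈ Set.Ioo (ρm^2) (ρp^2), DifferentiableAt ℝ F X ∧ DifferentiableAt ℝ (deriv F) X := by
    intro F hF X hX
    have hn : Set.Ioo u₁ u₂ ∈ nhds X := isOpen_Ioo.mem_nhds (hKsub hX)
    refine ⟨(hF.contDiffAt hn).differentiableAt (by simp), ?_⟩
    have h2 : ContDiffOn ℝ 1 (deriv F) (Set.Ioo u₁ u₂) :=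
      hF.deriv_of_isOpen isOpen_Ioo (by
        have : ((2 : ℕ∞) : WithTop ℕ∞) ≤ ((⊤ : ℕ∞) : WithTop ℕ∞) := by exact_mod_cast le_top
        exact le_trans (by norm_num) this)
    exact (h2.contDiffAt hn).differentiableAt (by simp)
  have hsq : ∀ y : ℝ, HasDerivAt (fun y : ℝ => y^2) (2 * y) y := by
    intro y; simpa using hasDerivAt_pow 2 y
  have hcomp : ∀ (F : ℝ → ℝ) (y : ℝ), DifferentiableAt ℝ F (y^2) →
      HasDerivAt (fun y => F (y^2)) (deriv F (y^2) * (2 * y)) y := fun F y hF =>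
    HasDerivAt.comp (h := fun y : ℝ => y^2) y hF.hasDerivAt (hsq y)
  have hev : ∀ᶠ y in nhds ρ₀, y^2 ∈ Set.Ioo (ρm^2) (ρp^2) :=
    (hsq ρ₀).continuousAt.eventually (isOpen_Ioo.mem_nhds hX0)
  have hc00 := hc0 _ hX0
  have hs0 : 0 < Real.sqrt (c (ρ₀^2)) := Real.sqrt_pos.2 hc00
  -- the one-variable pieces
  have hA : ∀ᶠ y in nhds ρ₀, HasDerivAt (fun y => a (y^2))
      ((y / Real.sqrt (c (y^2))) * fred a c (y^2)) y := by
    filter_upwards [hev] with y hy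
    have h := hcomp a y (hcd a ha _ hy).1
    have hs : 0 < Real.sqrt (c (y^2)) := Real.sqrt_pos.2 (hc0 _ hy)
    refine h.congr_deriv ?_
    unfold fred
    field_simp
  have hB : ∀ᶠ y in nhds ρ₀, HasDerivAt (fun y => b (y^2) * Real.sqrt (c (y^2)))
      ((y / Real.sqrt (c (y^2))) * gred b c (y^2)) y := by
    filter_upwards [hev] with y hy
    have h1 := hcomp b y (hcd b hb _ hy).1
    have h2 := (hcomp c y (hcd c hc _ hy).1).sqrt (hc0 _ hy).ne'
    have hs : 0 < Real.sqrt (c (y^2)) := Real.sqrt_pos.2 (hc0 _ hy)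
    have hss : Real.sqrt (c (y^2)) ^ 2 = c (y^2) := Real.sq_sqrt (hc0 _ hy).le
    refine (h1.mul h2).congr_deriv ?_
    unfold gred
    rw [← hss]
    simp only [Real.sqrt_sq hs.le]
    field_simp
  have dc := (hcd c hc _ hX0).1
  have dsq : DifferentiableAt ℝ (fun X => Real.sqrt (c X)) (ρ₀^2) := dc.sqrt hc00.ne'
  have df : DifferentiableAt ℝ (fred a c) (ρ₀^2) :=
    ((hcd a ha _ hX0).2.const_mul 2).mul dsq
  have dg : DifferentiableAt ℝ (gred b c) (ρ₀^2) :=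
    (((hcd b hb _ hX0).2.const_mul 2).mul dc).add ((hcd b hb _ hX0).1.mul (hcd c hc _ hX0).2)
  have dw : DifferentiableAt ℝ (fun y => y / Real.sqrt (c (y^2))) ρ₀ :=
    differentiableAt_id.div (hcomp _ ρ₀ dsq).differentiableAt hs0.ne'
  have hA1 := dw.hasDerivAt.mul (hcomp _ ρ₀ df)
  have hB1 := dw.hasDerivAt.mul (hcomp _ ρ₀ dg)
  have hH : Hred a b c = fun p : ℝ × ℝ =>
      (fun y => a (y^2)) p.1 - (fun y => b (y^2) * Real.sqrt (c (y^2))) p.1 * Real.cos p.2 := by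
    funext p; unfold Hred; ring
  have hsin : Real.sin θ₀ = 0 := by
    have := Real.sin_sq_add_cos_sq θ₀
    rw [hεcos] at this
    rcases hεpm with h | h <;> rw [h] at this <;> nlinarith
  have hess : ∀ u v, hessBil (Hred a b c) (ρ₀, θ₀) u v =
      (2 * ρ₀^2 * (deriv (fred a c) (ρ₀^2) - ε * deriv (gred b c) (ρ₀^2))
            / Real.sqrt (c (ρ₀^2))) * u.1 * v.1 + ε * b (ρ₀^2) * Real.sqrt (c (ρ₀^2)) * u.2 * v.2 := by
    intro u v
    unfold hessBil
    rw [hH]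
    refine (hess_gen _ _ _ _ _ _ ρ₀ θ₀ hA hB hA1 hB1 u v).trans ?_
    rw [hsin, hεcos]
    simp only [hfg]
    field_simp
    ring
  have h0 : (ρ₀ / Real.sqrt (c (ρ₀^2))) * fred a c (ρ₀^2)
      - ε * ((ρ₀ / Real.sqrt (c (ρ₀^2))) * gred b c (ρ₀^2)) = 0 := by rw [hfg]; ring
  have e11 : hessBil (Hred a b c) (ρ₀, θ₀) (1, 0) (1, 0)
      = 2 * ρ₀^2 * (deriv (fred a c) (ρ₀^2) - ε * deriv (gred b c) (ρ₀^2))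
            / Real.sqrt (c (ρ₀^2)) := by rw [hess]; simp
  have e12 : hessBil (Hred a b c) (ρ₀, θ₀) (1, 0) (0, 1) = 0 := by rw [hess]; simp
  have e21 : hessBil (Hred a b c) (ρ₀, θ₀) (0, 1) (1, 0) = 0 := by rw [hess]; simp
  have e22 : hessBil (Hred a b c) (ρ₀, θ₀) (0, 1) (0, 1)
        = ε * b (ρ₀^2) * Real.sqrt (c (ρ₀^2)) := by rw [hess]; simp
  have hdet : hessBil (Hred a b c) (ρ₀, θ₀) (1, 0) (1, 0)
          * hessBil (Hred a b c) (ρ₀, θ₀) (0, 1) (0, 1)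
        - hessBil (Hred a b c) (ρ₀, θ₀) (1, 0) (0, 1)
          * hessBil (Hred a b c) (ρ₀, θ₀) (0, 1) (1, 0) = (2 * ρ₀^2) * (ε * b (ρ₀^2)
          * (deriv (fred a c) (ρ₀^2) - ε * deriv (gred b c) (ρ₀^2))) := by
    rw [e11, e12, e21, e22]; field_simp; ring
  have hp : 0 < 2 * ρ₀^2 := by positivity
  have hε0 : ε ≠ 0 := by rcases hεpm with h | h <;> rw [h] <;> norm_num
  have hεb : ε * b (ρ₀^2) ≠ 0 := mul_ne_zero hε0 (hb0 _ hX0)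
  refine ⟨⟨e11, e12, e21, e22⟩, ?_, ?_, ?_, ?_⟩
  · rw [hdet]
    exact ⟨fun h => sub_ne_zero.1 (right_ne_zero_of_mul (right_ne_zero_of_mul h)),
      fun h => mul_ne_zero hp.ne' (mul_ne_zero hεb (sub_ne_zero.2 h))⟩
  · rw [hdet]; exact mul_pos_iff_of_pos_left hp
  · rw [hdet]
    exact ⟨fun h => by
      by_contra h'
      push Not at h'
      linarith [mul_nonneg hp.le h'], fun h => mul_neg_of_pos_of_neg hp h⟩
  · intro hdef
    have hD : ∀ w f g f' g' s r : ℝ, f = ε * g →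
        (w * f + r / s * (f' * (2 * r))) - ε * (w * g + r / s * (g' * (2 * r)))
          = (2 * r^2 / s) * (f' - ε * g') := by
      intro w f g f' g' s r h; rw [h]; ring
    have hq : 0 < 2 * ρ₀^2 / Real.sqrt (c (ρ₀^2)) := by positivity
    rcases lt_or_gt_of_ne hεb with hn | hn
    · have hneg : deriv (fred a c) (ρ₀^2) - ε * deriv (gred b c) (ρ₀^2) < 0 := by
        by_contra h
        push Not at h
        linarith [mul_nonpos_of_nonpos_of_nonneg hn.le h]
      have := locmax_gen _ _ _ _ _ _ ρ₀ θ₀ ε hA hB hA1 hB1 hεcos hεpm h0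
        (by
          rw [hD _ _ _ _ _ _ _ hfg]
          exact mul_neg_of_pos_of_neg hq hneg)
        (by
          have := mul_neg_of_neg_of_pos hn hs0
          linarith)
      rw [← hH] at this
      exact ⟨⟨fun h => absurd h this.2, fun h => absurd h hn.not_gt⟩, fun _ => hn, fun _ => this.1⟩
    · have hpos : 0 < deriv (fred a c) (ρ₀^2) - ε * deriv (gred b c) (ρ₀^2) :=
        (mul_pos_iff_of_pos_left hn).1 hdef
      have := locmin_gen _ _ _ _ _ _ ρ₀ θ₀ ε hA hB hA1 hB1 hεcos hεpm h0
        (by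
          rw [hD _ _ _ _ _ _ _ hfg]
          exact mul_pos hq hpos)
        (by
          have := mul_pos hn hs0
          linarith)
      rw [← hH] at this
      exact ⟨⟨fun _ => hn, fun _ => this.1⟩, fun h => absurd h this.2, fun h => absurd h hn.not_gt⟩
end

section
/- With notation as in the context: (1) if 0 < t < t⁻, then H_t^0 has no critical points, and for each 0 < j < α the function H_t^j has exactly one critical point, which is a nondegenerate local maximum; (2) if t⁻ < t < t⁺, then for every 0 ≤ j < α the function H_t^j has exactly one critical point, which is a nondegenerate local maximum; (3) if t⁺ < t ≤ 1, then H_t^0 has exactly two critical points, one a nondegenerate local maximum and one a nondegenerate saddle, while for each 0 < j < α exactly one of the following holds: H_t^j has three critical points (a nondegenerate local maximum, a nondegenerate local minimum and a nondegenerate saddle), or H_t^j has two critical points (a nondegenerate local maximum and one degenerate critical point), or H_t^j has a single critical point which is a nondegenerate local maximum. -/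
/-- The reduced Hamiltonian `H_t^j(ρ, θ) = 2γδtα² + (1 − 2t)(α + j − ρ²)
− 2γδt(ρ² − j)² + 4γtρ(α + j − ρ²)·cos θ·√(ρ² − 2j)` on the open cylinder. -/
noncomputable def HCP (α γ δ t j : ℝ) (p : ℝ × ℝ) : ℝ :=
  2*γ*δ*t*α^2 + (1 - 2*t)*(α + j - p.1^2) - 2*γ*δ*t*(p.1^2 - j)^2
    + 4*γ*t*p.1*(α + j - p.1^2) * Real.cos p.2 * Real.sqrt (p.1^2 - 2*j)

/-- The open cylinder `{(ρ, θ) : √(2j) < ρ < √(α + j), θ ∈ ℝ/2πℤ}`, realized as the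
strip with `θ ∈ [0, 2π)` (the functions considered are `2π`-periodic in `θ`). -/
def cylCP (α j : ℝ) : Set (ℝ × ℝ) :=
  {p | Real.sqrt (2*j) < p.1 ∧ p.1 < Real.sqrt (α + j) ∧
       0 ≤ p.2 ∧ p.2 < 2 * Real.pi}

/-- `p` is a critical point of `F`. -/
def IsCrit (F : ℝ × ℝ → ℝ) (p : ℝ × ℝ) : Prop := fderiv ℝ F p = 0

/-- Nondegenerate local maximum: critical point with negative definite Hessian. -/
def NondegMax (F : ℝ × ℝ → ℝ) (p : ℝ × ℝ) : Prop :=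
  IsCrit F p ∧ ∀ v : ℝ × ℝ, v ≠ 0 → hessBil F p v v < 0

/-- Nondegenerate local minimum: critical point with positive definite Hessian. -/
def NondegMin (F : ℝ × ℝ → ℝ) (p : ℝ × ℝ) : Prop :=
  IsCrit F p ∧ ∀ v : ℝ × ℝ, v ≠ 0 → 0 < hessBil F p v v

/-- Nondegenerate saddle: critical point with nondegenerate indefinite Hessian. -/
def NondegSaddle (F : ℝ × ℝ → ℝ) (p : ℝ × ℝ) : Prop :=
  IsCrit F p ∧ (∀ v : ℝ × ℝ, (∀ w, hessBil F p v w = 0) → v = 0) ∧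
    (∃ v, 0 < hessBil F p v v) ∧ (∃ w, hessBil F p w w < 0)

/-- Degenerate critical point: critical point with singular Hessian. -/
def DegenCrit (F : ℝ × ℝ → ℝ) (p : ℝ × ℝ) : Prop :=
  IsCrit F p ∧ ∃ v : ℝ × ℝ, v ≠ 0 ∧ ∀ w, hessBil F p v w = 0

open Real Set Filter Topology

/-- derivative of `g(s) = (α - s) √(s² - j²)` -/
noncomputable def gOne (α j s : ℝ) : ℝ :=
  -√(s^2 - j^2) + (α - s) * s / √(s^2 - j^2)

/-- second derivative of `g` -/
noncomputable def gTwo (α j s : ℝ) : ℝ :=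
  -2 * s / √(s^2 - j^2) - (α - s) * j^2 / √(s^2 - j^2)^3

lemma r_pos {j s : ℝ} (hj : 0 ≤ j) (hs : j < s) : 0 < √(s^2 - j^2) :=
  Real.sqrt_pos.2 (by nlinarith)

lemma r_sq {j s : ℝ} (hj : 0 ≤ j) (hs : j < s) : √(s^2 - j^2)^2 = s^2 - j^2 :=
  Real.sq_sqrt (by nlinarith)

lemma hasDeriv_r {j s : ℝ} (hj : 0 ≤ j) (hs : j < s) :
    HasDerivAt (fun s : ℝ => √(s^2 - j^2)) (s / √(s^2 - j^2)) s := by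
  have h1 : HasDerivAt (fun s : ℝ => s^2 - j^2) (2 * s) s := by
    simpa using ((hasDerivAt_id s).pow 2).sub_const (j^2)
  have h2 := h1.sqrt (by nlinarith : s^2 - j^2 ≠ 0)
  convert h2 using 1
  have := r_pos hj hs
  field_simp

lemma hasDeriv_g {α j s : ℝ} (hj : 0 ≤ j) (hs : j < s) :
    HasDerivAt (fun s : ℝ => (α - s) * √(s^2 - j^2)) (gOne α j s) s := by
  have h2 := ((hasDerivAt_id s).const_sub α).mul (hasDeriv_r hj hs)
  refine h2.congr_deriv ?_
  simp only [id, gOne]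
  ring

lemma hasDeriv_gOne {α j s : ℝ} (hj : 0 ≤ j) (hs : j < s) :
    HasDerivAt (gOne α j) (gTwo α j s) s := by
  have hr := r_pos hj hs
  have hr2 := r_sq hj hs
  have h := (hasDeriv_r hj hs).neg.add
    ((((hasDerivAt_id s).const_sub α).mul (hasDerivAt_id s)).div (hasDeriv_r hj hs) hr.ne')
  refine h.congr_deriv ?_
  simp only [id, gTwo, Pi.mul_apply]
  set r := √(s^2 - j^2)
  have hj2 : j^2 = s^2 - r^2 := by linarith
  rw [hj2]
  field_simp
  ring

lemma hasF {A B : ℝ → ℝ} {A' B' : ℝ} {p : ℝ × ℝ} (hA : HasDerivAt A A' p.1)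
    (hB : HasDerivAt B B' p.1) :
    HasFDerivAt (fun p : ℝ × ℝ => A p.1 + B p.1 * cos p.2)
      ((A' + B' * cos p.2) • ContinuousLinearMap.fst ℝ ℝ ℝ +
        (-(B p.1) * sin p.2) • ContinuousLinearMap.snd ℝ ℝ ℝ) p := by
  have h1 := hA.comp_hasFDerivAt p (hasFDerivAt_fst (𝕜 := ℝ) (E := ℝ) (F := ℝ) (p := p))
  have h2 := hB.comp_hasFDerivAt p (hasFDerivAt_fst (𝕜 := ℝ) (E := ℝ) (F := ℝ) (p := p))
  have h3 := (Real.hasDerivAt_cos p.2).comp_hasFDerivAt p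
    (hasFDerivAt_snd (𝕜 := ℝ) (E := ℝ) (F := ℝ) (p := p))
  refine (h1.add (h2.mul h3)).congr_fderiv ?_
  ext <;> simp <;> ring

lemma hasF_sin {B : ℝ → ℝ} {B' : ℝ} {p : ℝ × ℝ}
    (hB : HasDerivAt B B' p.1) :
    HasFDerivAt (fun p : ℝ × ℝ => -(B p.1) * sin p.2)
      ((-B' * sin p.2) • ContinuousLinearMap.fst ℝ ℝ ℝ +
        (-(B p.1) * cos p.2) • ContinuousLinearMap.snd ℝ ℝ ℝ) p := by
  have h2 := hB.neg.comp_hasFDerivAt p (hasFDerivAt_fst (𝕜 := ℝ) (E := ℝ) (F := ℝ) (p := p))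
  have h3 := (Real.hasDerivAt_sin p.2).comp_hasFDerivAt p
    (hasFDerivAt_snd (𝕜 := ℝ) (E := ℝ) (F := ℝ) (p := p))
  refine (h2.mul h3).congr_fderiv ?_
  ext <;> simp <;> ring

lemma hess_gen_s6 {F : ℝ × ℝ → ℝ} {A B A' B' : ℝ → ℝ} {a2 b2 : ℝ} {p : ℝ × ℝ} {U : Set ℝ}
    (hU : IsOpen U) (hp : p.1 ∈ U)
    (hF : ∀ q : ℝ × ℝ, q.1 ∈ U → F q = A q.1 + B q.1 * cos q.2)
    (hA : ∀ x ∈ U, HasDerivAt A (A' x) x) (hB : ∀ x ∈ U, HasDerivAt B (B' x) x)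
    (hA2 : HasDerivAt A' a2 p.1) (hB2 : HasDerivAt B' b2 p.1) :
    fderiv ℝ F p = ((A' p.1 + B' p.1 * cos p.2) • ContinuousLinearMap.fst ℝ ℝ ℝ +
        (-(B p.1) * sin p.2) • ContinuousLinearMap.snd ℝ ℝ ℝ) ∧
    ∀ u v, hessBil F p u v = (a2 + b2 * cos p.2) * u.1 * v.1
      - B' p.1 * sin p.2 * (u.1 * v.2 + u.2 * v.1) - B p.1 * cos p.2 * u.2 * v.2 := by
  have hV : IsOpen {q : ℝ × ℝ | q.1 ∈ U} := hU.preimage continuous_fst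
  have key : ∀ q : ℝ × ℝ, q.1 ∈ U → fderiv ℝ F q =
      ((A' q.1 + B' q.1 * cos q.2) • ContinuousLinearMap.fst ℝ ℝ ℝ +
        (-(B q.1) * sin q.2) • ContinuousLinearMap.snd ℝ ℝ ℝ) := by
    intro q hq
    have h := hasF (p := q) (hA _ hq) (hB _ hq)
    refine (h.congr_of_eventuallyEq ?_).fderiv
    filter_upwards [hV.mem_nhds hq] with x hx using hF x hx
  refine ⟨key p hp, fun u v => ?_⟩
  have h2 := ((hasF (p := p) hA2 hB2).smul_const (ContinuousLinearMap.fst ℝ ℝ ℝ)).add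
    ((hasF_sin (p := p) (hB _ hp)).smul_const (ContinuousLinearMap.snd ℝ ℝ ℝ))
  have h3 : HasFDerivAt (fderiv ℝ F) _ p := h2.congr_of_eventuallyEq (by
    filter_upwards [hV.mem_nhds hp] with x hx using key x hx)
  rw [hessBil, h3.fderiv]
  simp
  ring

lemma HCP_eq {α γ δ t j : ℝ} {p : ℝ × ℝ} (hp : 0 < p.1) :
    HCP α γ δ t j p = (2*γ*δ*t*α^2 + (1 - 2*t)*(α - (p.1^2 - j)) - 2*γ*δ*t*(p.1^2 - j)^2)
      + (4*γ*t*((α - (p.1^2 - j)) * √((p.1^2 - j)^2 - j^2))) * cos p.2 := by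
  have : √((p.1^2 - j)^2 - j^2) = p.1 * √(p.1^2 - 2*j) := by
    rw [show (p.1^2 - j)^2 - j^2 = p.1^2 * (p.1^2 - 2*j) by ring,
      Real.sqrt_mul (sq_nonneg _), Real.sqrt_sq hp.le]
  rw [this, HCP]
  ring

lemma main_gen {α γ δ t j : ℝ} (hj : 0 ≤ j) {p : ℝ × ℝ} (hp : √(2*j) < p.1) :
    (fderiv ℝ (HCP α γ δ t j) p =
      ((2 * p.1 * (-(1-2*t) - 4*γ*δ*t*(p.1^2-j) + 4*γ*t*gOne α j (p.1^2-j) * cos p.2)) •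
          ContinuousLinearMap.fst ℝ ℝ ℝ +
        (-(4*γ*t*((α - (p.1^2 - j)) * √((p.1^2 - j)^2 - j^2))) * sin p.2) •
          ContinuousLinearMap.snd ℝ ℝ ℝ)) ∧
    (sin p.2 = 0 → -(1-2*t) - 4*γ*δ*t*(p.1^2-j) + 4*γ*t*gOne α j (p.1^2-j) * cos p.2 = 0 →
      ∀ u v, hessBil (HCP α γ δ t j) p u v =
        4 * p.1^2 * (4*γ*t) * (-δ + gTwo α j (p.1^2-j) * cos p.2) * u.1 * v.1
        - (4*γ*t*((α - (p.1^2 - j)) * √((p.1^2 - j)^2 - j^2))) * cos p.2 * u.2 * v.2) := by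
  have hmem : ∀ x ∈ Ioi (√(2*j)), 0 < x ∧ j < x^2 - j := by
    intro x hx
    have h0 : 0 < x := lt_of_le_of_lt (Real.sqrt_nonneg _) hx
    have := (Real.sqrt_lt' h0).1 hx
    exact ⟨h0, by linarith⟩
  have hs : ∀ x : ℝ, HasDerivAt (fun x : ℝ => x^2 - j) (2*x) x := fun x => by
    simpa using ((hasDerivAt_id x).pow 2).sub_const j
  have hg1 : HasDerivAt (fun x : ℝ => gOne α j (x^2-j)) (gTwo α j (p.1^2-j) * (2*p.1)) p.1 :=
    HasDerivAt.comp p.1 (h₂ := gOne α j) (hasDeriv_gOne (α := α) hj (hmem _ hp).2) (hs p.1)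
  obtain ⟨h1, h2⟩ := hess_gen_s6 (F := HCP α γ δ t j) (p := p)
    (A := fun x => 2*γ*δ*t*α^2 + (1 - 2*t)*(α - (x^2 - j)) - 2*γ*δ*t*(x^2 - j)^2)
    (B := fun x => 4*γ*t*((α - (x^2 - j)) * √((x^2 - j)^2 - j^2)))
    (A' := fun x => 2*x*(-(1-2*t) - 4*γ*δ*t*(x^2-j)))
    (B' := fun x => 2*x*(4*γ*t*gOne α j (x^2-j)))
    (a2 := 2*(-(1-2*t) - 4*γ*δ*t*(p.1^2-j)) + 2*p.1*(- 4*γ*δ*t*(2*p.1)))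
    (b2 := 2*(4*γ*t*gOne α j (p.1^2-j)) + 2*p.1*(4*γ*t*(gTwo α j (p.1^2-j) * (2*p.1))))
    isOpen_Ioi hp
    (fun q hq => HCP_eq (hmem _ hq).1)
    (fun x hx => by
      have := ((((hs x).const_sub α).const_mul (1-2*t)).const_add (2*γ*δ*t*α^2)).sub
        (((hs x).pow 2).const_mul (2*γ*δ*t))
      refine this.congr_deriv ?_
      push_cast; ring)
    (fun x hx => by
      have := ((hasDeriv_g (α := α) hj (hmem _ hx).2).comp x (hs x)).const_mul (4*γ*t)
      refine this.congr_deriv ?_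
      ring)
    (by
      have := ((hasDerivAt_id p.1).const_mul 2).mul
        (((hs p.1).const_mul (4*γ*δ*t)).const_sub (-(1-2*t)))
      refine this.congr_deriv ?_
      simp only [id]; ring)
    (by
      have := ((hasDerivAt_id p.1).const_mul 2).mul (hg1.const_mul (4*γ*t))
      refine this.congr_deriv ?_
      simp only [id]; ring)
  refine ⟨?_, fun hsin hc u v => ?_⟩
  · rw [h1]; congr 2; ring
  · rw [h2, hsin]
    linear_combination 2 * u.1 * v.1 * hc

lemma cyl_mem {α j : ℝ} (hj : 0 ≤ j) (p : ℝ × ℝ) :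
    p ∈ cylCP α j ↔ 0 < p.1 ∧ j < p.1^2 - j ∧ p.1^2 - j < α ∧ 0 ≤ p.2 ∧ p.2 < 2*π := by
  unfold cylCP
  constructor
  · rintro ⟨h1, h2, h3, h4⟩
    have h0 : 0 < p.1 := lt_of_le_of_lt (Real.sqrt_nonneg _) h1
    have a := (Real.sqrt_lt' h0).1 h1
    have b := (Real.lt_sqrt h0.le).1 h2
    exact ⟨h0, by linarith, by linarith, h3, h4⟩
  · rintro ⟨h0, h1, h2, h3, h4⟩
    exact ⟨(Real.sqrt_lt' h0).2 (by linarith), (Real.lt_sqrt h0.le).2 (by linarith), h3, h4⟩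

/-- classification of critical points -/
lemma crit_class {α γ δ t j c : ℝ} (hj : 0 ≤ j) (hK : 0 < γ*t) (hc : 1 - 2*t = 4*(γ*t)*c)
    {q : ℝ × ℝ} (hq : q ∈ cylCP α j) (h : IsCrit (HCP α γ δ t j) q) :
    ∃ s ∈ Ioo j α, (q = (√(s+j), 0) ∧ -c - δ*s + gOne α j s = 0) ∨
      (q = (√(s+j), π) ∧ -c - δ*s - gOne α j s = 0) := by
  obtain ⟨h0, h1, h2, h3, h4⟩ := (cyl_mem hj q).1 hq
  have hm := (main_gen (α := α) (γ := γ) (δ := δ) (t := t) hj hq.1).1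
  rw [IsCrit, hm] at h
  have e1 := DFunLike.congr_fun h (1, 0)
  have e2 := DFunLike.congr_fun h (0, 1)
  simp at e1 e2
  have hr := r_pos hj h1
  have hsin : sin q.2 = 0 := by
    have hb : α - (q.1^2 - j) ≠ 0 := by linarith
    have hk1 : γ ≠ 0 := fun h => by simp [h] at hK
    have hk2 : t ≠ 0 := fun h => by simp [h] at hK
    have := hr.ne'
    tauto
  have hx : √((q.1^2 - j) + j) = q.1 := by rw [sub_add_cancel, Real.sqrt_sq h0.le]
  have e3 := e1.resolve_left h0.ne'
  refine ⟨q.1^2 - j, ⟨h1, h2⟩, ?_⟩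
  have hth : q.2 = 0 ∨ q.2 = π := by
    rcases lt_trichotomy q.2 π with h | h | h
    · left
      by_contra hne
      exact (Real.sin_pos_of_pos_of_lt_pi (lt_of_le_of_ne h3 (Ne.symm hne)) h).ne' hsin
    · exact Or.inr h
    · have := Real.sin_pos_of_pos_of_lt_pi (x := q.2 - π) (by linarith) (by linarith)
      rw [Real.sin_sub_pi, hsin] at this
      simp at this
  rcases hth with h | h
  · left
    refine ⟨Prod.ext hx.symm h, ?_⟩
    rw [h, Real.cos_zero] at e3
    have : 4*(γ*t) * (-c - δ*(q.1^2-j) + gOne α j (q.1^2-j)) = 0 := by linarith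
    exact (mul_eq_zero.1 this).resolve_left (by positivity)
  · right
    refine ⟨Prod.ext hx.symm h, ?_⟩
    rw [h, Real.cos_pi] at e3
    have : 4*(γ*t) * (-c - δ*(q.1^2-j) - gOne α j (q.1^2-j)) = 0 := by linarith
    exact (mul_eq_zero.1 this).resolve_left (by positivity)

lemma pt_mem {α j s θ : ℝ} (hj : 0 ≤ j) (hs : s ∈ Ioo j α) (h0 : 0 ≤ θ) (h1 : θ < 2*π) :
    (√(s+j), θ) ∈ cylCP α j := by
  have hs1 := hs.1
  have hs2 := hs.2
  rw [cyl_mem hj]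
  have : √(s+j)^2 = s + j := Real.sq_sqrt (by linarith)
  simp only [this]
  exact ⟨Real.sqrt_pos.2 (by linarith), by linarith, by linarith, h0, h1⟩

lemma pt_crit {α γ δ t j c s θ ε : ℝ} (hj : 0 ≤ j) (hK : 0 < γ*t) (hc : 1 - 2*t = 4*(γ*t)*c)
    (hs : s ∈ Ioo j α) (hsin : sin θ = 0) (hcos : cos θ = ε)
    (hz : -c - δ*s + ε * gOne α j s = 0) :
    IsCrit (HCP α γ δ t j) (√(s+j), θ) ∧
    ∃ P Q : ℝ, 0 < P ∧ 0 < Q ∧ ∀ u v, hessBil (HCP α γ δ t j) (√(s+j), θ) u v =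
      P * (-δ + ε * gTwo α j s) * (u.1 * v.1) - Q * ε * (u.2 * v.2) := by
  have hs1 := hs.1
  have hs2 := hs.2
  have hsq : √(s+j)^2 = s + j := Real.sq_sqrt (by linarith)
  have hlt : √(2*j) < √(s+j) := Real.sqrt_lt_sqrt (by linarith) (by linarith)
  obtain ⟨m1, m2⟩ := main_gen (α := α) (γ := γ) (δ := δ) (t := t) hj (p := (√(s+j), θ)) hlt
  simp only [hsq, add_sub_cancel_right, hsin, hcos] at m1 m2
  have hz' : -(1-2*t) - 4*γ*δ*t*s + 4*γ*t*gOne α j s * ε = 0 := by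
    rw [hc]; linear_combination (4*(γ*t)) * hz
  refine ⟨?_, 4 * (s+j) * (4*(γ*t)), 4*(γ*t)*((α - s) * √(s^2-j^2)), ?_, ?_, fun u v => ?_⟩
  · rw [IsCrit, m1, hz']; simp
  · have : 0 < s + j := by linarith
    positivity
  · have := r_pos hj hs1
    have : 0 < α - s := by linarith
    positivity
  · rw [m2 trivial hz' u v]; ring

lemma quad_pos {P Q : ℝ} (hP : 0 < P) (hQ : 0 < Q) {v : ℝ × ℝ} (hv : v ≠ 0) :
    0 < P * (v.1*v.1) + Q * (v.2*v.2) := by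
  by_cases h : v.1 = 0
  · have h2 : v.2 ≠ 0 := fun h2 => hv (Prod.ext h h2)
    have := mul_self_pos.2 h2
    rw [h]; simp; positivity
  · have := mul_self_pos.2 h
    have := mul_self_nonneg v.2
    positivity

lemma pt_max {α γ δ t j c s : ℝ} (hj : 0 ≤ j) (hK : 0 < γ*t) (hc : 1 - 2*t = 4*(γ*t)*c)
    (hs : s ∈ Ioo j α) (hz : -c - δ*s + gOne α j s = 0) (hn : -δ + gTwo α j s < 0) :
    NondegMax (HCP α γ δ t j) (√(s+j), 0) := by
  obtain ⟨h1, P, Q, hP, hQ, h⟩ := pt_crit (δ := δ) (ε := 1) hj hK hc hs Real.sin_zero Real.cos_zero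
    (by linarith)
  refine ⟨h1, fun v hv => ?_⟩
  rw [h]
  have := quad_pos (mul_pos hP (neg_pos.2 hn)) hQ hv
  linarith

lemma pt_min {α γ δ t j c s : ℝ} (hj : 0 ≤ j) (hK : 0 < γ*t) (hc : 1 - 2*t = 4*(γ*t)*c)
    (hs : s ∈ Ioo j α) (hz : -c - δ*s - gOne α j s = 0) (hn : 0 < -δ - gTwo α j s) :
    NondegMin (HCP α γ δ t j) (√(s+j), π) := by
  obtain ⟨h1, P, Q, hP, hQ, h⟩ := pt_crit (δ := δ) (ε := -1) hj hK hc hs Real.sin_pi Real.cos_pi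
    (by linarith)
  refine ⟨h1, fun v hv => ?_⟩
  rw [h]
  have := quad_pos (mul_pos hP hn) hQ hv
  linarith

lemma pt_saddle {α γ δ t j c s : ℝ} (hj : 0 ≤ j) (hK : 0 < γ*t) (hc : 1 - 2*t = 4*(γ*t)*c)
    (hs : s ∈ Ioo j α) (hz : -c - δ*s - gOne α j s = 0) (hn : -δ - gTwo α j s < 0) :
    NondegSaddle (HCP α γ δ t j) (√(s+j), π) := by
  obtain ⟨h1, P, Q, hP, hQ, h⟩ := pt_crit (δ := δ) (ε := -1) hj hK hc hs Real.sin_pi Real.cos_pi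
    (by linarith)
  have hneg : P * (-δ + -1 * gTwo α j s) < 0 := mul_neg_of_pos_of_neg hP (by linarith)
  refine ⟨h1, fun v hv => ?_, ⟨(0, 1), ?_⟩, ⟨(1, 0), ?_⟩⟩
  · have a := hv (1, 0)
    have b := hv (0, 1)
    rw [h] at a b
    simp only [mul_one, mul_zero, sub_zero, zero_sub] at a b
    refine Prod.ext ((mul_eq_zero.1 a).resolve_left hneg.ne) ?_
    have : Q * v.2 = 0 := by linarith
    exact (mul_eq_zero.1 this).resolve_left hQ.ne'
  · rw [h]; simpa using hQ
  · rw [h]; simpa using hneg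

lemma pt_degen {α γ δ t j c s : ℝ} (hj : 0 ≤ j) (hK : 0 < γ*t) (hc : 1 - 2*t = 4*(γ*t)*c)
    (hs : s ∈ Ioo j α) (hz : -c - δ*s - gOne α j s = 0) (hn : -δ - gTwo α j s = 0) :
    DegenCrit (HCP α γ δ t j) (√(s+j), π) := by
  obtain ⟨h1, P, Q, hP, hQ, h⟩ := pt_crit (δ := δ) (ε := -1) hj hK hc hs Real.sin_pi Real.cos_pi
    (by linarith)
  refine ⟨h1, (1, 0), by simp, fun w => ?_⟩
  rw [h, show -δ + -1 * gTwo α j s = 0 by linarith]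
  simp

lemma phi_deriv {α j s : ℝ} (c δ e : ℝ) (hj : 0 ≤ j) (hs : j < s) :
    HasDerivAt (fun s => -c - δ*s + e * gOne α j s) (-δ + e * gTwo α j s) s := by
  have := (((hasDerivAt_id s).const_mul δ).const_sub (-c)).add
    ((hasDeriv_gOne (α := α) hj hs).const_mul e)
  refine this.congr_deriv ?_
  simp

lemma phi_cont {α j : ℝ} (c δ e : ℝ) (hj : 0 ≤ j) {x y : ℝ} (hx : j < x) :
    ContinuousOn (fun s => -c - δ*s + e * gOne α j s) (Icc x y) := fun s hs =>
  (phi_deriv c δ e hj (lt_of_lt_of_le hx hs.1)).continuousAt.continuousWithinAt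

lemma phi_rolle {α j c δ e : ℝ} (hj : 0 ≤ j) {x y : ℝ} (hx : j < x) (hxy : x < y)
    (h1 : -c - δ*x + e * gOne α j x = 0) (h2 : -c - δ*y + e * gOne α j y = 0) :
    ∃ z ∈ Ioo x y, -δ + e * gTwo α j z = 0 :=
  exists_hasDerivAt_eq_zero hxy (phi_cont c δ e hj hx) (by simp only [h1, h2])
    (fun s hs => phi_deriv c δ e hj (hx.trans hs.1))

lemma r_phi {α j s : ℝ} (c δ e : ℝ) (hj : 0 ≤ j) (hs : j < s) :
    √(s^2-j^2) * (-c - δ*s + e * gOne α j s) =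
      (-c - δ*s) * √(s^2-j^2) + e * (-√(s^2-j^2)^2 + (α - s)*s) := by
  have := r_pos hj hs
  unfold gOne
  field_simp

lemma q_cont (α j c δ e : ℝ) : Continuous (fun s : ℝ =>
      (-c - δ*s) * √(s^2-j^2) + e * (-√(s^2-j^2)^2 + (α - s)*s)) := by
  fun_prop

lemma gTwo_neg {α j s : ℝ} (hj : 0 ≤ j) (hs : s ∈ Ioo j α) : gTwo α j s < 0 := by
  have hr := r_pos hj hs.1
  have h0 : 0 < s := lt_of_le_of_lt hj hs.1
  have h1 : 0 < α - s := sub_pos.2 hs.2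
  unfold gTwo
  have a : 0 < 2 * s / √(s^2-j^2) := by positivity
  have b : 0 ≤ (α - s) * j^2 / √(s^2-j^2)^3 := by positivity
  have : -2 * s / √(s^2-j^2) = -(2 * s / √(s^2-j^2)) := by ring
  linarith

lemma gTwo_mono {α j x y : ℝ} (hj : 0 < j) (hx : j < x) (hxy : x < y) (hy : y < α) :
    gTwo α j x < gTwo α j y := by
  have hr := r_pos hj.le hx
  have hr' := r_pos hj.le (hx.trans hxy)
  have hrr : √(x^2-j^2) < √(y^2-j^2) := Real.sqrt_lt_sqrt (by nlinarith) (by nlinarith)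
  have e1 := r_sq hj.le hx
  have e2 := r_sq hj.le (hx.trans hxy)
  unfold gTwo
  set r := √(x^2-j^2)
  set r' := √(y^2-j^2)
  have hx0 : 0 < x := hj.trans hx
  have h1 : y * r ≤ x * r' := by
    refine (sq_le_sq₀ (mul_nonneg (hx0.trans hxy).le hr.le) (by positivity)).1 ?_
    rw [mul_pow, mul_pow, e1, e2]
    nlinarith [mul_pos hj hj, mul_pos (sub_pos.2 hxy) (add_pos hx0 (hx0.trans hxy))]
  have h2 : y / r' ≤ x / r := by
    rw [div_le_div_iff₀ hr' hr]; exact h1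
  have h3 : (α - y) * j^2 / r'^3 < (α - x) * j^2 / r^3 := by
    have h4 : 0 < α - y := by linarith
    have h5 : 0 < α - x := by linarith
    have h6 : (α - y) * j^2 < (α - x) * j^2 := by
      apply mul_lt_mul_of_pos_right _ (by positivity); linarith
    have h7 : r^3 ≤ r'^3 := by gcongr
    exact div_lt_div₀ h6 h7 (by positivity) (by positivity)
  have : -2 * x / r = -2 * (x / r) := by ring
  have : -2 * y / r' = -2 * (y / r') := by ring
  linarith

lemma root_plus {α j c δ : ℝ} (hj : 0 < j) (hjα : j < α) (hend : 0 < c + δ*α) :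
    ∃ s ∈ Ioo j α, -c - δ*s + gOne α j s = 0 := by
  have h := intermediate_value_Ioo' hjα.le (q_cont α j c δ 1).continuousOn
  have hr := r_pos hj.le hjα
  have hm : (0:ℝ) ∈ Ioo ((-c - δ*α) * √(α^2-j^2) + 1 * (-√(α^2-j^2)^2 + (α - α)*α))
      ((-c - δ*j) * √(j^2-j^2) + 1 * (-√(j^2-j^2)^2 + (α - j)*j)) := by
    constructor
    · nlinarith [mul_pos hend hr]
    · simp [hj, hjα]
  obtain ⟨s, hs, hs0⟩ := h hm
  refine ⟨s, hs, ?_⟩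
  have hrs := r_pos hj.le hs.1
  have := r_phi (α := α) c δ 1 hj.le hs.1
  simp only at hs0
  rw [hs0] at this
  have := (mul_eq_zero.1 this).resolve_left hrs.ne'
  linarith

lemma root_plus_unique {α j c δ x y : ℝ} (hj : 0 ≤ j) (hδ : 0 < δ)
    (hx : x ∈ Ioo j α) (hy : y ∈ Ioo j α)
    (h1 : -c - δ*x + gOne α j x = 0) (h2 : -c - δ*y + gOne α j y = 0) : x = y := by
  have key : ∀ x y, x ∈ Ioo j α → y ∈ Ioo j α → -c - δ*x + gOne α j x = 0 →
      -c - δ*y + gOne α j y = 0 → ¬ x < y := by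
    intro x y hx hy h1 h2 hxy
    obtain ⟨z, hz, hz0⟩ := phi_rolle (c := c) (δ := δ) (e := 1) hj hx.1 hxy (by linarith)
      (by linarith)
    have := gTwo_neg hj (α := α) ⟨hx.1.trans hz.1, hz.2.trans hy.2⟩
    linarith
  exact le_antisymm (not_lt.1 (key y x hy hx h2 h1)) (not_lt.1 (key x y hx hy h1 h2))

lemma minus_neg {α j c δ s : ℝ} (hj : 0 ≤ j) (hδ : 2 < δ) (hc : -α < c) (hs : s ∈ Ioo j α) :
    -c - δ*s - gOne α j s < 0 := by
  have hr := r_pos hj hs.1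
  have h0 : 0 < s := lt_of_le_of_lt hj hs.1
  have h1 : 0 < α - s := sub_pos.2 hs.2
  have hrs : √(s^2-j^2) ≤ s := by
    apply Real.sqrt_le_iff.2 ⟨h0.le, by nlinarith⟩
  have : α - s ≤ (α - s) * s / √(s^2-j^2) := by
    rw [le_div_iff₀ hr]
    exact mul_le_mul_of_nonneg_left hrs h1.le
  unfold gOne
  nlinarith

lemma minus_trich {α j c δ : ℝ} (hj : 0 < j) (hjα : j < α) (hδ : 2 < δ)
    (hc : -(δ*α/2) < c) :
    (∃ x ∈ Ioo j α, ∃ y ∈ Ioo j α, x ≠ y ∧ -c - δ*x - gOne α j x = 0 ∧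
      -c - δ*y - gOne α j y = 0 ∧ 0 < -δ - gTwo α j x ∧ -δ - gTwo α j y < 0 ∧
      ∀ z ∈ Ioo j α, -c - δ*z - gOne α j z = 0 → z = x ∨ z = y) ∨
    (∃ x ∈ Ioo j α, -c - δ*x - gOne α j x = 0 ∧ -δ - gTwo α j x = 0 ∧
      ∀ z ∈ Ioo j α, -c - δ*z - gOne α j z = 0 → z = x) ∨
    (∀ z ∈ Ioo j α, -c - δ*z - gOne α j z ≠ 0) := by
  have hα : 0 < α := hj.trans hjα
  have roll : ∀ x y, x ∈ Ioo j α → y ∈ Ioo j α → x < y → -c - δ*x - gOne α j x = 0 →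
      -c - δ*y - gOne α j y = 0 → ∃ z ∈ Ioo x y, -δ - gTwo α j z = 0 := by
    intro x y hx hy hxy h1 h2
    obtain ⟨z, hz, hz0⟩ := phi_rolle (c := c) (δ := δ) (e := -1) hj.le hx.1 hxy (by linarith)
      (by linarith)
    exact ⟨z, hz, by linarith⟩
  have noThree : ∀ x y z, x ∈ Ioo j α → y ∈ Ioo j α → z ∈ Ioo j α → x < y → y < z →
      -c - δ*x - gOne α j x = 0 → -c - δ*y - gOne α j y = 0 →
      -c - δ*z - gOne α j z = 0 → False := by
    intro x y z hx hy hz hxy hyz h1 h2 h3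
    obtain ⟨u, hu, hu0⟩ := roll x y hx hy hxy h1 h2
    obtain ⟨v, hv, hv0⟩ := roll y z hy hz hyz h2 h3
    have := gTwo_mono (α := α) hj (hx.1.trans hu.1) (hu.2.trans hv.1) (hv.2.trans hz.2)
    linarith
  by_cases hpos : ∃ m ∈ Ioo j α, 0 < -c - δ*m - gOne α j m
  · left
    obtain ⟨m, hm, hm0⟩ := hpos
    have hrm := r_pos hj.le hm.1
    have qm : 0 < (-c - δ*m) * √(m^2-j^2) + -1 * (-√(m^2-j^2)^2 + (α - m)*m) := by
      rw [← r_phi c δ (-1) hj.le hm.1]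
      apply mul_pos hrm; linarith
    have toPhi : ∀ s, s ∈ Ioo j α →
        (-c - δ*s) * √(s^2-j^2) + -1 * (-√(s^2-j^2)^2 + (α - s)*s) = 0 →
        -c - δ*s - gOne α j s = 0 := by
      intro s hs h0
      rw [← r_phi c δ (-1) hj.le hs.1] at h0
      have := (mul_eq_zero.1 h0).resolve_left (r_pos hj.le hs.1).ne'
      linarith
    have qj : (-c - δ*j) * √(j^2-j^2) + -1 * (-√(j^2-j^2)^2 + (α - j)*j) < 0 := by
      simp; nlinarith
    have qα : (-c - δ*α) * √(α^2-j^2) + -1 * (-√(α^2-j^2)^2 + (α - α)*α) < 0 := by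
      have hr := r_pos hj.le hjα
      have hrs : √(α^2-j^2) ≤ α := Real.sqrt_le_iff.2 ⟨hα.le, by nlinarith⟩
      have : 0 < c + δ*α - √(α^2-j^2) := by nlinarith
      nlinarith [mul_pos this hr]
    obtain ⟨x, hx, hx0⟩ := intermediate_value_Ioo hm.1.le (q_cont α j c δ (-1)).continuousOn
      ⟨qj, qm⟩
    obtain ⟨y, hy, hy0⟩ := intermediate_value_Ioo' hm.2.le (q_cont α j c δ (-1)).continuousOn
      ⟨qα, qm⟩
    have hx' : x ∈ Ioo j α := ⟨hx.1, hx.2.trans hm.2⟩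
    have hy' : y ∈ Ioo j α := ⟨hm.1.trans hy.1, hy.2⟩
    have px := toPhi x hx' hx0
    have py := toPhi y hy' hy0
    have hxy : x < y := hx.2.trans hy.1
    refine ⟨x, hx', y, hy', hxy.ne, px, py, ?_, ?_, ?_⟩
    · obtain ⟨u, hu, hu0⟩ := exists_hasDerivAt_eq_slope _ _ hx.2
        (phi_cont (α := α) c δ (-1) hj.le hx.1)
        (fun s hs => phi_deriv c δ (-1) hj.le (hx.1.trans hs.1))
      have : 0 < -δ + -1 * gTwo α j u := by
        rw [hu0]; apply div_pos <;> linarith [hx.2]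
      have := gTwo_mono (α := α) hj hx.1 hu.1 (hu.2.trans hm.2)
      linarith
    · obtain ⟨u, hu, hu0⟩ := exists_hasDerivAt_eq_slope _ _ hy.1
        (phi_cont (α := α) c δ (-1) hj.le hm.1)
        (fun s hs => phi_deriv c δ (-1) hj.le (hm.1.trans hs.1))
      have : -δ + -1 * gTwo α j u < 0 := by
        rw [hu0]; apply div_neg_of_neg_of_pos <;> linarith [hy.1]
      have := gTwo_mono (α := α) hj (hm.1.trans hu.1) hu.2 hy.2
      linarith
    · intro z hz hz0
      by_contra hne
      push Not at hne
      rcases lt_or_gt_of_ne hne.1 with h | h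
      · exact noThree z x y hz hx' hy' h hxy hz0 px py
      · rcases lt_or_gt_of_ne hne.2 with h' | h'
        · exact noThree x z y hx' hz hy' h h' px hz0 py
        · exact noThree x y z hx' hy' hz hxy h' px py hz0
  · right
    push Not at hpos
    by_cases hz : ∃ x ∈ Ioo j α, -c - δ*x - gOne α j x = 0
    · left
      obtain ⟨x, hx, hx0⟩ := hz
      have hmax : IsLocalMax (fun s => -c - δ*s + (-1) * gOne α j s) x := by
        filter_upwards [isOpen_Ioo.mem_nhds hx] with s hs
        have := hpos s hs
        linarith
      have hD := hmax.hasDerivAt_eq_zero (phi_deriv c δ (-1) hj.le hx.1)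
      have hD : -δ - gTwo α j x = 0 := by linarith
      refine ⟨x, hx, hx0, hD, fun z hz hz0 => ?_⟩
      by_contra hne
      rcases lt_or_gt_of_ne hne with h | h
      · obtain ⟨u, hu, hu0⟩ := roll z x hz hx h hz0 hx0
        have := gTwo_mono (α := α) hj (hz.1.trans hu.1) hu.2 hx.2
        linarith
      · obtain ⟨u, hu, hu0⟩ := roll x z hx hz h hx0 hz0
        have := gTwo_mono (α := α) hj hx.1 hu.1 (hu.2.trans hz.2)
        linarith
    · right
      push Not at hz
      exact hz

lemma gOne_zero {α s : ℝ} (hs : 0 < s) : gOne α 0 s = α - 2*s := by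
  have : √(s^2 - 0^2) = s := by simp [Real.sqrt_sq hs.le]
  unfold gOne
  rw [this]; field_simp; ring

lemma gTwo_zero {α s : ℝ} (hs : 0 < s) : gTwo α 0 s = -2 := by
  have : √(s^2 - 0^2) = s := by simp [Real.sqrt_sq hs.le]
  unfold gTwo
  rw [this]; field_simp; ring

lemma one_crit {α γ δ t j c s : ℝ} (hj : 0 ≤ j) (hδ : 0 < δ) (hK : 0 < γ*t)
    (hc : 1 - 2*t = 4*(γ*t)*c) (hs : s ∈ Ioo j α) (hs0 : -c - δ*s + gOne α j s = 0)
    (hm : ∀ z ∈ Ioo j α, -c - δ*z - gOne α j z ≠ 0) :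
    ∃ p ∈ cylCP α j, NondegMax (HCP α γ δ t j) p ∧
          ∀ q ∈ cylCP α j, IsCrit (HCP α γ δ t j) q → q = p := by
  refine ⟨_, pt_mem hj hs le_rfl (by positivity), pt_max hj hK hc hs hs0 ?_, fun q hq hqc => ?_⟩
  · have := gTwo_neg hj hs
    linarith
  · obtain ⟨z, hz, ⟨e, h⟩ | ⟨e, h⟩⟩ := crit_class hj hK hc hq hqc
    · rw [e, root_plus_unique hj hδ hz hs h hs0]
    · exact absurd h (hm z hz)

lemma pts_ne (a b : ℝ) : ((a, 0) : ℝ × ℝ) ≠ (b, π) := fun h =>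
  Real.pi_pos.ne (Prod.ext_iff.1 h).2

lemma pts_ne' {j s z : ℝ} (hj : 0 < j) (hs : j < s) (hz : j < z) (h : s ≠ z) :
    ((√(s+j), π) : ℝ × ℝ) ≠ (√(z+j), π) := fun e => by
  have h1 := (Prod.ext_iff.1 e).1
  simp only at h1
  rw [Real.sqrt_inj (by linarith) (by linarith)] at h1
  exact h (by linarith)

/-- Critical point structure of the reduced Hamiltonians `H_t^j` of the ℂP² family on
the cylinders, for the three ranges `0 < t < t⁻`, `t⁻ < t < t⁺` and `t⁺ < t ≤ 1`. -/
theorem stmt6 (α γ δ : ℝ) (hα : 0 < α) (hγ0 : 0 < γ) (hγ : γ < 1/(4*α))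
    (hδ : 1/(2*γ*α) < δ) :
    (∀ t : ℝ, 0 < t → t < 1/(2*(1 + 2*γ*α)) →
      (¬ ∃ p ∈ cylCP α 0, IsCrit (HCP α γ δ t 0) p) ∧
      (∀ j : ℝ, 0 < j → j < α →
        ∃ p ∈ cylCP α j, NondegMax (HCP α γ δ t j) p ∧
          ∀ q ∈ cylCP α j, IsCrit (HCP α γ δ t j) q → q = p)) ∧
    (∀ t : ℝ, 1/(2*(1 + 2*γ*α)) < t → t < 1/(2*(1 - 2*γ*α)) →
      ∀ j : ℝ, 0 ≤ j → j < α →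
        ∃ p ∈ cylCP α j, NondegMax (HCP α γ δ t j) p ∧
          ∀ q ∈ cylCP α j, IsCrit (HCP α γ δ t j) q → q = p) ∧
    (∀ t : ℝ, 1/(2*(1 - 2*γ*α)) < t → t ≤ 1 →
      (∃ p₁ ∈ cylCP α 0, ∃ p₂ ∈ cylCP α 0, p₁ ≠ p₂ ∧
        NondegMax (HCP α γ δ t 0) p₁ ∧ NondegSaddle (HCP α γ δ t 0) p₂ ∧
        ∀ q ∈ cylCP α 0, IsCrit (HCP α γ δ t 0) q → q = p₁ ∨ q = p₂) ∧
      (∀ j : ℝ, 0 < j → j < α →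
        (∃ p₁ ∈ cylCP α j, ∃ p₂ ∈ cylCP α j, ∃ p₃ ∈ cylCP α j,
          p₁ ≠ p₂ ∧ p₁ ≠ p₃ ∧ p₂ ≠ p₃ ∧
          NondegMax (HCP α γ δ t j) p₁ ∧ NondegMin (HCP α γ δ t j) p₂ ∧
          NondegSaddle (HCP α γ δ t j) p₃ ∧
          ∀ q ∈ cylCP α j, IsCrit (HCP α γ δ t j) q → q = p₁ ∨ q = p₂ ∨ q = p₃) ∨
        (∃ p₁ ∈ cylCP α j, ∃ p₂ ∈ cylCP α j, p₁ ≠ p₂ ∧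
          NondegMax (HCP α γ δ t j) p₁ ∧ DegenCrit (HCP α γ δ t j) p₂ ∧
          ∀ q ∈ cylCP α j, IsCrit (HCP α γ δ t j) q → q = p₁ ∨ q = p₂) ∨
        (∃ p ∈ cylCP α j, NondegMax (HCP α γ δ t j) p ∧
          ∀ q ∈ cylCP α j, IsCrit (HCP α γ δ t j) q → q = p))) := by
  have hγα : γ * α < 1/4 := by
    rw [lt_div_iff₀ (by positivity)] at hγ; linarith
  have hγα0 : 0 < γ * α := by positivity
  have hδγ : 1 < δ * (2*γ*α) := by
    rwa [div_lt_iff₀ (by positivity)] at hδ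
  have hδ0 : 0 < δ := lt_trans (by positivity) hδ
  have hδ2 : 2 < δ := by nlinarith
  have setup : ∀ t : ℝ, 0 < t → ∃ c, 1 - 2*t = 4*(γ*t)*c ∧ 0 < γ * t ∧
      (t < 1/(2*(1 + 2*γ*α)) → α < c) ∧ (1/(2*(1 + 2*γ*α)) < t → c < α) ∧
      (t < 1/(2*(1 - 2*γ*α)) → -α < c) ∧ (1/(2*(1 - 2*γ*α)) < t → c < -α) ∧
      (t ≤ 1 → -(δ*α/2) < c) := by
    intro t ht
    have hK : 0 < γ * t := by positivity
    have p1 : 0 < 2*(1 + 2*γ*α) := by nlinarith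
    have p2 : 0 < 2*(1 - 2*γ*α) := by nlinarith
    refine ⟨(1 - 2*t)/(4*(γ*t)), by field_simp, hK, ?_, ?_, ?_, ?_, ?_⟩
    · intro h
      rw [lt_div_iff₀ p1] at h
      rw [lt_div_iff₀ (by positivity)]; linarith
    · intro h
      rw [div_lt_iff₀ p1] at h
      rw [div_lt_iff₀ (by positivity)]; linarith
    · intro h
      rw [lt_div_iff₀ p2] at h
      rw [lt_div_iff₀ (by positivity)]; linarith
    · intro h
      rw [div_lt_iff₀ p2] at h
      rw [div_lt_iff₀ (by positivity)]; linarith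
    · intro h
      rw [lt_div_iff₀ (by positivity)]
      nlinarith [mul_lt_mul_of_pos_right hδγ ht]
  have hδα : 2 * α < δ * α := mul_lt_mul_of_pos_right hδ2 hα
  refine ⟨fun t ht htm => ?_, fun t htm htp j hj hjα => ?_, fun t htp ht1 => ?_⟩
  · obtain ⟨c, hc, hK, c1, -, -, -, -⟩ := setup t ht
    have hcα := c1 htm
    refine ⟨?_, fun j hj hjα => ?_⟩
    · rintro ⟨q, hq, hqc⟩
      obtain ⟨z, hz, ⟨e, h⟩ | ⟨e, h⟩⟩ := crit_class le_rfl hK hc hq hqc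
      · rw [gOne_zero hz.1] at h
        nlinarith [mul_pos hδ0 hz.1, hz.1]
      · exact absurd h (minus_neg le_rfl hδ2 (by linarith) hz).ne
    · obtain ⟨s, hs, hs0⟩ := root_plus (c := c) (δ := δ) hj hjα (by linarith)
      exact one_crit hj.le hδ0 hK hc hs hs0
        (fun z hz => (minus_neg hj.le hδ2 (by linarith) hz).ne)
  · have ht : 0 < t := lt_trans (by positivity) htm
    obtain ⟨c, hc, hK, -, c2, c3, -, -⟩ := setup t ht
    have hcα := c2 htm
    have hcα' := c3 htp
    have hs : ∃ s ∈ Ioo j α, -c - δ*s + gOne α j s = 0 := by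
      rcases hj.eq_or_lt with rfl | hj
      · have h0 : 0 < (α - c)/(δ+2) := div_pos (by linarith) (by linarith)
        refine ⟨(α - c)/(δ+2), ⟨h0, ?_⟩, ?_⟩
        · rw [div_lt_iff₀ (by linarith)]; linarith
        · rw [gOne_zero h0]; field_simp; ring
      · exact root_plus hj hjα (by linarith)
    obtain ⟨s, hs, hs0⟩ := hs
    exact one_crit hj hδ0 hK hc hs hs0
        (fun z hz => (minus_neg hj hδ2 (by linarith) hz).ne)
  · have ht : 0 < t := lt_trans (one_div_pos.2 (by nlinarith)) htp
    obtain ⟨c, hc, hK, -, -, -, c4, c5⟩ := setup t ht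
    have hcα := c4 htp
    have hcδ := c5 ht1
    have hcδα : 0 < c + δ*α := by linarith
    refine ⟨?_, fun j hj hjα => ?_⟩
    · have h0 : 0 < (α - c)/(δ+2) := div_pos (by linarith) (by linarith)
      have h1 : 0 < (-c - α)/(δ-2) := div_pos (by linarith) (by linarith)
      have hs : (α - c)/(δ+2) ∈ Ioo 0 α :=
        ⟨h0, by rw [div_lt_iff₀ (by linarith)]; linarith⟩
      have hz : (-c - α)/(δ-2) ∈ Ioo 0 α :=
        ⟨h1, by rw [div_lt_iff₀ (by linarith)]; linarith⟩
      have hs0 : -c - δ*((α - c)/(δ+2)) + gOne α 0 ((α - c)/(δ+2)) = 0 := by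
        rw [gOne_zero h0]; field_simp; ring
      have hd : δ - 2 ≠ 0 := by linarith
      have hz0 : -c - δ*((-c - α)/(δ-2)) - gOne α 0 ((-c - α)/(δ-2)) = 0 := by
        rw [gOne_zero h1]; field_simp; ring
      refine ⟨_, pt_mem le_rfl hs le_rfl (by positivity), _,
        pt_mem le_rfl hz Real.pi_pos.le (by linarith [Real.pi_pos]), pts_ne _ _,
        pt_max le_rfl hK hc hs hs0 ?_, pt_saddle le_rfl hK hc hz hz0 ?_, fun q hq hqc => ?_⟩
      · rw [gTwo_zero h0]; linarith
      · rw [gTwo_zero h1]; linarith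
      · obtain ⟨w, hw, ⟨e, h⟩ | ⟨e, h⟩⟩ := crit_class le_rfl hK hc hq hqc
        · left; rw [e, root_plus_unique le_rfl hδ0 hw hs h hs0]
        · right
          rw [gOne_zero hw.1] at h
          have : w = (-c - α)/(δ-2) := by
            rw [eq_div_iff hd]; linarith
          rw [e, this]
    · obtain ⟨s, hs, hs0⟩ := root_plus (c := c) (δ := δ) hj hjα hcδα
      have hmax : NondegMax (HCP α γ δ t j) (√(s+j), 0) :=
        pt_max hj.le hK hc hs hs0 (by linarith [gTwo_neg hj.le hs])
      have hsm : (√(s+j), 0) ∈ cylCP α j := pt_mem hj.le hs le_rfl (by positivity)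
      have hpm : ∀ z ∈ Ioo j α, (√(z+j), π) ∈ cylCP α j := fun z hz =>
        pt_mem hj.le hz Real.pi_pos.le (by linarith [Real.pi_pos])
      rcases minus_trich hj hjα hδ2 hcδ with ⟨x, hx, y, hy, hxy, hx0, hy0, dx, dy, hu⟩ |
        ⟨x, hx, hx0, dx, hu⟩ | hu
      · left
        refine ⟨_, hsm, _, hpm x hx, _, hpm y hy, pts_ne _ _, pts_ne _ _,
          pts_ne' hj hx.1 hy.1 hxy, hmax, pt_min hj.le hK hc hx hx0 dx,
          pt_saddle hj.le hK hc hy hy0 dy, fun q hq hqc => ?_⟩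
        obtain ⟨w, hw, ⟨e, h⟩ | ⟨e, h⟩⟩ := crit_class hj.le hK hc hq hqc
        · left; rw [e, root_plus_unique hj.le hδ0 hw hs h hs0]
        · right
          rcases hu w hw h with rfl | rfl
          · exact Or.inl e
          · exact Or.inr e
      · right; left
        refine ⟨_, hsm, _, hpm x hx, pts_ne _ _, hmax, pt_degen hj.le hK hc hx hx0 dx,
          fun q hq hqc => ?_⟩
        obtain ⟨w, hw, ⟨e, h⟩ | ⟨e, h⟩⟩ := crit_class hj.le hK hc hq hqc
        · left; rw [e, root_plus_unique hj.le hδ0 hw hs h hs0]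
        · right
          rw [e, hu w hw h]
      · right; right
        exact one_crit hj.le hδ0 hK hc hs hs0 hu
end

section
/- For every j with 0 < j < α, the equation f(X) = g(X) has exactly one solution X in the open interval (2j, α + j). -/
/-- `f(X) = 2(2t − 1 − 4γδt(X − j))·√(X(X − 2j))`. -/
noncomputable def fCP (γ δ t j X : ℝ) : ℝ :=
  2 * (2*t - 1 - 4*γ*δ*t*(X - j)) * Real.sqrt (X * (X - 2*j))

/-- `g(X) = 8γt(2X² − (α + 4j)X + j(α + j))`. -/
noncomputable def gCP (α γ t j X : ℝ) : ℝ :=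
  8*γ*t*(2*X^2 - (α + 4*j)*X + j*(α + j))

theorem uniq_aux (α γ δ t : ℝ) (hγ0 : 0 < γ) (hδ : 0 < δ) (ht0 : 0 < t)
    (j : ℝ) (hj0 : 0 < j) (X Y : ℝ) (hX : 2*j < X) (hY : Y < α + j) (hXY : X < Y)
    (h1 : fCP γ δ t j X = gCP α γ t j X) (h2 : fCP γ δ t j Y = gCP α γ t j Y) : False := by
  unfold fCP gCP at h1 h2
  have pX : 0 < X * (X - 2*j) := mul_pos (by linarith) (by linarith)
  have pY : 0 < Y * (Y - 2*j) := mul_pos (by linarith) (by linarith)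
  have a0 := Real.sqrt_pos.2 pX
  have b0 := Real.sqrt_pos.2 pY
  have a2 := Real.sq_sqrt pX.le
  have b2 := Real.sq_sqrt pY.le
  generalize Real.sqrt (X * (X - 2*j)) = a at *
  generalize Real.sqrt (Y * (Y - 2*j)) = b at *
  obtain ⟨u, rfl⟩ : ∃ u, X = u + j := ⟨X - j, by ring⟩
  obtain ⟨v, rfl⟩ : ∃ v, Y = v + j := ⟨Y - j, by ring⟩
  have hu : j < u := by linarith
  have huv : u < v := by linarith
  have hv : v < α := by linarith
  have hab : a < b := by
    apply lt_of_pow_lt_pow_left₀ 2 b0.le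
    nlinarith
  have hq : v * a < u * b := by
    apply lt_of_pow_lt_pow_left₀ 2 (mul_pos (by linarith) b0).le
    rw [mul_pow, mul_pow, a2, b2]
    have : 0 < j^2 * ((v - u) * (v + u)) :=
      mul_pos (by positivity) (mul_pos (by linarith) (by linarith))
    nlinarith
  have hq' : v / b < u / a := by rwa [div_lt_div_iff₀ b0 a0]
  have e1 : 2*t - 1 - 4*γ*δ*t*u = 4*γ*t*(a - (α - u) * (u / a)) := by
    field_simp
    rw [show a^2 = _ from a2]
    linear_combination h1/2
  have e2 : 2*t - 1 - 4*γ*δ*t*v = 4*γ*t*(b - (α - v) * (v / b)) := by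
    field_simp
    rw [show b^2 = _ from b2]
    linear_combination h2/2
  have hm : (α - v) * (v / b) < (α - u) * (u / a) := by
    have : 0 < v / b := div_pos (by linarith) b0
    apply mul_lt_mul'' (by linarith) hq' (by linarith) this.le
  have k1 : 4*γ*t*(a - (α - u) * (u / a)) < 4*γ*t*(b - (α - v) * (v / b)) :=
    mul_lt_mul_of_pos_left (by linarith) (by positivity)
  have k2 : 4*γ*δ*t*u < 4*γ*δ*t*v := mul_lt_mul_of_pos_left huv (by positivity)
  linarith

/-- For every `j` with `0 < j < α`, the equation `f(X) = g(X)` has exactly one solution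
`X` in the open interval `(2j, α + j)`. -/
theorem stmt7 (α γ δ t : ℝ) (hα : 0 < α) (hγ0 : 0 < γ) (hγ : γ < 1/(4*α))
    (hδ : 1/(2*γ*α) < δ) (ht0 : 0 < t) (ht1 : t ≤ 1)
    (j : ℝ) (hj0 : 0 < j) (hjα : j < α) :
    ∃! X : ℝ, X ∈ Set.Ioo (2*j) (α + j) ∧ fCP γ δ t j X = gCP α γ t j X := by
  have hδ0 : 0 < δ := lt_trans (by positivity) hδ
  have hd : 1 < 2*γ*α*δ := by
    rw [div_lt_iff₀ (by positivity)] at hδ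
    linarith
  have hc : ContinuousOn (fun X => fCP γ δ t j X - gCP α γ t j X) (Set.Icc (2*j) (α+j)) := by
    unfold fCP gCP
    fun_prop
  have hl : 0 < fCP γ δ t j (2*j) - gCP α γ t j (2*j) := by
    unfold fCP gCP
    have : 0 < 8*γ*t*(j*(α-j)) := mul_pos (by positivity) (mul_pos hj0 (by linarith))
    simp
    nlinarith
  have hr : fCP γ δ t j (α+j) - gCP α γ t j (α+j) < 0 := by
    unfold fCP gCP
    have h1 : 0 < 8*γ*t*((α+j)*(α-j)) :=
      mul_pos (by positivity) (mul_pos (by linarith) (by linarith))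
    have h2 : 2 * (2*t - 1 - 4*γ*δ*t*(α+j - j)) * Real.sqrt ((α+j) * (α+j - 2*j)) ≤ 0 := by
      apply mul_nonpos_of_nonpos_of_nonneg _ (Real.sqrt_nonneg _)
      nlinarith [mul_lt_mul_of_pos_left hd ht0]
    nlinarith
  obtain ⟨X, hX, hX0⟩ := intermediate_value_Ioo' (by linarith) hc ⟨hr, hl⟩
  have hX1 : fCP γ δ t j X = gCP α γ t j X := sub_eq_zero.1 hX0
  refine ⟨X, ⟨hX, hX1⟩, ?_⟩
  rintro Y ⟨hY, hY1⟩
  rcases lt_trichotomy Y X with h | h | h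
  · exact (uniq_aux α γ δ t hγ0 hδ0 ht0 j hj0 Y X hY.1 hX.2 h hY1 hX1).elim
  · exact h
  · exact (uniq_aux α γ δ t hγ0 hδ0 ht0 j hj0 X Y hX.1 hY.2 h hX1 hY1).elim
end

section
/- If t ≤ t⁺, then for every j with 0 < j < α the function f + g has no zero in the open interval (2j, α + j). -/
/-- If `t ≤ t⁺ = 1/(2(1 − 2γα))`, then for every `j` with `0 < j < α` the function
`f + g` has no zero in the open interval `(2j, α + j)`. -/
theorem stmt8 (α γ δ t : ℝ) (hα : 0 < α) (hγ0 : 0 < γ) (hγ : γ < 1/(4*α))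
    (hδ : 1/(2*γ*α) < δ) (ht0 : 0 < t) (ht1 : t ≤ 1)
    (htp : t ≤ 1/(2*(1 - 2*γ*α)))
    (j : ℝ) (hj0 : 0 < j) (hjα : j < α) :
    ∀ X ∈ Set.Ioo (2*j) (α + j), fCP γ δ t j X + gCP α γ t j X ≠ 0 := by
  intro X hX
  obtain ⟨h1, h2⟩ := hX
  have hga : 0 < γ * α := mul_pos hγ0 hα
  have hga4 : 4 * (γ * α) < 1 := by
    rw [lt_div_iff₀ (by positivity)] at hγ
    linarith
  have hd2 : 2 < δ := by
    refine lt_trans ?_ hδ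
    rw [lt_div_iff₀ (by positivity)]
    linarith
  have htp' : 2 * t - 1 ≤ 4 * γ * α * t := by
    rw [le_div_iff₀ (by linarith)] at htp
    linarith
  unfold fCP gCP
  have hr : 0 < X * (X - 2*j) := mul_pos (by linarith) (by linarith)
  have hs := Real.sqrt_pos.mpr hr
  have hsq := Real.sq_sqrt hr.le
  set s := Real.sqrt (X * (X - 2*j)) with hsdef
  have hsY : s < X - j := by
    apply lt_of_pow_lt_pow_left₀ 2 (by linarith)
    nlinarith
  have hk : 0 < 4 * γ * t := by positivity
  have hA : (2*t - 1 - 4*γ*δ*t*(X - j)) * s ≤ 4 * γ * t * ((α - 2 * (X - j)) * s) := by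
    have h3 : 2*t - 1 - 4*γ*δ*t*(X - j) ≤ 4 * γ * t * (α - 2 * (X - j)) := by
      have : 0 ≤ 4 * γ * t * ((δ - 2) * (X - j)) :=
        mul_nonneg hk.le (mul_nonneg (by linarith) (by linarith))
      linarith
    have := mul_le_mul_of_nonneg_right h3 hs.le
    linarith
  have hB : 0 < (X - j - s) * (α - (X - j - s)) :=
    mul_pos (by linarith) (by linarith)
  have hC := mul_pos hk hB
  have hE : 4 * γ * t * ((α - 2 * (X - j)) * s) + 4*γ*t*(2*X^2 - (α + 4*j)*X + j*(α + j))
      = - (4 * γ * t * ((X - j - s) * (α - (X - j - s)))) := by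
    linear_combination (-(4 * γ * t)) * hsq
  apply ne_of_lt
  linarith
end

section
/- For every t ∈ (t⁺, 1] and every j with j_t < j < α, the function f + g has no zero in the open interval (2j, α + j). -/
/-- The bound `j_t` on the `J`-extent of the flap. -/
noncomputable def jCP (α γ δ t : ℝ) : ℝ :=
  ((δ - 2)*(2*(1 - 4*γ*α)*t - 1)
      + Real.sqrt (16*γ*α*t*(2*t - 1 + γ*α*t*(δ^2 - 4*δ + 1)) - (2*t - 1)^2))
    / (4*γ*t*(δ^2 - 4*δ + 5))

theorem core_neg (α j Y s W : ℝ) (hj : 0 < j) (hY : j < Y) (hYα : Y < α)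
    (hs : 0 < s) (hs2 : s^2 = Y^2 - j^2) (hW : 0 < W) (hW2 : W^2 = α^2 - j^2) :
    (Y - s)^2 - α*Y + 2*α*s - W*s < 0 := by
  have hsW : s < W := by nlinarith
  have hsY : s < Y := by nlinarith
  have hWα : W < α := by nlinarith
  obtain ⟨q, hq⟩ : ∃ q, q = Y - s := ⟨_, rfl⟩
  obtain ⟨r, hr⟩ : ∃ r, r = α - W := ⟨_, rfl⟩
  obtain ⟨P, hP⟩ : ∃ P, P = α + W := ⟨_, rfl⟩
  obtain ⟨p, hp⟩ : ∃ p, p = Y + s := ⟨_, rfl⟩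
  have hpq : p*q = j^2 := by subst hq hp; linarith
  have hrP : r*P = j^2 := by subst hr hP; linarith
  have q0 : 0 < q := by linarith
  have r0 : 0 < r := by linarith
  have hpP : p < P := by linarith
  have hqr : r < q := by
    by_contra h
    push Not at h
    have : p*q < P*r := by nlinarith
    linarith
  have hqp : q < p := by linarith
  have hqj : q^2 < j^2 := by nlinarith
  have key : 2*q*((Y - s)^2 - α*Y + 2*α*s - W*s) = (q-r)*(2*q^2 - P*(q+r)) := by
    have e1 : (Y - s)^2 - α*Y + 2*α*s - W*s = q^2 + p*r/2 - q*(P/2 + r) := by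
      subst hq hr hP hp; ring
    rw [e1]
    linear_combination r*hpq - r*hrP
  have h2 : 2*q^2 - P*(q+r) < 0 := by nlinarith
  have h3 : (q-r)*(2*q^2 - P*(q+r)) < 0 := mul_neg_of_pos_of_neg (by linarith) h2
  by_contra h
  push Not at h
  have : 0 ≤ 2*q*((Y - s)^2 - α*Y + 2*α*s - W*s) := by positivity
  linarith

theorem j_bounds (α d e R j : ℝ) (hα : 0 < α) (hd : 0 < d) (he1 : -α < e) (he2 : e < d*α)
    (hR : 0 ≤ R) (hR2 : R^2 = α^2*(d^2+1) - e^2) (hj : d*e + R < (d^2+1)*j) :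
    0 < j ∧ 0 < d*j - e ∧ α^2 < (d*j-e)^2 + j^2 := by
  have hD : 0 < d^2+1 := by positivity
  refine ⟨?_, ?_, ?_⟩
  · have : 0 ≤ d*e + R := by
      by_cases h : 0 ≤ e
      · positivity
      · push Not at h
        have h1 : e^2 ≤ α^2 := by nlinarith
        have h2 : (-(d*e))^2 ≤ R^2 := by nlinarith
        have := abs_le_of_sq_le_sq h2 hR
        linarith [(abs_le.1 this).2]
    by_contra h
    push Not at h
    nlinarith
  · have h1 : e ≤ d*R := by
      by_cases h : 0 ≤ e
      · have h1 : e^2 ≤ (d*α)^2 := by nlinarith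
        have h2 : e^2 ≤ (d*R)^2 := by
          rw [mul_pow, hR2]; nlinarith
        have := abs_le_of_sq_le_sq h2 (by positivity)
        linarith [(abs_le.1 this).2]
      · push Not at h
        have : 0 ≤ d*R := by positivity
        linarith
    have h2 : 0 < (d^2+1)*(d*j-e) := by nlinarith
    exact pos_of_mul_pos_right h2 hD.le
  · have h1 : R^2 < ((d^2+1)*j - d*e)^2 := by nlinarith
    have h2 : 0 < (d^2+1)*((d*j-e)^2 + j^2 - α^2) := by nlinarith
    have := pos_of_mul_pos_right h2 hD.le
    linarith

/-- For every `t ∈ (t⁺, 1]` and every `j` with `j_t < j < α`, the function `f + g`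
has no zero in the open interval `(2j, α + j)`. -/
theorem stmt9 (α γ δ t : ℝ) (hα : 0 < α) (hγ0 : 0 < γ) (hγ : γ < 1/(4*α))
    (hδ : 1/(2*γ*α) < δ) (htp : 1/(2*(1 - 2*γ*α)) < t) (ht1 : t ≤ 1)
    (j : ℝ) (hj0 : jCP α γ δ t < j) (hjα : j < α) :
    ∀ X ∈ Set.Ioo (2*j) (α + j), fCP γ δ t j X + gCP α γ t j X ≠ 0 := by
  intro X hX
  obtain ⟨hX1, hX2⟩ := hX
  have g1 : γ*α < 1/4 := by
    rw [lt_div_iff₀ (by positivity)] at hγ; linarith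
  have g2 : 1 < δ*(2*γ*α) := by
    rwa [div_lt_iff₀ (by positivity)] at hδ
  have g3 : 1 < t*(2*(1 - 2*γ*α)) := by
    rwa [div_lt_iff₀ (by linarith)] at htp
  have ga : 0 < γ*α := by positivity
  have hd : 2 < δ := by nlinarith
  have ht : 0 < t := by
    by_contra h
    push Not at h
    nlinarith
  obtain ⟨K, hK⟩ : ∃ K, K = 4*γ*t := ⟨_, rfl⟩
  have K0 : 0 < K := by rw [hK]; positivity
  obtain ⟨c, hc⟩ : ∃ c, c = (2*t-1)/K := ⟨_, rfl⟩
  have hcK : 2*t-1 = K*c := by rw [hc]; field_simp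
  have hc1 : α < c := by
    rw [hc, lt_div_iff₀ K0, hK]; linarith
  have hc2 : c < δ*α := by
    rw [hc, div_lt_iff₀ K0, hK]; nlinarith
  obtain ⟨d, hdd⟩ : ∃ d, d = δ - 2 := ⟨_, rfl⟩
  obtain ⟨e, he⟩ : ∃ e, e = c - 2*α := ⟨_, rfl⟩
  have d0 : 0 < d := by linarith
  have he1 : -α < e := by linarith
  have he2 : e < d*α := by rw [he, hdd]; linarith
  have hD : 0 ≤ α^2*(d^2+1) - e^2 := by
    by_cases h : 0 ≤ e
    · nlinarith
    · push Not at h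
      nlinarith [mul_pos hα d0]
  have hj : d*e + Real.sqrt (α^2*(d^2+1) - e^2) < (d^2+1)*j := by
    unfold jCP at hj0
    have e1 : 16*γ*α*t*(2*t - 1 + γ*α*t*(δ^2 - 4*δ + 1)) - (2*t - 1)^2
        = K^2*(α^2*(d^2+1) - e^2) := by
      rw [hcK, he, hdd]; rw [show 16*γ*α*t = 4*α*K by rw [hK]; ring,
        show γ*α*t = α*K/4 by rw [hK]; ring]; ring
    rw [e1, Real.sqrt_mul (by positivity), Real.sqrt_sq K0.le] at hj0
    have e2 : 4*γ*t*(δ^2 - 4*δ + 5) = K*(d^2+1) := by rw [hK, hdd]; ring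
    have e3 : (δ - 2)*(2*(1 - 4*γ*α)*t - 1) = K*(d*e) := by
      have : 2*(1 - 4*γ*α)*t - 1 = K*e := by
        rw [he]; linear_combination hcK + 2*α*hK
      rw [this, hdd]; ring
    rw [e2, e3, div_lt_iff₀ (by positivity)] at hj0
    by_contra h
    push Not at h
    nlinarith [mul_le_mul_of_nonneg_left h K0.le]
  obtain ⟨j0, w0, hw⟩ := j_bounds α d e _ j hα d0 he1 he2 (Real.sqrt_nonneg _)
    (Real.sq_sqrt hD) hj
  obtain ⟨Y, hY⟩ : ∃ Y, Y = X - j := ⟨_, rfl⟩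
  have hX' : X = Y + j := by linarith
  have hY1 : j < Y := by linarith
  have hY2 : Y < α := by linarith
  obtain ⟨s, hs⟩ : ∃ s, s = Real.sqrt (X * (X - 2*j)) := ⟨_, rfl⟩
  have hpos : 0 < X * (X - 2*j) := mul_pos (by linarith) (by linarith)
  have s0 : 0 < s := by rw [hs]; exact Real.sqrt_pos.2 hpos
  have s2 : s^2 = Y^2 - j^2 := by rw [hs, Real.sq_sqrt hpos.le, hX']; ring
  have hWp : 0 < α^2 - j^2 := by nlinarith
  obtain ⟨W, hW⟩ : ∃ W, W = Real.sqrt (α^2 - j^2) := ⟨_, rfl⟩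
  have W0 : 0 < W := by rw [hW]; exact Real.sqrt_pos.2 hWp
  have W2 : W^2 = α^2 - j^2 := by rw [hW, Real.sq_sqrt hWp.le]
  have core := core_neg α j Y s W j0 hY1 hY2 s0 s2 W0 W2
  have hWw : W ≤ d*j - e := by
    rw [hW]; apply Real.sqrt_le_iff.2; exact ⟨w0.le, by linarith⟩
  have hWY : W ≤ d*Y - e := by
    have := mul_lt_mul_of_pos_left hY1 d0
    linarith
  have hQ : Y^2 - δ*Y*s + s^2 - α*Y + c*s < 0 := by
    have h1 : W*s ≤ (d*Y-e)*s := mul_le_mul_of_nonneg_right hWY s0.le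
    have h2 : Y^2 - δ*Y*s + s^2 - α*Y + c*s
      = (Y - s)^2 - α*Y + 2*α*s - (d*Y-e)*s := by rw [hdd, he]; ring
    linarith
  have hfin : fCP γ δ t j X + gCP α γ t j X = 2*K*(Y^2 - δ*Y*s + s^2 - α*Y + c*s) := by
    unfold fCP gCP
    rw [← hs, hcK, ← hY, show 4*γ*δ*t*Y = K*δ*Y by rw [hK]; ring,
      show 8*γ*t = 2*K by rw [hK]; ring, s2, hX']
    ring
  rw [hfin]
  exact (mul_neg_of_pos_of_neg (by positivity) hQ).ne
end

section
/- Regard f and g as smooth functions of (j, X) on the domain {(j, X) : 0 < j < α, 2j < X < α + j} (with t fixed). Then: (a) there is no (j, X) in the domain at which both f − g and ∂_X(f − g) vanish; (b) there is no (j, X) in the domain at which f + g, ∂_X(f + g) and ∂²_X(f + g) all vanish; (c) there is no (j, X) in the domain at which f + g, ∂_X(f + g) and ∂_j(f + g) all vanish. (Consequently, every degenerate rank-one singular point of the paper's family of integrable systems on ℂP² is parabolic.) -/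
/-- The `X`-derivative of `√(X(X − 2j))`. -/
lemma hasDerivAt_root (j X : ℝ) (hj : 0 < j) (hX : 2*j < X) :
    HasDerivAt (fun Y : ℝ => Real.sqrt (Y * (Y - 2*j)))
      ((X - j) / Real.sqrt (X * (X - 2*j))) X := by
  have hQ : 0 < X * (X - 2*j) := mul_pos (by linarith) (by linarith)
  have h1 : HasDerivAt (fun Y : ℝ => Y * (Y - 2*j)) (1 * (X - 2*j) + X * 1) X :=
    (hasDerivAt_id X).mul ((hasDerivAt_id X).sub_const (2*j))
  have h2 := h1.sqrt hQ.ne'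
  convert h2 using 1
  have := (Real.sqrt_pos.2 hQ).ne'
  field_simp
  ring

/-- The first `X`-derivative of `f + s g`. -/
noncomputable def dCP (α γ δ t s j X : ℝ) : ℝ :=
  2 * (-(4*γ*δ*t)) * Real.sqrt (X * (X - 2*j))
    + 2 * (2*t - 1 - 4*γ*δ*t*(X - j)) * ((X - j) / Real.sqrt (X * (X - 2*j)))
    + s * (8*γ*t*(4*X - (α + 4*j)))

lemma hasDerivAt_amp (γ δ t j X : ℝ) :
    HasDerivAt (fun Y : ℝ => 2 * (2*t - 1 - 4*γ*δ*t*(Y - j))) (2 * (-(4*γ*δ*t))) X := by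
  have h := ((((hasDerivAt_id X).sub_const j).const_mul (4*γ*δ*t)).const_sub (2*t-1)).const_mul 2
  simpa using h

lemma hasDerivAt_CP (α γ δ t s j X : ℝ) (hj : 0 < j) (hX : 2*j < X) :
    HasDerivAt (fun Y => fCP γ δ t j Y + s * gCP α γ t j Y) (dCP α γ δ t s j X) X := by
  have h1 := (hasDerivAt_amp γ δ t j X).mul (hasDerivAt_root j X hj hX)
  have h2 : HasDerivAt (fun Y => gCP α γ t j Y) (8*γ*t*(4*X - (α + 4*j))) X := by
    have h := ((((hasDerivAt_pow 2 X).const_mul 2).sub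
      ((hasDerivAt_id X).const_mul (α + 4*j))).add_const (j*(α+j))).const_mul (8*γ*t)
    exact h.congr_deriv (by norm_num; left; ring)
  exact h1.add (h2.const_mul s)

lemma hasDerivAt_dCP (α γ δ t s j X : ℝ) (hj : 0 < j) (hX : 2*j < X) :
    HasDerivAt (fun Y => dCP α γ δ t s j Y)
      (2 * (-(4*γ*δ*t)) * ((X - j) / Real.sqrt (X * (X - 2*j)))
      + (2 * (-(4*γ*δ*t)) * ((X - j) / Real.sqrt (X * (X - 2*j)))
        + 2 * (2*t - 1 - 4*γ*δ*t*(X - j)) *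
          ((1 * Real.sqrt (X * (X - 2*j)) - (X - j) * ((X - j) / Real.sqrt (X * (X - 2*j))))
            / Real.sqrt (X * (X - 2*j))^2))
      + s * (8*γ*t*4)) X := by
  have hQ : 0 < X * (X - 2*j) := mul_pos (by linarith) (by linarith)
  have hR := (Real.sqrt_pos.2 hQ).ne'
  have hr := hasDerivAt_root j X hj hX
  have h3 := (((hasDerivAt_id X).sub_const j).div hr hR)
  have h4 := (hasDerivAt_amp γ δ t j X).mul h3
  have h5 : HasDerivAt (fun Y : ℝ => s * (8*γ*t*(4*Y - (α + 4*j)))) (s * (8*γ*t*4)) X := by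
    have h := ((((hasDerivAt_id X).const_mul 4).sub_const (α+4*j)).const_mul (8*γ*t)).const_mul s
    simpa using h
  exact ((hr.const_mul (2 * (-(4*γ*δ*t)))).add h4).add h5

/-- The `j`-derivative of `f + g`. -/
lemma hasDerivAt_CP_j (α γ δ t j X : ℝ) (hj : 0 < j) (hX : 2*j < X) :
    HasDerivAt (fun i => fCP γ δ t i X + gCP α γ t i X)
      (2 * (4*γ*δ*t) * Real.sqrt (X * (X - 2*j))
        + 2 * (2*t - 1 - 4*γ*δ*t*(X - j)) * (-X / Real.sqrt (X * (X - 2*j)))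
        + 8*γ*t*(-4*X + α + 2*j)) j := by
  have hQ : 0 < X * (X - 2*j) := mul_pos (by linarith) (by linarith)
  have hR := (Real.sqrt_pos.2 hQ).ne'
  have h0 : HasDerivAt (fun i : ℝ => X * (X - 2*i)) (X * (-(2*1))) j :=
    (((hasDerivAt_id j).const_mul 2).const_sub X).const_mul X
  have h1 := h0.sqrt hQ.ne'
  have h2 : HasDerivAt (fun i : ℝ => 2 * (2*t - 1 - 4*γ*δ*t*(X - i))) (2 * (4*γ*δ*t)) j := by
    have h := ((((hasDerivAt_id j).const_sub X).const_mul (4*γ*δ*t)).const_sub (2*t-1)).const_mul 2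
    simpa using h
  have h3 : HasDerivAt (fun i => gCP α γ t i X) (8*γ*t*(-4*X + α + 2*j)) j := by
    have hid := hasDerivAt_id j
    have h := (((((hid.const_mul 4).const_add α).mul_const X).const_sub (2*X^2)).add
      (hid.mul (hid.const_add α))).const_mul (8*γ*t)
    exact h.congr_deriv (by simp only [id]; ring)
  have h4 := (h2.mul h1).add h3
  exact h4.congr_deriv (by field_simp)

lemma key_pos (α j u : ℝ) (hj : 0 < j) (hju : j < u) (hu : u < α) :
    0 < 2*u^3 - 3*u*j^2 + α*j^2 := by
  nlinarith [mul_pos (mul_pos hj hj) (sub_pos.2 hu),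
    mul_pos (show 0 < u by linarith) (mul_pos (sub_pos.2 hju) (show 0 < u + j by linarith))]

/-- Elimination of `f` from `f + s g = 0` and its `X`-derivative. -/
lemma elim_CP (α γ δ t s j X : ℝ) (hj : 0 < j) (hX : 2*j < X)
    (h0 : fCP γ δ t j X + s * gCP α γ t j X = 0) (h1 : dCP α γ δ t s j X = 0) :
    8*γ*δ*t * Real.sqrt (X * (X - 2*j))^3
      = s * (8*γ*t) * (2*(X-j)^3 - 3*(X-j)*j^2 + α*j^2) := by
  have hQ : 0 < X * (X - 2*j) := mul_pos (by linarith) (by linarith)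
  have hR := Real.sqrt_pos.2 hQ
  have hR2 := Real.sq_sqrt hQ.le
  unfold fCP gCP at h0
  unfold dCP at h1
  set R := Real.sqrt (X * (X - 2*j))
  field_simp at h1
  linear_combination (-R) * h1 + (X - j) * h0 + s*8*γ*t*(4*X - (α+4*j)) * hR2

/-- On the domain `{(j, X) : 0 < j < α, 2j < X < α + j}`:
(a) `f − g` and `∂_X(f − g)` never vanish simultaneously;
(b) `f + g`, `∂_X(f + g)` and `∂²_X(f + g)` never vanish simultaneously;
(c) `f + g`, `∂_X(f + g)` and `∂_j(f + g)` never vanish simultaneously.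
Consequently every degenerate rank-one singular point of the ℂP² family is parabolic. -/
theorem stmt10 (α γ δ t : ℝ) (hα : 0 < α) (hγ0 : 0 < γ) (hγ : γ < 1/(4*α))
    (hδ : 1/(2*γ*α) < δ) (ht0 : 0 < t) (ht1 : t ≤ 1) :
    (∀ j X : ℝ, 0 < j → j < α → 2*j < X → X < α + j →
      ¬ (fCP γ δ t j X - gCP α γ t j X = 0 ∧
          deriv (fun Y => fCP γ δ t j Y - gCP α γ t j Y) X = 0)) ∧
    (∀ j X : ℝ, 0 < j → j < α → 2*j < X → X < α + j →
      ¬ (fCP γ δ t j X + gCP α γ t j X = 0 ∧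
          deriv (fun Y => fCP γ δ t j Y + gCP α γ t j Y) X = 0 ∧
          deriv (deriv (fun Y => fCP γ δ t j Y + gCP α γ t j Y)) X = 0)) ∧
    (∀ j X : ℝ, 0 < j → j < α → 2*j < X → X < α + j →
      ¬ (fCP γ δ t j X + gCP α γ t j X = 0 ∧
          deriv (fun Y => fCP γ δ t j Y + gCP α γ t j Y) X = 0 ∧
          deriv (fun i => fCP γ δ t i X + gCP α γ t i X) j = 0)) := by
  have hαγ : 0 < 2*γ*α := by positivity
  have hδ0 : 0 < δ := lt_trans (by positivity) hδ
  refine ⟨?_, ?_, ?_⟩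
  · rintro j X hj hjα hX hXα ⟨h0, h1⟩
    have e : (fun Y => fCP γ δ t j Y - gCP α γ t j Y)
        = fun Y => fCP γ δ t j Y + (-1) * gCP α γ t j Y := by
      funext Y; ring
    rw [e, (hasDerivAt_CP α γ δ t (-1) j X hj hX).deriv] at h1
    have h := elim_CP α γ δ t (-1) j X hj hX (by linarith) h1
    have hk := key_pos α j (X-j) hj (by linarith) (by linarith)
    have hQ : 0 < X * (X - 2*j) := mul_pos (by linarith) (by linarith)
    have hR := Real.sqrt_pos.2 hQ
    have hl : 0 < 8*γ*δ*t * Real.sqrt (X * (X - 2*j))^3 := by positivity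
    have hr : 0 < (8*γ*t) * (2*(X-j)^3 - 3*(X-j)*j^2 + α*j^2) := by positivity
    linarith
  · rintro j X hj hjα hX hXα ⟨h0, h1, h2⟩
    have e : (fun Y => fCP γ δ t j Y + gCP α γ t j Y)
        = fun Y => fCP γ δ t j Y + 1 * gCP α γ t j Y := by
      funext Y; ring
    have ev : deriv (fun Y => fCP γ δ t j Y + 1 * gCP α γ t j Y)
        =ᶠ[nhds X] fun Y => dCP α γ δ t 1 j Y := by
      filter_upwards [lt_mem_nhds hX] with Y hY
      exact (hasDerivAt_CP α γ δ t 1 j Y hj hY).deriv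
    rw [e, ev.deriv_eq, (hasDerivAt_dCP α γ δ t 1 j X hj hX).deriv] at h2
    rw [e, (hasDerivAt_CP α γ δ t 1 j X hj hX).deriv] at h1
    have h := elim_CP α γ δ t 1 j X hj hX (by linarith) h1
    have hQ : 0 < X * (X - 2*j) := mul_pos (by linarith) (by linarith)
    have hR := Real.sqrt_pos.2 hQ
    have hR2 := Real.sq_sqrt hQ.le
    unfold fCP gCP at h0
    clear h1 ev e
    set R := Real.sqrt (X * (X - 2*j))
    have h2' : -(16*γ*δ*t)*(X-j)*R^3 - 2 * (2*t - 1 - 4*γ*δ*t*(X - j)) * R * j^2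
        + 32*γ*t*R^4 = 0 := by
      have hj2 : j^2 = (X-j)^2 - R^2 := by rw [hR2]; ring
      rw [hj2]
      have h6 := congrArg (fun z => R^4 * z) h2
      simp only [mul_zero] at h6
      refine Eq.trans ?_ h6
      field_simp
      ring
    have h4 : R^4 = (X * (X - 2*j))^2 := by rw [← hR2]; ring
    have h3 : 24*γ*t*j^2*(j^2 - α*(X-j)) = 0 := by
      linear_combination h2' + 2*(X-j)*h + j^2*h0 - 32*γ*t*h4
    have hlt : j^2 - α*(X-j) < 0 := by nlinarith
    have : 24*γ*t*j^2 ≠ 0 := by positivity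
    exact (mul_ne_zero this hlt.ne) h3
  · rintro j X hj hjα hX hXα ⟨h0, h1, h2⟩
    have e : (fun Y => fCP γ δ t j Y + gCP α γ t j Y)
        = fun Y => fCP γ δ t j Y + 1 * gCP α γ t j Y := by
      funext Y; ring
    rw [e, (hasDerivAt_CP α γ δ t 1 j X hj hX).deriv] at h1
    rw [(hasDerivAt_CP_j α γ δ t j X hj hX).deriv] at h2
    have hQ : 0 < X * (X - 2*j) := mul_pos (by linarith) (by linarith)
    have hR := Real.sqrt_pos.2 hQ
    have hR2 := Real.sq_sqrt hQ.le
    unfold fCP gCP at h0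
    unfold dCP at h1
    clear e
    set R := Real.sqrt (X * (X - 2*j))
    have h12 : 2 * (2*t - 1 - 4*γ*δ*t*(X - j)) * (-j / R) - 16*γ*t*j = 0 := by
      linear_combination h1 + h2
    have h12' : j * ((2*t - 1 - 4*γ*δ*t*(X - j)) + 8*γ*t*R) = 0 := by
      field_simp at h12
      linear_combination (-1/2) * h12
    have h5 := (mul_eq_zero.1 h12').resolve_left hj.ne'
    have h3 : 8*γ*t*(j^2 - α*(X-j)) = 0 := by
      linear_combination h0 - 2*R*h5 + 16*γ*t*hR2
    have hlt : j^2 - α*(X-j) < 0 := by nlinarith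
    have : 8*γ*t ≠ 0 := by positivity
    exact (mul_ne_zero this hlt.ne) h3
end

section
/- For every fixed j with 0 < j < α, there is at most one t ∈ (0, 1] for which there exists X ∈ (2j, α + j) satisfying f_t(X) + g_t(X) = 0 and f_t′(X) + g_t′(X) = 0 (derivatives taken in X). (In the paper's family of systems on ℂP², this says that for each level J = j there is at most one time t at which a parabolic value occurs over that level.) -/
/-- Any solution `X` satisfies two algebraic equations in `s = √(X(X-2j))`. -/
lemma key_alg (α γ δ j t X : ℝ) (hγ0 : 0 < γ) (hj0 : 0 < j) (ht : 0 < t) (hX : 2*j < X)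
    (h0 : fCP γ δ t j X + gCP α γ t j X = 0)
    (h1 : deriv (fun Y => fCP γ δ t j Y + gCP α γ t j Y) X = 0) :
    t * (2 * √((X-j)^2 - j^2) - 4*γ*δ*(X-j)*√((X-j)^2 - j^2)
      + 4*γ*(2*(X-j)^2 - α*(X-j) - j^2)) = √((X-j)^2 - j^2) ∧
    δ * √((X-j)^2 - j^2)^3 = 2*(X-j)^3 - 3*j^2*(X-j) + α*j^2 := by
  have hpos : 0 < X * (X - 2*j) := mul_pos (by linarith) (by linarith)
  have hd : HasDerivAt (fun Y => fCP γ δ t j Y + gCP α γ t j Y)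
      (2 * (-(4*γ*δ*t)) * √(X * (X - 2*j)) + 2 * (2*t - 1 - 4*γ*δ*t*(X - j)) *
        ((2*X - 2*j) / (2 * √(X * (X - 2*j)))) + 8*γ*t*(4*X - (α+4*j))) X := by
    unfold fCP gCP
    have hid := hasDerivAt_id X
    have a1 : HasDerivAt (fun Y : ℝ => 2 * (2*t - 1 - 4*γ*δ*t*(Y - j)))
        (2 * (-(4*γ*δ*t))) X := by
      refine HasDerivAt.congr_deriv ((((hid.sub_const j).const_mul (4*γ*δ*t)).const_sub (2*t-1)).const_mul 2) ?_
      try simp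
      try ring
    have a2 : HasDerivAt (fun Y : ℝ => Y * (Y - 2*j)) (2*X - 2*j) X := by
      refine HasDerivAt.congr_deriv (hid.mul (hid.sub_const (2*j))) ?_
      try simp
      try ring
    have a3 : HasDerivAt (fun Y : ℝ => 8*γ*t*(2*Y^2 - (α + 4*j)*Y + j*(α + j)))
        (8*γ*t*(4*X - (α+4*j))) X := by
      refine HasDerivAt.congr_deriv ((((((hid.pow 2).const_mul 2).sub (hid.const_mul (α+4*j))).add_const
        (j*(α+j))).const_mul (8*γ*t))) ?_
      simp only [id]
      norm_num
      try left
      try ring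
    exact (a1.mul (a2.sqrt hpos.ne')).add a3
  rw [hd.deriv] at h1
  unfold fCP gCP at h0
  have e : X * (X - 2*j) = (X-j)^2 - j^2 := by ring
  rw [e] at h0 h1 hpos
  have hs : 0 < √((X-j)^2 - j^2) := Real.sqrt_pos.2 hpos
  have hs2 : √((X-j)^2 - j^2)^2 = (X-j)^2 - j^2 := Real.sq_sqrt hpos.le
  set s := √((X-j)^2 - j^2) with hsdef
  clear_value s
  obtain ⟨u, rfl⟩ : ∃ u, X = u + j := ⟨X - j, by ring⟩
  simp only [add_sub_cancel_right] at *
  refine ⟨by linear_combination h0/2, ?_⟩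
  field_simp at h1
  have hk : 8*γ*t ≠ 0 := by positivity
  apply mul_left_cancel₀ hk
  have h2 : s * (-(8*γ*t*δ)*s^2 + 2*(2*t-1-4*γ*δ*t*u)*u + 8*γ*t*(4*u-α)*s) = 0 := by
    linear_combination (s * h1)
  linear_combination -h2 + u*h0 + 8*γ*t*(4*u-α)*hs2

lemma anti (α j : ℝ) (hj0 : 0 < j) (hjα : j < α) :
    StrictAntiOn (fun u : ℝ => (2*u^3 - 3*j^2*u + α*j^2) / √(u^2 - j^2)^3) (Set.Ioi j) := by
  have hd : ∀ u ∈ Set.Ioi j, HasDerivAt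
      (fun u : ℝ => (2*u^3 - 3*j^2*u + α*j^2) / √(u^2 - j^2)^3)
      (3*j^2*(j^2 - α*u) / √(u^2 - j^2)^5) u := by
    intro u hu
    have hu : j < u := hu
    have hpos : 0 < u^2 - j^2 := by nlinarith
    have hs : 0 < √(u^2 - j^2) := Real.sqrt_pos.2 hpos
    have hs2 : √(u^2 - j^2)^2 = u^2 - j^2 := Real.sq_sqrt hpos.le
    have hid := hasDerivAt_id u
    have a1 : HasDerivAt (fun u : ℝ => 2*u^3 - 3*j^2*u + α*j^2) (6*u^2 - 3*j^2) u := by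
      refine HasDerivAt.congr_deriv ((((hid.pow 3).const_mul 2).sub (hid.const_mul (3*j^2))).add_const (α*j^2)) ?_
      try simp
      try ring
    have a2 : HasDerivAt (fun u : ℝ => u^2 - j^2) (2*u) u := by
      refine HasDerivAt.congr_deriv ((hid.pow 2).sub_const (j^2)) ?_
      try simp
      try ring
    have a3 := a1.div ((a2.sqrt hpos.ne').pow 3) (pow_pos hs 3).ne'
    refine a3.congr_deriv ?_
    try simp only [Pi.pow_apply]
    set s := √(u^2 - j^2)
    clear_value s
    field_simp
    norm_num
    have : s^4 = (u^2-j^2)^2 := by rw [← hs2]; ring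
    first
      | linear_combination (-(6*u^2 - 3*j^2)) * hs2
      | linear_combination (6*u^2 - 3*j^2) * hs2
      | linear_combination (s^2*(6*u^2 - 3*j^2)) * hs2
  apply strictAntiOn_of_deriv_neg (convex_Ioi j)
  · exact fun u hu => (hd u hu).continuousAt.continuousWithinAt
  · intro u hu
    rw [interior_Ioi] at hu
    rw [(hd u hu).deriv]
    have hu : j < u := hu
    have hpos : 0 < u^2 - j^2 := by nlinarith
    have hs : 0 < √(u^2 - j^2) := Real.sqrt_pos.2 hpos
    apply div_neg_of_neg_of_pos _ (by positivity)
    have : j^2 - α*u < 0 := by nlinarith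
    exact mul_neg_of_pos_of_neg (by positivity) this

/-- For every fixed `j` with `0 < j < α`, there is at most one `t ∈ (0, 1]` for which
there exists `X ∈ (2j, α + j)` satisfying `f_t(X) + g_t(X) = 0` and
`f_t′(X) + g_t′(X) = 0`. -/
theorem stmt11 (α γ δ : ℝ) (hα : 0 < α) (hγ0 : 0 < γ) (hγ : γ < 1/(4*α))
    (hδ : 1/(2*γ*α) < δ)
    (j : ℝ) (hj0 : 0 < j) (hjα : j < α)
    (t₁ t₂ : ℝ) (ht₁ : t₁ ∈ Set.Ioc (0:ℝ) 1) (ht₂ : t₂ ∈ Set.Ioc (0:ℝ) 1)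
    (h₁ : ∃ X ∈ Set.Ioo (2*j) (α + j),
        fCP γ δ t₁ j X + gCP α γ t₁ j X = 0 ∧
        deriv (fun Y => fCP γ δ t₁ j Y + gCP α γ t₁ j Y) X = 0)
    (h₂ : ∃ X ∈ Set.Ioo (2*j) (α + j),
        fCP γ δ t₂ j X + gCP α γ t₂ j X = 0 ∧
        deriv (fun Y => fCP γ δ t₂ j Y + gCP α γ t₂ j Y) X = 0) :
    t₁ = t₂ := by
  obtain ⟨X, ⟨hX, -⟩, h0, h1⟩ := h₁
  obtain ⟨Y, ⟨hY, -⟩, k0, k1⟩ := h₂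
  obtain ⟨e1, e2⟩ := key_alg α γ δ j t₁ X hγ0 hj0 ht₁.1 hX h0 h1
  obtain ⟨d1, d2⟩ := key_alg α γ δ j t₂ Y hγ0 hj0 ht₂.1 hY k0 k1
  have hs : ∀ X, 2*j < X → 0 < √((X-j)^2 - j^2) := fun X hX =>
    Real.sqrt_pos.2 (by nlinarith)
  have hsX := hs X hX
  have hsY := hs Y hY
  have hXY : X - j = Y - j := by
    apply (anti α j hj0 hjα).injOn (show j < X - j by linarith) (show j < Y - j by linarith)
    simp only
    rw [← e2, ← d2, mul_div_cancel_right₀ _ (pow_pos hsX 3).ne',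
      mul_div_cancel_right₀ _ (pow_pos hsY 3).ne']
  rw [← hXY] at d1
  refine mul_right_cancel₀ ?_ (e1.trans d1.symm)
  intro hK
  rw [hK, mul_zero] at e1
  exact hsX.ne e1
end

section
/- For each t ∈ (t⁺, 1], define k_t : [0, α] → ℝ by k_t(j) = t/t⁺ − 1 − 4γt((δ − 2)j + α − √(α² − j²)). Then k_t has a unique zero j_t in (0, α), with k_t > 0 on [0, j_t) and k_t < 0 on (j_t, α]; j_t is given explicitly by j_t = [(δ−2)(2(1−4γα)t − 1) + √(16γαt(2t − 1 + γαt(δ² − 4δ + 1)) − (2t−1)²)] / (4γt(δ² − 4δ + 5)); the map t ↦ j_t is strictly increasing on (t⁺, 1]; and j_t → 0 as t → t⁺ from above. -/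
open Topology

/-- `k_t(j) = t/t⁺ − 1 − 4γt((δ − 2)j + α − √(α² − j²))`, where `t⁺ = 1/(2(1 − 2γα))`. -/
noncomputable def kCP (α γ δ t j : ℝ) : ℝ :=
  t / (1/(2*(1 - 2*γ*α))) - 1 - 4*γ*t*((δ - 2)*j + α - Real.sqrt (α^2 - j^2))

lemma kCP_eq (α γ δ t j : ℝ) : kCP α γ δ t j =
    t * (2*(1 - 2*γ*α) - 4*γ*((δ - 2)*j + α - Real.sqrt (α^2 - j^2))) - 1 := by
  unfold kCP
  rw [div_div_eq_mul_div, div_one]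
  ring

lemma kCP_anti (α γ δ t : ℝ) (hγ0 : 0 < γ) (hδ : 2 < δ) (ht : 0 < t) (x y : ℝ)
    (hx : 0 ≤ x) (hxy : x < y) : kCP α γ δ t y < kCP α γ δ t x := by
  have h1 : Real.sqrt (α^2 - y^2) ≤ Real.sqrt (α^2 - x^2) :=
    Real.sqrt_le_sqrt (by nlinarith)
  have h2 : (δ - 2) * x < (δ - 2) * y := mul_lt_mul_of_pos_left hxy (by linarith)
  unfold kCP
  have h3 : 0 < 4*γ*t := by positivity
  have := mul_lt_mul_of_pos_left (show (δ - 2)*x + α - Real.sqrt (α^2 - x^2) <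
    (δ - 2)*y + α - Real.sqrt (α^2 - y^2) by linarith) h3
  linarith

lemma core (d A B : ℝ) (hd : 0 < d) (hA : 0 < A) (h1 : -A < B) (h2 : B < d * A) :
    ∃ S : ℝ, S = Real.sqrt ((d^2+1)*A^2 - B^2) ∧ S^2 = (d^2+1)*A^2 - B^2 ∧
      0 < d*B + S ∧ 0 < d*S - B := by
  have hD : 0 ≤ (d^2+1)*A^2 - B^2 := by
    rcases le_total B 0 with h | h
    · nlinarith [mul_pos (mul_pos hd hA) (mul_pos hd hA)]
    · nlinarith [mul_pos (mul_pos hd hA) (mul_pos hd hA)]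
  refine ⟨_, rfl, Real.sq_sqrt hD, ?_, ?_⟩
  · rcases le_or_gt 0 B with h | h
    · have : 0 < Real.sqrt ((d^2+1)*A^2 - B^2) := by
        apply Real.sqrt_pos.2
        nlinarith
      nlinarith [mul_nonneg hd.le h]
    · have : -(d*B) < Real.sqrt ((d^2+1)*A^2 - B^2) := by
        apply Real.lt_sqrt_of_sq_lt
        have hBA : 0 < A^2 - B^2 := by nlinarith
        nlinarith [mul_pos (show 0 < d^2+1 by positivity) hBA]
      linarith
  · rcases le_or_gt B 0 with h | h
    · have : 0 < Real.sqrt ((d^2+1)*A^2 - B^2) := by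
        apply Real.sqrt_pos.2
        nlinarith [mul_pos (mul_pos hd hA) (mul_pos hd hA)]
      nlinarith [mul_pos hd this]
    · have : B / d < Real.sqrt ((d^2+1)*A^2 - B^2) := by
        apply Real.lt_sqrt_of_sq_lt
        rw [div_pow, div_lt_iff₀ (by positivity)]
        have hBA : 0 < (d*A)^2 - B^2 := by nlinarith
        nlinarith [mul_pos (show 0 < d^2+1 by positivity) hBA]
      rw [div_lt_iff₀ hd] at this
      linarith

lemma zero_spec (α γ δ t : ℝ) (hα : 0 < α) (hγ0 : 0 < γ) (hδ2 : 2 < δ)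
    (hδ : 1 < δ * (2*γ*α)) (ht : 0 < t) (ht1 : 1 < t * (2*(1 - 2*γ*α))) :
    0 < jCP α γ δ t ∧ jCP α γ δ t < α ∧ kCP α γ δ t (jCP α γ δ t) = 0 := by
  have hc : 0 < 4*γ*t := by positivity
  have hE : 0 < (δ-2)^2+1 := by positivity
  obtain ⟨S, hS, hS2, h1, h2⟩ := core (δ-2) (4*γ*t*α) (2*(1 - 4*γ*α)*t - 1) (by linarith)
    (by positivity) (by nlinarith) (by nlinarith)
  have hj : jCP α γ δ t = ((δ-2)*(2*(1 - 4*γ*α)*t - 1) + S) / (4*γ*t*((δ-2)^2+1)) := by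
    unfold jCP
    rw [hS]
    congr 1
    · congr 2
      ring
    · ring
  have hden : 0 < 4*γ*t*((δ-2)^2+1) := by positivity
  have hpos : 0 < jCP α γ δ t := by rw [hj]; positivity
  generalize hB : 2*(1 - 4*γ*α)*t - 1 = B at *
  set r := ((δ-2)*S - B) / (4*γ*t*((δ-2)^2+1)) with hr
  have hrpos : 0 < r := by positivity
  have hsq : α^2 - (jCP α γ δ t)^2 = r^2 := by
    rw [hj, hr, div_pow, div_pow, sub_eq_iff_eq_add, ← add_div, eq_div_iff (by positivity)]
    linear_combination (-((δ-2)^2+1)) * hS2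
  have hlt : jCP α γ δ t < α := by nlinarith
  refine ⟨hpos, hlt, ?_⟩
  have hk : kCP α γ δ t (jCP α γ δ t) =
      B + 4*γ*t*r - (δ-2)*(4*γ*t*jCP α γ δ t) := by
    rw [kCP_eq, hsq, Real.sqrt_sq hrpos.le, ← hB]
    ring
  rw [hk, hj, hr]
  field_simp
  ring

/-- For each `t ∈ (t⁺, 1]`, the function `k_t : [0, α] → ℝ` has a unique zero `j_t` in
`(0, α)`, with `k_t > 0` on `[0, j_t)` and `k_t < 0` on `(j_t, α]`; `j_t` is given by the
displayed explicit formula; `t ↦ j_t` is strictly increasing on `(t⁺, 1]`; and `j_t → 0`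
as `t → t⁺` from above. -/
theorem stmt12 (α γ δ : ℝ) (hα : 0 < α) (hγ0 : 0 < γ) (hγ : γ < 1/(4*α))
    (hδ : 1/(2*γ*α) < δ) :
    (∀ t : ℝ, 1/(2*(1 - 2*γ*α)) < t → t ≤ 1 →
      jCP α γ δ t ∈ Set.Ioo 0 α ∧
      kCP α γ δ t (jCP α γ δ t) = 0 ∧
      (∀ j : ℝ, 0 ≤ j → j < jCP α γ δ t → 0 < kCP α γ δ t j) ∧
      (∀ j : ℝ, jCP α γ δ t < j → j ≤ α → kCP α γ δ t j < 0) ∧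
      (∀ j ∈ Set.Ioo (0:ℝ) α, kCP α γ δ t j = 0 → j = jCP α γ δ t)) ∧
    StrictMonoOn (jCP α γ δ) (Set.Ioc (1/(2*(1 - 2*γ*α))) 1) ∧
    Filter.Tendsto (jCP α γ δ) (𝓝[>] (1/(2*(1 - 2*γ*α)))) (𝓝 0) := by
  have hg : γ * (4*α) < 1 := by rwa [lt_div_iff₀ (by positivity)] at hγ
  have hδ' : 1 < δ * (2*γ*α) := by rwa [div_lt_iff₀ (by positivity)] at hδ
  have hδ2 : 2 < δ := by
    have : 0 < γ * α := by positivity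
    by_contra h
    nlinarith
  have hp : 0 < 2*(1 - 2*γ*α) := by linarith
  have key : ∀ t : ℝ, 1/(2*(1 - 2*γ*α)) < t → 0 < t ∧ 0 < jCP α γ δ t ∧ jCP α γ δ t < α ∧
      kCP α γ δ t (jCP α γ δ t) = 0 := by
    intro t ht
    have ht0 : 0 < t := lt_trans (by positivity) ht
    rw [div_lt_iff₀ hp] at ht
    exact ⟨ht0, zero_spec α γ δ t hα hγ0 hδ2 hδ' ht0 ht⟩
  refine ⟨?_, ?_, ?_⟩
  · intro t ht _
    obtain ⟨ht0, h0, h1, hk⟩ := key t ht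
    have hpos : ∀ j : ℝ, 0 ≤ j → j < jCP α γ δ t → 0 < kCP α γ δ t j := fun j hj hlt => by
      have := kCP_anti α γ δ t hγ0 hδ2 ht0 j _ hj hlt
      linarith
    have hneg : ∀ j : ℝ, jCP α γ δ t < j → kCP α γ δ t j < 0 := fun j hlt => by
      have := kCP_anti α γ δ t hγ0 hδ2 ht0 _ j h0.le hlt
      linarith
    refine ⟨⟨h0, h1⟩, hk, hpos, fun j hj _ => hneg j hj, ?_⟩
    intro j hj hz
    rcases lt_trichotomy j (jCP α γ δ t) with h | h | h
    · have := hpos j hj.1.le h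
      linarith
    · exact h
    · have := hneg j h
      linarith
  · intro t ht u hu htu
    obtain ⟨ht0, h0, h1, hk⟩ := key t ht.1
    obtain ⟨hu0, h0', h1', hk'⟩ := key u hu.1
    have hlt : 0 < kCP α γ δ u (jCP α γ δ t) := by
      rw [kCP_eq] at hk ⊢
      set M := 2*(1 - 2*γ*α) - 4*γ*((δ - 2)*jCP α γ δ t + α -
        Real.sqrt (α^2 - (jCP α γ δ t)^2))
      have hM : 0 < M := by
        by_contra h
        nlinarith
      nlinarith
    by_contra h
    rcases (not_lt.1 h).lt_or_eq with h | h
    · have := kCP_anti α γ δ u hγ0 hδ2 hu0 _ _ h0'.le h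
      linarith
    · rw [← h] at hlt
      linarith
  · have hT : 0 < 1/(2*(1 - 2*γ*α)) := by positivity
    have hT1 : 1/(2*(1 - 2*γ*α)) * (2*(1 - 2*γ*α)) = 1 := div_mul_cancel₀ _ hp.ne'
    generalize 1/(2*(1 - 2*γ*α)) = T at *
    have hz : jCP α γ δ T = 0 := by
      unfold jCP
      have : 16*γ*α*T*(2*T - 1 + γ*α*T*(δ^2 - 4*δ + 1)) - (2*T - 1)^2
          = ((δ-2)*(4*γ*T*α))^2 := by
        have h2 : 2*T - 1 = 4*γ*T*α := by linarith
        rw [h2]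
        ring
      rw [this, Real.sqrt_sq (mul_nonneg (by linarith) (by positivity))]
      have h3 : (δ - 2)*(2*(1 - 4*γ*α)*T - 1) + (δ-2)*(4*γ*T*α) = 0 := by
        linear_combination (δ-2) * hT1
      rw [h3, zero_div]
    have hc : ContinuousAt (jCP α γ δ) T := by
      have hd : 4*γ*T*(δ^2 - 4*δ + 5) ≠ 0 := by
        have : 0 < δ^2 - 4*δ + 5 := by nlinarith [sq_nonneg (δ-2)]
        positivity
      unfold jCP
      exact ContinuousAt.div (by fun_prop) (by fun_prop) hd
    have := hc.tendsto
    rw [hz] at this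
    exact this.mono_left nhdsWithin_le_nhds
end

section
/- For every t ∈ [0, 1] and every j with −α < j < α, one has (1 − 2t + 4γδαt)² − 16γ²t²(α² − j²) > 0. -/
/-- For every `t ∈ [0, 1]` and every `j` with `−α < j < α`, one has
`(1 − 2t + 4γδαt)² − 16γ²t²(α² − j²) > 0`.  (This is the determinant `det(Ω⁻¹Aₜ)` at a
rank-one singular point on the ℤ₂-sphere `{z₃ = 0}` of the ℂP² family; its positivity
shows those points are nondegenerate of elliptic-regular type.) -/
theorem stmt13 (α γ δ : ℝ) (hα : 0 < α) (hγ0 : 0 < γ) (hγ : γ < 1/(4*α))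
    (hδ : 1/(2*γ*α) < δ)
    (t : ℝ) (ht0 : 0 ≤ t) (ht1 : t ≤ 1)
    (j : ℝ) (hj : -α < j) (hj' : j < α) :
    0 < (1 - 2*t + 4*γ*δ*α*t)^2 - 16*γ^2*t^2*(α^2 - j^2) := by
  have h1 : 4*γ*α < 1 := by
    rw [lt_div_iff₀ (by positivity)] at hγ
    linarith
  have h2 : 2 < 4*γ*δ*α := by
    rw [div_lt_iff₀ (by positivity)] at hδ
    linarith
  have h3 : 1 ≤ 1 - 2*t + 4*γ*δ*α*t := by
    nlinarith [mul_nonneg ht0 (sub_pos.mpr h2).le]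
  have h4 : 0 ≤ 4*γ*α*t := by positivity
  have h5 : 4*γ*α*t < 1 := by
    have h6 : 0 ≤ 4*γ*α := by positivity
    nlinarith [mul_nonneg h6 (sub_nonneg.mpr ht1)]
  have h7 : (4*γ*α*t)^2 < (1 - 2*t + 4*γ*δ*α*t)^2 :=
    pow_lt_pow_left₀ (lt_of_lt_of_le h5 h3) h4 two_ne_zero
  have h8 : 0 ≤ (4*γ*t*j)^2 := sq_nonneg _
  have h9 : 16*γ^2*t^2*(α^2 - j^2) = (4*γ*α*t)^2 - (4*γ*t*j)^2 := by ring
  rw [h9]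
  linarith
end
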